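/- Let T be a near-triangulation of order n ≥ 5 with boundary cycle C = (u_1, ..., u_h, u_1), and let u_i be a boundary vertex. If all neighbors of u_i lie on C, then both boundary edges (u_{i−1}, u_i) and (u_i, u_{i+1}) are contractible in T. -/

import Mathlib

/-!
Common definitions.

A *plane graph* is a finite graph whose vertices are points of the plane `ℝ × ℝ` and whose
edges are drawn as straight-line segments between their endpoints (by Fáry's theorem every
planar graph admits such a drawing).  A *near-triangulation* is a plane graph that is properly
embedded, biconnected, and all of whose bounded faces are triangles (the faces are the
connected components of the complement of the drawing).  The boundary cycle lists, cyclically,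
the vertices on the outer (unbounded) face.
-/

open scoped Classical

noncomputable section

/-- A finite graph drawn in the plane: the vertices are points of `ℝ × ℝ` and each edge is
drawn as the straight-line segment between its endpoints. -/
structure PlaneGraph where
  verts : Finset (ℝ × ℝ)
  Adj : ℝ × ℝ → ℝ × ℝ → Prop
  symm : ∀ p q, Adj p q → Adj q p
  loopless : ∀ p, ¬ Adj p p
  mem_of_adj : ∀ p q, Adj p q → p ∈ verts ∧ q ∈ verts

namespace PlaneGraph

variable (G : PlaneGraph)

/-- The union of the (closed) segments realizing the edges of the graph. -/
def drawing : Set (ℝ × ℝ) := {x | ∃ p q, G.Adj p q ∧ x ∈ segment ℝ p q}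

/-- The straight-line drawing is a proper plane embedding: two edges meet only in common
endpoints and no vertex lies on an edge of which it is not an endpoint. -/
def IsEmbedded : Prop :=
  (∀ p q r s, G.Adj p q → G.Adj r s → ∀ x, x ∈ segment ℝ p q → x ∈ segment ℝ r s →
      ({p, q} : Set (ℝ × ℝ)) = {r, s} ∨
        (x ∈ ({p, q} : Set (ℝ × ℝ)) ∧ x ∈ ({r, s} : Set (ℝ × ℝ)))) ∧
  (∀ p q v, G.Adj p q → v ∈ G.verts → v ∈ segment ℝ p q → v = p ∨ v = q)

/-- Reachability by walks in the graph. -/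
def Reachable (p q : ℝ × ℝ) : Prop := Relation.ReflTransGen G.Adj p q

/-- The graph is connected. -/
def Connected : Prop := G.verts.Nonempty ∧ ∀ p ∈ G.verts, ∀ q ∈ G.verts, G.Reachable p q

/-- Deletion of a set of vertices together with all incident edges. -/
def deleteVerts (S : Finset (ℝ × ℝ)) : PlaneGraph where
  verts := G.verts \ S
  Adj := fun p q => G.Adj p q ∧ p ∉ S ∧ q ∉ S
  symm := fun p q h => ⟨G.symm p q h.1, h.2.2, h.2.1⟩
  loopless := fun p h => G.loopless p h.1
  mem_of_adj := fun p q h => by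
    obtain ⟨h1, h2⟩ := G.mem_of_adj p q h.1
    exact ⟨Finset.mem_sdiff.mpr ⟨h1, h.2.1⟩, Finset.mem_sdiff.mpr ⟨h2, h.2.2⟩⟩

/-- Deletion of a single edge (keeping all vertices). -/
def deleteEdge (p q : ℝ × ℝ) : PlaneGraph where
  verts := G.verts
  Adj := fun a b => G.Adj a b ∧ ¬ ((a = p ∧ b = q) ∨ (a = q ∧ b = p))
  symm := fun a b h => ⟨G.symm a b h.1, by tauto⟩
  loopless := fun a h => G.loopless a h.1
  mem_of_adj := fun a b h => G.mem_of_adj a b h.1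

/-- The (abstract, simple) graph obtained by contracting the edge `(p, q)`:
the vertex `q` is merged into `p`, which becomes the new contracted vertex. -/
def contractEdge (p q : ℝ × ℝ) : PlaneGraph where
  verts := G.verts.erase q
  Adj := fun a b =>
    a ≠ b ∧ a ∈ G.verts.erase q ∧ b ∈ G.verts.erase q ∧
      (G.Adj a b ∨ (a = p ∧ G.Adj q b) ∨ (b = p ∧ G.Adj q a))
  symm := fun a b h => by
    obtain ⟨h1, h2, h3, h4⟩ := h
    refine ⟨h1.symm, h3, h2, ?_⟩
    rcases h4 with h4 | h4 | h4
    · exact Or.inl (G.symm _ _ h4)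
    · exact Or.inr (Or.inr h4)
    · exact Or.inr (Or.inl h4)
  loopless := fun a h => h.1 rfl
  mem_of_adj := fun a b h => ⟨h.2.1, h.2.2.1⟩

/-- Biconnectivity: at least three vertices, connected, and deleting any single vertex leaves
a connected graph. -/
def Biconnected : Prop :=
  3 ≤ G.verts.card ∧ G.Connected ∧ ∀ v ∈ G.verts, (G.deleteVerts {v}).Connected

/-- A face of the plane graph: a connected component of the complement of the drawing. -/
def IsFace (F : Set (ℝ × ℝ)) : Prop :=
  ∃ x, x ∉ G.drawing ∧ F = connectedComponentIn G.drawingᶜ x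

/-- The open triangle with the three given corners. -/
def openTriangle (a b c : ℝ × ℝ) : Set (ℝ × ℝ) :=
  interior (convexHull ℝ ({a, b, c} : Set (ℝ × ℝ)))

/-- Every bounded (inner) face of the drawing is a triangular face of the graph. -/
def InnerFacesTriangles : Prop :=
  ∀ F, G.IsFace F → Bornology.IsBounded F →
    ∃ a ∈ G.verts, ∃ b ∈ G.verts, ∃ c ∈ G.verts,
      G.Adj a b ∧ G.Adj b c ∧ G.Adj a c ∧ F = openTriangle a b c

/-- A near-triangulation: a properly embedded biconnected plane graph all of whose faces are
triangles, except possibly the outer (unbounded) face. -/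
def IsNearTriangulation : Prop :=
  G.IsEmbedded ∧ G.Biconnected ∧ G.InnerFacesTriangles

/-- The outer region: the union of the unbounded components of the complement of the
drawing (for a near-triangulation this is the outer face). -/
def outerRegion : Set (ℝ × ℝ) :=
  {x | x ∉ G.drawing ∧ ¬ Bornology.IsBounded (connectedComponentIn G.drawingᶜ x)}

/-- `u : ZMod h → ℝ × ℝ` is the boundary cycle of `G`: an injective cyclic sequence
`u 0, u 1, …, u (h-1)` of vertices, consecutive ones adjacent, whose edges bound the outer
face and which contains every vertex lying on the boundary of the outer face. -/
def IsBoundaryCycle {h : ℕ} (u : ZMod h → ℝ × ℝ) : Prop :=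
  3 ≤ h ∧ Function.Injective u ∧
  (∀ i, u i ∈ G.verts) ∧
  (∀ i, G.Adj (u i) (u (i + 1))) ∧
  (∀ i, segment ℝ (u i) (u (i + 1)) ⊆ frontier G.outerRegion) ∧
  (∀ v ∈ G.verts, (v : ℝ × ℝ) ∈ frontier G.outerRegion → v ∈ Set.range u)

/-- An interior vertex: a vertex not on the boundary cycle. -/
def IsInteriorVtx {h : ℕ} (u : ZMod h → ℝ × ℝ) (v : ℝ × ℝ) : Prop :=
  v ∈ G.verts ∧ v ∉ Set.range u

/-- The edge `(p, q)` is a diagonal: it joins two non-consecutive boundary vertices. -/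
def IsDiagonalEdge {h : ℕ} (u : ZMod h → ℝ × ℝ) (p q : ℝ × ℝ) : Prop :=
  G.Adj p q ∧ ∃ i j : ZMod h, p = u i ∧ q = u j ∧ j ≠ i + 1 ∧ i ≠ j + 1

/-- The graph has no diagonals: any edge between boundary vertices joins consecutive ones. -/
def HasNoDiagonals {h : ℕ} (u : ZMod h → ℝ × ℝ) : Prop :=
  ∀ i j : ZMod h, G.Adj (u i) (u j) → j = i + 1 ∨ i = j + 1

/-- The degree of a vertex. -/
def degree (v : ℝ × ℝ) : ℕ := (G.verts.filter (fun w => G.Adj v w)).card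

/-- The degree of a vertex in the subgraph induced on the set `S` of vertices. -/
def degreeOn (S : Set (ℝ × ℝ)) (v : ℝ × ℝ) : ℕ :=
  (G.verts.filter (fun w => G.Adj v w ∧ w ∈ S)).card

/-- A total dominating set: every vertex of the graph is adjacent to a member of `D`. -/
def IsTDS (D : Finset (ℝ × ℝ)) : Prop :=
  D ⊆ G.verts ∧ ∀ v ∈ G.verts, ∃ d ∈ D, G.Adj v d

/-- The total domination number `γₜ`. -/
def totalDominationNumber : ℕ :=
  sInf {k | ∃ D : Finset (ℝ × ℝ), G.IsTDS D ∧ D.card = k}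

/-- Isomorphism of plane graphs as abstract graphs. -/
def IsIsoTo (H : PlaneGraph) : Prop :=
  ∃ f : ℝ × ℝ → ℝ × ℝ,
    Set.BijOn f (↑G.verts) (↑H.verts) ∧
    ∀ p ∈ G.verts, ∀ q ∈ G.verts, (G.Adj p q ↔ H.Adj (f p) (f q))

/-- The edge `(p, q)` is contractible: the contracted graph `G/e` is (abstractly isomorphic
to) a near-triangulation. -/
def IsContractible (p q : ℝ × ℝ) : Prop :=
  G.Adj p q ∧ ∃ H : PlaneGraph, H.IsNearTriangulation ∧ (G.contractEdge p q).IsIsoTo H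

/-- A separating triangle: a triangle of the graph with some vertex strictly inside it and
some vertex outside it. -/
def IsSeparatingTriangle (a b c : ℝ × ℝ) : Prop :=
  a ∈ G.verts ∧ b ∈ G.verts ∧ c ∈ G.verts ∧
  G.Adj a b ∧ G.Adj b c ∧ G.Adj a c ∧
  (∃ v ∈ G.verts, v ∈ openTriangle a b c) ∧
  (∃ v ∈ G.verts, v ∉ convexHull ℝ ({a, b, c} : Set (ℝ × ℝ)))

/-- Edge list of the first exceptional 12-vertex maximal outerplanar graph `H₁`
(boundary 12-cycle, central triangle `{0,4,8}`, ear triangles `{1,2,3}`, `{5,6,7}`,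
`{9,10,11}`, and the three remaining quadrilateral diagonals, all with the same
orientation). -/
def exc1Edges : List (Fin 12 × Fin 12) :=
  [(0,1),(1,2),(2,3),(3,4),(4,5),(5,6),(6,7),(7,8),(8,9),(9,10),(10,11),(11,0),
   (0,4),(4,8),(0,8),(1,3),(5,7),(9,11),(0,3),(4,7),(8,11)]

/-- Edge list of the second exceptional 12-vertex maximal outerplanar graph `H₂`
(same as `H₁` except that one quadrilateral diagonal has the opposite orientation). -/
def exc2Edges : List (Fin 12 × Fin 12) :=
  [(0,1),(1,2),(2,3),(3,4),(4,5),(5,6),(6,7),(7,8),(8,9),(9,10),(10,11),(11,0),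
   (0,4),(4,8),(0,8),(1,3),(5,7),(9,11),(0,3),(4,7),(0,9)]

/-- The exceptional graph `H₁`. -/
def H1graph : SimpleGraph (Fin 12) := SimpleGraph.fromRel (fun a b => (a, b) ∈ exc1Edges)

/-- The exceptional graph `H₂`. -/
def H2graph : SimpleGraph (Fin 12) := SimpleGraph.fromRel (fun a b => (a, b) ∈ exc2Edges)

/-- Isomorphism between a plane graph and a simple graph on `Fin 12`. -/
def IsIsoToSG (H : SimpleGraph (Fin 12)) : Prop :=
  ∃ f : ℝ × ℝ → Fin 12,
    Set.BijOn f (↑G.verts) Set.univ ∧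
    ∀ p ∈ G.verts, ∀ q ∈ G.verts, (G.Adj p q ↔ H.Adj (f p) (f q))

/-- `G` is isomorphic to `H₁` or to `H₂`. -/
def IsExceptional : Prop := G.IsIsoToSG H1graph ∨ G.IsIsoToSG H2graph

/-- A maximal outerplanar graph (MOP): a near-triangulation all of whose vertices lie on the
boundary cycle. -/
def IsMOP : Prop :=
  G.IsNearTriangulation ∧
    ∃ (h : ℕ) (u : ZMod h → ℝ × ℝ), G.IsBoundaryCycle u ∧ ∀ v ∈ G.verts, v ∈ Set.range u

/-- The graph is Hamiltonian: it has a cycle through all of its vertices. -/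
def IsHamiltonian : Prop :=
  ∃ (m : ℕ) (c : ZMod m → ℝ × ℝ), 3 ≤ m ∧ Function.Injective c ∧
    (∀ i, G.Adj (c i) (c (i + 1))) ∧ ∀ v ∈ G.verts, v ∈ Set.range c

/-- An outerplane graph: a properly embedded plane graph all of whose vertices lie on the
boundary of the outer region. -/
def IsOuterplane : Prop :=
  G.IsEmbedded ∧ ∀ v ∈ G.verts, (v : ℝ × ℝ) ∈ closure G.outerRegion

/-- The union of the boundary-cycle segments. -/
def boundaryDrawing {h : ℕ} (u : ZMod h → ℝ × ℝ) : Set (ℝ × ℝ) :=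
  ⋃ i : ZMod h, segment ℝ (u i) (u (i + 1))

/-- The open interior of the boundary cycle, viewed as a simple closed polygon. -/
def polygonInterior {h : ℕ} (u : ZMod h → ℝ × ℝ) : Set (ℝ × ℝ) :=
  {x | x ∉ boundaryDrawing u ∧
    Bornology.IsBounded (connectedComponentIn (boundaryDrawing u)ᶜ x)}

/-- The union of the segments realizing the diagonals of `G[C]`. -/
def diagonalDrawing {h : ℕ} (u : ZMod h → ℝ × ℝ) : Set (ℝ × ℝ) :=
  {x | ∃ i j : ZMod h, G.Adj (u i) (u j) ∧ j ≠ i + 1 ∧ i ≠ j + 1 ∧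
    x ∈ segment ℝ (u i) (u j)}

/-- A region of the subdivision of the interior of the boundary cycle by the diagonals of
`G[C]`: a connected component of the interior of the cycle minus the diagonals. -/
def IsSubdivisionRegion {h : ℕ} (u : ZMod h → ℝ × ℝ) (R : Set (ℝ × ℝ)) : Prop :=
  ∃ x ∈ polygonInterior u \ G.diagonalDrawing u,
    R = connectedComponentIn (polygonInterior u \ G.diagonalDrawing u) x

/-- The diagonal `(u i, u j)` is a side of the region `R`. -/
def IsSideOf {h : ℕ} (u : ZMod h → ℝ × ℝ) (R : Set (ℝ × ℝ)) (i j : ZMod h) : Prop :=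
  G.Adj (u i) (u j) ∧ j ≠ i + 1 ∧ i ≠ j + 1 ∧
    segment ℝ (u i) (u j) \ {u i, u j} ⊆ frontier R

/-- `v` lies on the opposite side of the diagonal `(u i, u j)` from the region `R`:
inside the boundary polygon, `v` cannot be joined to `R` without crossing the diagonal. -/
def OppositeSideOf {h : ℕ} (u : ZMod h → ℝ × ℝ) (R : Set (ℝ × ℝ)) (i j : ZMod h)
    (v : ℝ × ℝ) : Prop :=
  ∀ x ∈ R, v ∉ connectedComponentIn (polygonInterior u \ segment ℝ (u i) (u j)) x

/-- A terminal polygon: a region of the subdivision containing some interior vertex such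
that at most one of its sides has interior vertices of `G` on its opposite side
(i.e. at most one of the outer parts `T_out(P,d)` contains interior vertices). -/
def IsTerminalPolygon {h : ℕ} (u : ZMod h → ℝ × ℝ) (R : Set (ℝ × ℝ)) : Prop :=
  G.IsSubdivisionRegion u R ∧
  (∃ v, G.IsInteriorVtx u v ∧ v ∈ R) ∧
  ∀ i j k l : ZMod h,
    G.IsSideOf u R i j → G.IsSideOf u R k l →
    (∃ w, G.IsInteriorVtx u w ∧ OppositeSideOf u R i j w) →
    (∃ w, G.IsInteriorVtx u w ∧ OppositeSideOf u R k l w) →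
    ({u i, u j} : Set (ℝ × ℝ)) = {u k, u l}

/-- An irreducible near-triangulation: it has interior vertices, and for every boundary edge
`(u i, u (i+1))` the third vertex of the inner triangular face containing this edge also lies
on the boundary cycle. -/
def Irreducible {h : ℕ} (u : ZMod h → ℝ × ℝ) : Prop :=
  (∃ v, G.IsInteriorVtx u v) ∧
  ∀ i : ZMod h, ∀ v ∈ G.verts,
    G.Adj (u i) v → G.Adj (u (i + 1)) v →
    G.IsFace (openTriangle (u i) (u (i + 1)) v) → v ∈ Set.range u

end PlaneGraph

/-- An oriented triangulated planar piece, given combinatorially: `Tri x y z` says that `x, y, z`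
is an inner triangular face listed counterclockwise.  The graph has no cut vertex, and every
even edge set `ζ` is the boundary of a set of faces, recorded by the faces to the left of the
darts. -/
structure TriangulatedDisk (α : Type*) where
  verts : Finset α
  Adj : α → α → Prop
  Tri : α → α → α → Prop
  adj_symm : ∀ {x y}, Adj x y → Adj y x
  adj_irrefl : ∀ x, ¬ Adj x x
  adj_mem : ∀ {x y}, Adj x y → x ∈ verts
  tri_adj : ∀ {x y z}, Tri x y z → Adj x y
  tri_rotate : ∀ {x y z}, Tri x y z → Tri y z x
  tri_unique : ∀ {x y z z'}, Tri x y z → Tri x y z' → z = z'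
  connected_delete : ∀ (c : α) (K : Set α), (∀ x ∈ K, x ∈ verts) → c ∉ K → K.Nonempty →
    (∀ x ∈ K, ∀ y, Adj x y → y ≠ c → y ∈ K) → ∀ y ∈ verts, y ≠ c → y ∈ K
  bounding : ∀ ζ : α → α → ZMod 2, (∀ x y, ζ x y = ζ y x) → (∀ x y, ζ x y ≠ 0 → Adj x y) →
    (∀ x, ∑ y ∈ verts, ζ x y = 0) →
    ∃ φ : α → α → ZMod 2,
      (∀ x y, Adj x y → (∀ z, ¬ Tri x y z) → φ x y = 0) ∧
      (∀ x y z, Tri x y z → φ x y = φ y z) ∧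
      (∀ x y, Adj x y → φ x y + φ y x = ζ x y)

namespace TriangulatedDisk

variable {α : Type*} (D : TriangulatedDisk α)

/-- The dart `x → y` has the outer face on its left. -/
def Outer (x y : α) : Prop := D.Adj x y ∧ ∀ z, ¬ D.Tri x y z

/-- The indicator of the edge `ab`, as a mod 2 chain. -/
def edgeChain (a b x y : α) : ZMod 2 := if (x = a ∧ y = b) ∨ (x = b ∧ y = a) then 1 else 0

lemma edgeChain_symm (a b x y : α) : edgeChain a b x y = edgeChain a b y x := by
  unfold edgeChain
  congr 1
  apply propext
  tauto

lemma sum_edgeChain {V : Finset α} {a b : α} (ha : a ∈ V) (hb : b ∈ V) (hab : a ≠ b) (x : α) :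
    ∑ y ∈ V, edgeChain a b x y = (if x = a then 1 else 0) + (if x = b then 1 else 0) := by
  by_cases hxa : x = a
  · subst hxa
    simp [edgeChain, hab, hb]
  · by_cases hxb : x = b
    · subst hxb
      simp [edgeChain, hxa, ha]
    · simp [edgeChain, hxa, hxb]

lemma edgeChain_adj {a b : α} (hab : D.Adj a b) {x y : α} (h : edgeChain a b x y ≠ 0) :
    D.Adj x y ∧ (x = a ∧ y = b ∨ x = b ∧ y = a) := by
  unfold edgeChain at h
  split_ifs at h with hc
  · refine ⟨?_, hc⟩
    rcases hc with ⟨rfl, rfl⟩ | ⟨rfl, rfl⟩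
    · exact hab
    · exact D.adj_symm hab
  · exact absurd rfl h

lemma adj_mem_right {x y : α} (h : D.Adj x y) : y ∈ D.verts := D.adj_mem (D.adj_symm h)

lemma ne_of_adj {x y : α} (h : D.Adj x y) : x ≠ y := by
  rintro rfl
  exact D.adj_irrefl _ h

/-- Two vertices different from `z` are the boundary of a chain avoiding `z`. -/
lemma exists_chain_avoiding (z s t : α) (hs : s ∈ D.verts) (ht : t ∈ D.verts) (hsz : s ≠ z)
    (htz : t ≠ z) :
    ∃ η : α → α → ZMod 2, (∀ x y, η x y = η y x) ∧
      (∀ x y, η x y ≠ 0 → D.Adj x y ∧ x ≠ z ∧ y ≠ z) ∧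
      ∀ x, ∑ y ∈ D.verts, η x y = (if x = s then 1 else 0) + (if x = t then 1 else 0) := by
  refine (D.connected_delete z {t | t ∈ D.verts ∧ t ≠ z ∧ ∃ η : α → α → ZMod 2,
      (∀ x y, η x y = η y x) ∧ (∀ x y, η x y ≠ 0 → D.Adj x y ∧ x ≠ z ∧ y ≠ z) ∧
      ∀ x, ∑ y ∈ D.verts, η x y = (if x = s then 1 else 0) + (if x = t then 1 else 0)}
      (fun x hx => hx.1) (fun h => h.2.1 rfl) ⟨s, hs, hsz, 0, ?_, ?_, ?_⟩ ?_ t ht htz).2.2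
  · simp
  · simp
  · intro x
    simp [CharTwo.add_self_eq_zero]
  · rintro x ⟨hx, hxz, η, h1, h2, h3⟩ y hxy hyz
    refine ⟨D.adj_mem_right hxy, hyz, fun p q => η p q + edgeChain x y p q, ?_, ?_, ?_⟩
    · intro p q
      beta_reduce
      rw [h1, edgeChain_symm]
    · intro p q hpq
      beta_reduce at hpq
      by_cases h0 : η p q = 0
      · rw [h0, zero_add] at hpq
        obtain ⟨h4, h5⟩ := D.edgeChain_adj hxy hpq
        refine ⟨h4, ?_⟩
        rcases h5 with ⟨rfl, rfl⟩ | ⟨rfl, rfl⟩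
        · exact ⟨hxz, hyz⟩
        · exact ⟨hyz, hxz⟩
      · exact h2 p q h0
    · intro p
      rw [Finset.sum_add_distrib, h3, sum_edgeChain hx (D.adj_mem_right hxy) (D.ne_of_adj hxy)]
      have : ∀ a b c : ZMod 2, (a + b) + (b + c) = a + c := by decide
      exact this _ _ _

lemma tri_rotate' {x y z : α} (h : D.Tri x y z) : D.Tri z x y := D.tri_rotate (D.tri_rotate h)

lemma tri_pred_unique {z w w' v : α} (h₁ : D.Tri z w v) (h₂ : D.Tri z w' v) : w = w' :=
  D.tri_unique (D.tri_rotate' h₁) (D.tri_rotate' h₂)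

/-- The faces around a vertex `z` link all neighbours of `z` into a single orbit. -/
lemma link_single_orbit {z : α} (S : Set α) (hS : ∀ w ∈ S, D.Adj z w)
    (hne : S.Nonempty) (hσ : ∀ w w', D.Tri z w w' → (w ∈ S ↔ w' ∈ S)) :
    ∀ w, D.Adj z w → w ∈ S := by
  intro t ht
  by_contra htS
  obtain ⟨s, hs⟩ := hne
  have hzs := hS s hs
  have hzV := D.adj_mem hzs
  obtain ⟨η, h1, h2, h3⟩ := D.exists_chain_avoiding z s t (D.adj_mem_right hzs)
    (D.adj_mem_right ht) (D.ne_of_adj hzs).symm (D.ne_of_adj ht).symm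
  obtain ⟨φ, hφ0, hφt, hφe⟩ := D.bounding
    (fun p q => η p q + (edgeChain z s p q + edgeChain z t p q)) (by
      intro x y
      rw [h1, edgeChain_symm z s, edgeChain_symm z t]) (by
      intro p q hpq
      by_cases h0 : η p q = 0
      · by_cases h0' : edgeChain z s p q = 0
        · rw [h0, h0', zero_add, zero_add] at hpq
          exact (D.edgeChain_adj ht hpq).1
        · exact (D.edgeChain_adj hzs h0').1
      · exact (h2 p q h0).1) (by
      intro x
      rw [Finset.sum_add_distrib, Finset.sum_add_distrib, h3,
        sum_edgeChain hzV (D.adj_mem_right hzs) (D.ne_of_adj hzs),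
        sum_edgeChain hzV (D.adj_mem_right ht) (D.ne_of_adj ht)]
      have : ∀ a b c : ZMod 2, (a + b) + ((c + a) + (c + b)) = 0 := by decide
      exact this _ _ _)
  obtain ⟨F, hFS⟩ : ∃ F : Finset α, ∀ w, w ∈ F ↔ w ∈ S :=
    ⟨D.verts.filter (· ∈ S), fun w => by
      simp only [Finset.mem_filter, and_iff_right_iff_imp]
      exact fun h => D.adj_mem_right (hS w h)⟩
  have e1 : ∑ w ∈ F, (φ z w + φ w z) = 1 := by
    have : ∀ w ∈ F, φ z w + φ w z = if w = s then 1 else 0 := by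
      intro w hw
      rw [hFS] at hw
      have hzw := D.ne_of_adj (hS w hw)
      rw [hφe z w (hS w hw)]
      have e0 : η z w = 0 := by
        by_contra h0
        exact (h2 _ _ h0).2.1 rfl
      have hwt : w ≠ t := by
        rintro rfl
        exact htS hw
      simp [e0, edgeChain, hwt, hzw.symm]
    rw [Finset.sum_congr rfl this]
    simp [(hFS s).2 hs]
  have e2 : ∑ w ∈ F, φ z w = ∑ w ∈ F, φ w z := by
    have hl : ∑ w ∈ F, φ z w = ∑ w ∈ F with ∃ w', D.Tri z w w', φ z w := by
      rw [Finset.sum_filter_of_ne]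
      intro w hw h0
      by_contra hcon
      push Not at hcon
      exact h0 (hφ0 _ _ (hS w ((hFS w).1 hw)) hcon)
    have hr : ∑ w ∈ F, φ w z = ∑ w ∈ F with ∃ w', D.Tri w z w', φ w z := by
      rw [Finset.sum_filter_of_ne]
      intro w hw h0
      by_contra hcon
      push Not at hcon
      exact h0 (hφ0 _ _ (D.adj_symm (hS w ((hFS w).1 hw))) hcon)
    rw [hl, hr]
    refine Finset.sum_bij (fun w hw => (Finset.mem_filter.1 hw).2.choose) ?_ ?_ ?_ ?_
    · intro w hw
      have hT := (Finset.mem_filter.1 hw).2.choose_spec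
      have hwF := (Finset.mem_filter.1 hw).1
      rw [Finset.mem_filter, hFS]
      exact ⟨(hσ _ _ hT).1 ((hFS _).1 hwF), w, D.tri_rotate' hT⟩
    · intro w hw w' hw' he
      have hT := (Finset.mem_filter.1 hw).2.choose_spec
      have hT' := (Finset.mem_filter.1 hw').2.choose_spec
      rw [← he] at hT'
      exact D.tri_pred_unique hT hT'
    · intro w hw
      obtain ⟨w', hT⟩ := (Finset.mem_filter.1 hw).2
      have hwF := (Finset.mem_filter.1 hw).1
      have hT' := D.tri_rotate hT
      have hm : w' ∈ F.filter (fun w => ∃ w', D.Tri z w w') := by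
        rw [Finset.mem_filter, hFS]
        exact ⟨(hσ _ _ hT').2 ((hFS _).1 hwF), w, hT'⟩
      exact ⟨w', hm, D.tri_unique (Finset.mem_filter.1 hm).2.choose_spec hT'⟩
    · intro w hw
      have hT := (Finset.mem_filter.1 hw).2.choose_spec
      exact (hφt _ _ _ (D.tri_rotate' hT)).symm
  rw [Finset.sum_add_distrib, e2, CharTwo.add_self_eq_zero] at e1
  exact absurd e1 (by decide)

/-- A vertex with an outgoing outer dart has an incoming one. -/
lemma exists_outer_in {z w : α} (h : D.Outer z w) : ∃ v, D.Outer v z := by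
  by_contra hcon
  push Not at hcon
  set N := D.verts.filter (D.Adj z) with hN
  have hpred : ∀ v ∈ N, ∃ v' ∈ N, D.Tri z v' v := by
    intro v hv
    have hv' := (Finset.mem_filter.1 hv).2
    have : ∃ v', D.Tri v z v' := by
      by_contra h0
      push Not at h0
      exact hcon v ⟨D.adj_symm hv', h0⟩
    obtain ⟨v', hT⟩ := this
    have hT' := D.tri_rotate hT
    exact ⟨v', Finset.mem_filter.2 ⟨D.adj_mem_right (D.tri_adj hT'), D.tri_adj hT'⟩, hT'⟩
  choose! g hgN hgT using hpred
  have hinj : Set.InjOn g N := by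
    intro v hv v' hv' he
    have h1 := hgT v hv
    have h2 := hgT v' hv'
    rw [he] at h1
    exact D.tri_unique h1 h2
  have hsurj := Finset.surj_on_of_inj_on_of_card_le (s := N) (t := N) (fun a _ => g a) hgN
    (fun a b ha hb => hinj ha hb) le_rfl
  obtain ⟨v, hv, hvw⟩ := hsurj w (Finset.mem_filter.2 ⟨D.adj_mem_right h.1, h.1⟩)
  exact h.2 v (by rw [hvw]; exact hgT v hv)

/-- The neighbours of an outer vertex `z`, listed in clockwise order from one outer dart at `z` to
the other. -/
lemma exists_link_list {z w₁ : α} (h : D.Outer w₁ z) :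
    ∃ l : List α, l.Nodup ∧ l.IsChain (fun a b => D.Tri z a b) ∧ (∀ w, w ∈ l ↔ D.Adj z w) ∧
      l.head? = some w₁ ∧ (∀ w ∈ l, (∀ v, ¬ D.Tri z w v) ↔ l.getLast? = some w) := by
  have key : ∀ n : ℕ, ∀ l : List α, D.verts.card - l.length = n → l.Nodup →
      l.IsChain (fun a b => D.Tri z b a) → (∀ w ∈ l, D.Adj z w) → l.getLast? = some w₁ →
      ∃ l : List α, l.Nodup ∧ l.IsChain (fun a b => D.Tri z b a) ∧ (∀ w ∈ l, D.Adj z w) ∧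
        l.getLast? = some w₁ ∧ ∀ w, l.head? = some w → ∀ v, D.Tri z w v → v ∈ l := by
    intro n
    induction n with
    | zero =>
      intro l hn hnd hc hadj hlast
      refine ⟨l, hnd, hc, hadj, hlast, ?_⟩
      intro w _ v hv
      have hsub : l.toFinset ⊆ D.verts := fun x hx => D.adj_mem_right (hadj x (by simpa using hx))
      have heq := Finset.eq_of_subset_of_card_le hsub (by
        rw [List.toFinset_card_of_nodup hnd]
        omega)
      have : v ∈ D.verts := D.adj_mem (D.tri_adj (D.tri_rotate' hv))
      rw [← heq] at this
      simpa using this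
    | succ n ih =>
      intro l hn hnd hc hadj hlast
      by_cases hmax : ∀ w, l.head? = some w → ∀ v, D.Tri z w v → v ∈ l
      · exact ⟨l, hnd, hc, hadj, hlast, hmax⟩
      · push Not at hmax
        obtain ⟨w, hw, v, hv, hvl⟩ := hmax
        match l, hw with
        | w' :: l', hw =>
          simp only [List.head?_cons, Option.some.injEq] at hw
          subst hw
          refine ih (v :: w' :: l') ?_ ?_ ?_ ?_ ?_
          · simp only [List.length_cons] at hn ⊢
            omega
          · exact List.nodup_cons.2 ⟨hvl, hnd⟩
          · exact List.isChain_cons_cons.2 ⟨hv, hc⟩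
          · intro x hx
            rcases List.mem_cons.1 hx with rfl | hx
            · exact D.adj_symm (D.tri_adj (D.tri_rotate' hv))
            · exact hadj x hx
          · simpa [List.getLast?_cons_cons] using hlast
  obtain ⟨l, hnd, hc, hadj, hlast, hmax⟩ := key _ [w₁] rfl (by simp) (by simp)
    (by simpa using D.adj_symm h.1) (by simp)
  have hw₁ : ∀ v, ¬ D.Tri z v w₁ := fun v hv => h.2 _ (D.tri_rotate' hv)
  have hmem₁ : w₁ ∈ l := List.mem_of_getLast? hlast
  -- the head of `l` has no successor
  have hhead : ∀ w, l.head? = some w → ∀ v, ¬ D.Tri z w v := by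
    intro w hw v hv
    have hvl := hmax w hw v hv
    obtain ⟨l₁, l₂, rfl⟩ := List.append_of_mem hvl
    match l₂ with
    | [] =>
      simp only [List.getLast?_append, List.getLast?_singleton, Option.some_or,
        Option.some.injEq] at hlast
      exact hw₁ w (hlast ▸ hv)
    | a :: l₂ =>
      have hva : D.Tri z a v := by
        have := (List.isChain_append.1 hc).2.1
        exact (List.isChain_cons_cons.1 this).1
      have hwa : w = a := D.tri_pred_unique hv hva
      subst hwa
      match l₁, hw with
      | [], hw =>
        simp only [List.nil_append, List.head?_cons, Option.some.injEq] at hw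
        subst hw
        simp at hnd
      | b :: l₁, hw =>
        simp only [List.cons_append, List.head?_cons, Option.some.injEq] at hw
        subst hw
        simp at hnd
  have hpairs : ∀ w ∈ l, l.head? = some w ∨ ∃ v ∈ l, D.Tri z w v := by
    intro w hw
    obtain ⟨l₁, l₂, rfl⟩ := List.append_of_mem hw
    rcases List.eq_nil_or_concat l₁ with rfl | ⟨l₁, b, rfl⟩
    · simp
    · right
      refine ⟨b, by simp, ?_⟩
      rw [List.concat_eq_append, List.append_assoc] at hc
      have := (List.isChain_append.1 hc).2.1
      exact (List.isChain_cons_cons.1 this).1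
  have hpairs' : ∀ w ∈ l, w = w₁ ∨ ∃ v ∈ l, D.Tri z v w := by
    intro w hw
    obtain ⟨l₁, l₂, rfl⟩ := List.append_of_mem hw
    match l₂ with
    | [] =>
      left
      simpa using hlast
    | a :: l₂ =>
      right
      refine ⟨a, by simp, ?_⟩
      have := (List.isChain_append.1 hc).2.1
      exact (List.isChain_cons_cons.1 this).1
  have hall := D.link_single_orbit (z := z) {w | w ∈ l} hadj ⟨w₁, hmem₁⟩ (by
    intro w w' hT
    constructor
    · intro hw
      rcases hpairs w hw with h0 | ⟨v, hv, hTv⟩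
      · exact absurd hT (hhead w h0 w')
      · rw [D.tri_unique hT hTv]
        exact hv
    · intro hw
      rcases hpairs' w' hw with rfl | ⟨v, hv, hTv⟩
      · exact absurd hT (hw₁ w)
      · rw [D.tri_pred_unique hT hTv]
        exact hv)
  refine ⟨l.reverse, List.nodup_reverse.2 hnd, List.isChain_reverse.2 hc, ?_, ?_, ?_⟩
  · intro w
    rw [List.mem_reverse]
    exact ⟨hadj w, hall w⟩
  · simpa using hlast
  · intro w hw
    rw [List.getLast?_reverse]
    constructor
    · intro h0
      rcases hpairs w (List.mem_reverse.1 hw) with h1 | ⟨v, _, hv⟩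
      · exact h1
      · exact absurd hv (h0 v)
    · exact hhead w

end TriangulatedDisk

namespace TriangulatedDisk

variable {α : Type*} (D : TriangulatedDisk α)

/-- Deleting `z` leaves a graph without cut vertices. -/
def Removable (z : α) : Prop :=
  ∀ (c : α) (K : Set α), (∀ x ∈ K, x ∈ D.verts ∧ x ≠ z) → c ∉ K → K.Nonempty →
    (∀ x ∈ K, ∀ y, D.Adj x y → y ≠ z → y ≠ c → y ∈ K) → ∀ y ∈ D.verts, y ≠ z → y ≠ c → y ∈ K

/-- `{z, c}` separates `K`, which avoids the base edge `ab`, from the rest of the graph, where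
`z` is an outer vertex. -/
structure Separation (a b z c : α) (K : Finset α) : Prop where
  outer : ∃ w, D.Outer w z
  ne_left : z ≠ a
  ne_right : z ≠ b
  ne : c ≠ z
  nonempty : K.Nonempty
  subset : K ⊆ D.verts
  notMem_fst : z ∉ K
  notMem_snd : c ∉ K
  notMem_left : a ∉ K
  notMem_right : b ∉ K
  closed : ∀ x ∈ K, ∀ y, D.Adj x y → y = z ∨ y = c ∨ y ∈ K
  rest : ∃ r ∈ D.verts, r ∉ K ∧ r ≠ z ∧ r ≠ c

variable {D}

lemma exists_outer_out_ne {z w : α} (h : D.Outer w z) (hV : 3 ≤ D.verts.card) :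
    ∃ v, v ≠ w ∧ D.Outer z v := by
  obtain ⟨l, hnd, -, hl, hhead, hlast⟩ := D.exists_link_list h
  have : ∃ v, D.Adj z v ∧ v ≠ w := by
    by_contra hcon
    push Not at hcon
    have hz := D.adj_mem_right h.1
    have hall := D.connected_delete w {z} (by simpa using hz) (D.ne_of_adj h.1) ⟨z, rfl⟩ (by
      rintro x rfl y hxy hyw
      exact absurd (hcon y hxy) hyw)
    have hsub : D.verts ⊆ {z, w} := by
      intro y hy
      by_cases hyw : y = w
      · simp [hyw]
      · simpa [hyw] using hall y hy hyw
    have := Finset.card_le_card hsub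
    have := Finset.card_le_two (a := z) (b := w)
    omega
  obtain ⟨v, hv, hvw⟩ := this
  have hvl := (hl v).2 hv
  match l, hhead with
  | x :: l, hhead =>
    simp only [List.head?_cons, Option.some.injEq] at hhead
    subst hhead
    match l with
    | [] => simp [hvw] at hvl
    | y :: l =>
      have hm := List.getLast_mem (l := y :: l) (by simp)
      have hg : (x :: y :: l).getLast? = some ((y :: l).getLast (by simp)) := by
        rw [List.getLast?_cons_cons, List.getLast?_eq_some_getLast]
      have hm' := List.mem_cons_of_mem x hm
      refine ⟨_, ?_, (hl _).1 hm', (hlast _ hm').2 hg⟩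
      rintro he
      rw [List.nodup_cons] at hnd
      rw [he] at hm
      exact hnd.1 hm

lemma exists_separation_of_not_removable {a b z : α} (hab : D.Adj a b) (hz : ∃ w, D.Outer w z)
    (hza : z ≠ a) (hzb : z ≠ b) (h : ¬ D.Removable z) : ∃ c K, D.Separation a b z c K := by
  unfold Removable at h
  push Not at h
  obtain ⟨c, K, hKV, hcK, hne, hcl, y, hy, hyz, hyc, hyK⟩ := h
  have hcz : c ≠ z := by
    rintro rfl
    exact hyK (D.connected_delete c K (fun x hx => (hKV x hx).1) hcK hne
      (fun x hx y hxy hyc => hcl x hx y hxy hyc hyc) y hy hyz)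
  by_cases hK : a ∈ K ∨ b ∈ K
  · refine ⟨c, D.verts.filter (fun x => x ∉ K ∧ x ≠ z ∧ x ≠ c), hz, hza, hzb, hcz, ⟨y, ?_⟩,
      Finset.filter_subset _ _, ?_, ?_, ?_, ?_, ?_, ?_⟩
    · simp [*]
    · simp
    · simp
    · simp only [Finset.mem_filter, not_and, not_not]
      rintro - haK haz
      by_contra hac
      exact haK (hcl b (hK.resolve_left haK) a (D.adj_symm hab) hza.symm hac)
    · simp only [Finset.mem_filter, not_and, not_not]
      rintro - haK haz
      by_contra hac
      exact haK (hcl a (hK.resolve_right haK) b hab hzb.symm hac)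
    · simp only [Finset.mem_filter]
      rintro x ⟨hx, hxK, hxz, hxc⟩ y hxy
      by_contra hcon
      push Not at hcon
      have : y ∈ K := by
        by_contra hyK
        exact hcon.2.1 (hcon.2.2 (D.adj_mem_right hxy) hyK hcon.1)
      exact hxK (hcl y this x (D.adj_symm hxy) hxz hxc)
    · obtain ⟨k, hk⟩ := hne
      refine ⟨k, (hKV k hk).1, ?_, (hKV k hk).2, ?_⟩
      · simp [hk]
      · rintro rfl
        exact hcK hk
  · push Not at hK
    refine ⟨c, D.verts.filter (· ∈ K), hz, hza, hzb, hcz, ?_,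
      Finset.filter_subset _ _, ?_, ?_, ?_, ?_, ?_, ⟨y, hy, ?_, hyz, hyc⟩⟩
    · obtain ⟨k, hk⟩ := hne
      exact ⟨k, by simp [hk, (hKV k hk).1]⟩
    · simp only [Finset.mem_filter, not_and]
      rintro - hzK
      exact (hKV z hzK).2 rfl
    · simp [hcK]
    · simp [hK.1]
    · simp [hK.2]
    · simp only [Finset.mem_filter]
      rintro x ⟨hx, hxK⟩ y hxy
      by_cases h1 : y = z
      · exact Or.inl h1
      by_cases h2 : y = c
      · exact Or.inr (Or.inl h2)
      exact Or.inr (Or.inr ⟨D.adj_mem_right hxy, hcl x hxK y hxy h1 h2⟩)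
    · simp [hyK]

lemma forall_mem_of_isChain {R : α → α → Prop} {P : α → Prop} :
    ∀ {l : List α}, l.IsChain R → (∀ x ∈ l, ∀ y ∈ l, R x y → (P x ↔ P y)) →
      ∀ x ∈ l, ∀ y ∈ l, P x → P y
  | [], _, _ => by simp
  | [a], _, _ => by
    intro x hx y hy
    rw [List.mem_singleton] at hx hy
    rw [hx, hy]
    exact id
  | a :: b :: l, hc, h => by
    rw [List.isChain_cons_cons] at hc
    have ih := forall_mem_of_isChain (P := P) hc.2
      (fun x hx y hy => h x (List.mem_cons_of_mem _ hx) y (List.mem_cons_of_mem _ hy))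
    have hab := h a (by simp) b (by simp) hc.1
    intro x hx y hy hP
    rcases List.mem_cons.1 hx with rfl | hx' <;> rcases List.mem_cons.1 hy with rfl | hy'
    · exact hP
    · exact ih b (by simp) y hy' (hab.1 hP)
    · exact hab.2 (ih x hx' b (by simp) hP)
    · exact ih x hx' y hy' hP

/-- The separating vertex `c` is a neighbour of `z`, and `K` contains an outer vertex. -/
lemma Separation.adj_and_exists_outer {a b z c : α} {K : Finset α}
    (h : D.Separation a b z c K) : D.Adj z c ∧ ∃ z' ∈ K, ∃ w, D.Outer w z' := by
  obtain ⟨⟨w₁, hw₁⟩, hza, hzb, hcz, hne, hKV, hzK, hcK, haK, hbK, hcl, r, hr, hrK, hrz, hrc⟩ := h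
  have hzV := D.adj_mem_right hw₁.1
  have h1 : ∃ k ∈ K, D.Adj z k := by
    by_contra hcon
    push Not at hcon
    refine hzK (D.connected_delete c K (fun x hx => hKV hx) hcK hne ?_ z hzV hcz.symm)
    intro x hx y hxy hyc
    rcases hcl x hx y hxy with rfl | rfl | hy
    · exact absurd (D.adj_symm hxy) (hcon x hx)
    · exact absurd rfl hyc
    · exact hy
  have h2 : ∃ k, k ∉ K ∧ k ≠ c ∧ D.Adj z k := by
    by_contra hcon
    push Not at hcon
    have := (D.connected_delete c {x | x ∈ D.verts ∧ x ∉ K ∧ x ≠ z ∧ x ≠ c} (fun x hx => hx.1)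
      (by simp) ⟨r, hr, hrK, hrz, hrc⟩ ?_ z hzV hcz.symm).2.2.1
    · exact this rfl
    · rintro x ⟨hx, hxK, hxz, hxc⟩ y hxy hyc
      refine ⟨D.adj_mem_right hxy, ?_, ?_, hyc⟩
      · intro hyK
        rcases hcl y hyK x (D.adj_symm hxy) with rfl | rfl | h
        · exact hxz rfl
        · exact hxc rfl
        · exact hxK h
      · rintro rfl
        exact hcon x hxK hxc (D.adj_symm hxy)
  obtain ⟨k, hkK, hzk⟩ := h1
  obtain ⟨r, hrK, hrc, hzr⟩ := h2
  obtain ⟨l, hnd, hc, hl, hhead, hlast⟩ := D.exists_link_list hw₁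
  have key : ∀ l' : List α, l'.IsChain (fun a b => D.Tri z a b) → (∀ x ∈ l', x ∈ l) → c ∉ l' →
      ∀ x ∈ l', ∀ y ∈ l', x ∈ K → y ∈ K := by
    intro l' hc' hl' hcl'
    refine forall_mem_of_isChain (P := (· ∈ K)) hc' ?_
    have hstep : ∀ x ∈ l', ∀ y ∈ l', D.Adj x y → x ∈ K → y ∈ K := by
      intro x hx y hy hxy hxK
      rcases hcl x hxK y hxy with rfl | rfl | h
      · exact absurd ((hl _).1 (hl' _ hy)) (D.adj_irrefl _)
      · exact absurd hy hcl'
      · exact h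
    intro x hx y hy hT
    have hxy := D.tri_adj (D.tri_rotate hT)
    exact ⟨hstep x hx y hy hxy, hstep y hy x hx (D.adj_symm hxy)⟩
  have hcl2 : c ∈ l := by
    by_contra hcl2
    exact hrK (key l hc (fun _ h => h) hcl2 k ((hl k).2 hzk) r ((hl r).2 hzr) hkK)
  refine ⟨(hl c).1 hcl2, ?_⟩
  obtain ⟨l₁, l₂, rfl⟩ := List.append_of_mem hcl2
  rw [List.nodup_append] at hnd
  obtain ⟨hnd1, hnd2, hdis⟩ := hnd
  rw [List.nodup_cons] at hnd2
  rw [List.isChain_append] at hc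
  have hk := (hl k).2 hzk
  rw [List.mem_append, List.mem_cons] at hk
  rcases hk with hk | rfl | hk
  · match l₁, hk with
    | x :: l₁, hk =>
      simp only [List.cons_append, List.head?_cons, Option.some.injEq] at hhead
      subst hhead
      refine ⟨x, key (x :: l₁) hc.1 (fun y hy => List.mem_append_left _ hy) ?_ k hk x (by simp) hkK,
        D.exists_outer_in hw₁⟩
      intro hcm
      exact hdis c hcm c (by simp) rfl
  · exact absurd hkK hcK
  · have hne2 : l₂ ≠ [] := by
      rintro rfl
      simp at hk
    have hm := List.getLast_mem hne2
    have hm' : l₂.getLast hne2 ∈ l₁ ++ c :: l₂ :=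
      List.mem_append_right _ (List.mem_cons_of_mem _ hm)
    refine ⟨l₂.getLast hne2, key l₂ (hc.2.1.tail) (fun y hy =>
      List.mem_append_right _ (List.mem_cons_of_mem _ hy)) hnd2.1 k hk _ hm hkK, z, (hl _).1 hm',
      (hlast _ hm').2 ?_⟩
    rw [List.getLast?_append, List.getLast?_cons, List.getLast?_eq_some_getLast hne2]
    simp

lemma Separation.exists_removable {a b : α} (hab : D.Adj a b) :
    ∀ (n : ℕ) {z c : α} {K : Finset α}, K.card = n → D.Separation a b z c K →
      ∃ z, (∃ w, D.Outer w z) ∧ z ≠ a ∧ z ≠ b ∧ D.Removable z := by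
  intro n
  induction n using Nat.strong_induction_on with
  | _ n ih =>
  intro z c K hn hs
  obtain ⟨hzc, z', hz'K, hz'⟩ := hs.adj_and_exists_outer
  have hz'a : z' ≠ a := fun h => hs.notMem_left (h ▸ hz'K)
  have hz'b : z' ≠ b := fun h => hs.notMem_right (h ▸ hz'K)
  by_cases hrem : D.Removable z'
  · exact ⟨z', hz', hz'a, hz'b, hrem⟩
  obtain ⟨c', B, ht⟩ := exists_separation_of_not_removable hab hz' hz'a hz'b hrem
  have hBK : B ⊆ K := by
    intro x hxB
    by_contra hxK
    by_cases hcase : z ∈ B ∨ c ∈ B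
    · have hz'A := D.connected_delete c'
        {y | y ∈ D.verts ∧ y ∉ B ∧ y ∉ K ∧ y ≠ z' ∧ y ≠ c' ∧ y ≠ z ∧ y ≠ c} (fun y hy => hy.1)
        (by simp) ?_ ?_ z' (hs.subset hz'K) ht.ne.symm
      · exact hz'A.2.2.1 hz'K
      · have hmem : ∀ y ∈ D.verts, y ∉ B → y ∉ K → y ≠ z' → y ≠ c' → y ≠ z ∧ y ≠ c := by
          intro y hy hyB hyK hyz' hyc'
          constructor
          · rintro rfl
            rcases ht.closed c (hcase.resolve_left hyB) y (D.adj_symm hzc) with h | h | h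
            · exact hyz' h
            · exact hyc' h
            · exact hyB h
          · rintro rfl
            rcases ht.closed z (hcase.resolve_right hyB) y hzc with h | h | h
            · exact hyz' h
            · exact hyc' h
            · exact hyB h
        by_cases hac' : a = c'
        · have hbc' : b ≠ c' := fun h => D.ne_of_adj hab (hac'.trans h.symm)
          exact ⟨b, D.adj_mem_right hab, ht.notMem_right, hs.notMem_right, hz'b.symm, hbc',
            hmem b (D.adj_mem_right hab) ht.notMem_right hs.notMem_right hz'b.symm hbc'⟩
        · exact ⟨a, D.adj_mem hab, ht.notMem_left, hs.notMem_left, hz'a.symm, hac',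
            hmem a (D.adj_mem hab) ht.notMem_left hs.notMem_left hz'a.symm hac'⟩
      · rintro x ⟨hxV, hxB, hxK, hxz', hxc', hxz, hxc⟩ y hxy hyc'
        have hyK : y ∉ K := by
          intro hyK
          rcases hs.closed y hyK x (D.adj_symm hxy) with h | h | h
          exacts [hxz h, hxc h, hxK h]
        have hyB : y ∉ B := by
          intro hyB
          rcases ht.closed y hyB x (D.adj_symm hxy) with h | h | h
          exacts [hxz' h, hxc' h, hxB h]
        have hyz' : y ≠ z' := by
          rintro rfl
          exact hyK hz'K
        refine ⟨D.adj_mem_right hxy, hyB, hyK, hyz', hyc', ?_, ?_⟩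
        · rintro rfl
          rcases hcase with h | h
          · exact hyB h
          · rcases ht.closed c h y (D.adj_symm hzc) with h | h | h
            exacts [hyz' h, hyc' h, hyB h]
        · rintro rfl
          rcases hcase with h | h
          · rcases ht.closed z h y hzc with h | h | h
            exacts [hyz' h, hyc' h, hyB h]
          · exact hyB h
    · push Not at hcase
      have := D.connected_delete c' {y | y ∈ B ∧ y ∉ K} (fun y hy => ht.subset hy.1)
        (fun h => ht.notMem_snd h.1) ⟨x, hxB, hxK⟩ ?_ z' (hs.subset hz'K) ht.ne.symm
      · exact this.2 hz'K
      · rintro x ⟨hxB, hxK⟩ y hxy hyc'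
        have hyK : y ∉ K := by
          intro hyK
          rcases hs.closed y hyK x (D.adj_symm hxy) with rfl | rfl | h
          exacts [hcase.1 hxB, hcase.2 hxB, hxK h]
        refine ⟨?_, hyK⟩
        rcases ht.closed x hxB y hxy with rfl | h | h
        · exact absurd hz'K hyK
        · exact absurd h hyc'
        · exact h
  have hlt : B.card < K.card := Finset.card_lt_card
    (Finset.ssubset_iff_subset_ne.2 ⟨hBK, fun h => ht.notMem_fst (h ▸ hz'K)⟩)
  exact ih B.card (hn ▸ hlt) rfl ht

/-- Some outer vertex off a given outer edge can be removed without creating cut vertices. -/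
lemma exists_removable {a b : α} (hba : D.Outer b a) (hV : 3 ≤ D.verts.card) :
    ∃ z, (∃ w, D.Outer w z) ∧ z ≠ a ∧ z ≠ b ∧ D.Removable z := by
  obtain ⟨z, hzb, hz⟩ := exists_outer_out_ne hba hV
  have hza : z ≠ a := (D.ne_of_adj hz.1).symm
  by_cases hrem : D.Removable z
  · exact ⟨z, ⟨a, hz⟩, hza, hzb, hrem⟩
  · obtain ⟨c, K, hs⟩ := exists_separation_of_not_removable (D.adj_symm hba.1) ⟨a, hz⟩ hza hzb hrem
    exact hs.exists_removable (D.adj_symm hba.1) _ rfl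

variable (D)

/-- Deletion of an outer vertex. -/
def deleteVert (z : α) (hz : ∃ w, D.Outer w z) (hrem : D.Removable z) : TriangulatedDisk α where
  verts := D.verts.erase z
  Adj x y := D.Adj x y ∧ x ≠ z ∧ y ≠ z
  Tri x y t := D.Tri x y t ∧ x ≠ z ∧ y ≠ z ∧ t ≠ z
  adj_symm h := ⟨D.adj_symm h.1, h.2.2, h.2.1⟩
  adj_irrefl x h := D.adj_irrefl x h.1
  adj_mem h := Finset.mem_erase.2 ⟨h.2.1, D.adj_mem h.1⟩
  tri_adj h := ⟨D.tri_adj h.1, h.2.1, h.2.2.1⟩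
  tri_rotate h := ⟨D.tri_rotate h.1, h.2.2.1, h.2.2.2, h.2.1⟩
  tri_unique h h' := D.tri_unique h.1 h'.1
  connected_delete := by
    intro c K hK hc hne hcl y hy hyc
    refine hrem c K (fun x hx => ?_) hc hne ?_ y (Finset.mem_of_mem_erase hy)
      (Finset.ne_of_mem_erase hy) hyc
    · have := hK x hx
      exact ⟨Finset.mem_of_mem_erase this, Finset.ne_of_mem_erase this⟩
    · intro x hx y hxy hyz hyc
      exact hcl x hx y ⟨hxy, Finset.ne_of_mem_erase (hK x hx), hyz⟩ hyc
  bounding := by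
    intro ζ hsymm hsupp hsum
    have hz0 : ∀ x, ζ x z = 0 := by
      intro x
      by_contra h0
      exact (hsupp _ _ h0).2.2 rfl
    obtain ⟨φ, hφ0, hφt, hφe⟩ := D.bounding ζ hsymm (fun x y h => (hsupp x y h).1) (by
      intro x
      rw [← hsum x]
      symm
      apply Finset.sum_erase
      exact hz0 x)
    refine ⟨φ, ?_, fun x y t h => hφt x y t h.1, fun x y h => hφe x y h.1⟩
    have hzw : ∀ w, D.Adj z w → φ z w = φ w z := by
      intro w hw
      have h1 := hφe z w hw
      rw [hsymm, hz0] at h1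
      have : ∀ a b : ZMod 2, a + b = 0 → a = b := by decide
      exact this _ _ h1
    obtain ⟨w₀, hw₀⟩ := hz
    have hall := D.link_single_orbit (z := z) {w | D.Adj z w ∧ φ z w = 0} (fun w hw => hw.1)
      ⟨w₀, D.adj_symm hw₀.1, (hzw _ (D.adj_symm hw₀.1)).trans (hφ0 _ _ hw₀.1 hw₀.2)⟩ (by
        intro w w' hT
        have hw := D.tri_adj hT
        have hw' := D.adj_symm (D.tri_adj (D.tri_rotate' hT))
        have : φ z w = φ z w' := by
          rw [hzw w' hw']
          exact (hφt _ _ _ (D.tri_rotate' hT)).symm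
        simp [hw, hw', this])
    rintro x y ⟨hxy, hx, hy⟩ hno
    by_cases hT : ∃ t, D.Tri x y t
    · obtain ⟨t, hT⟩ := hT
      have htz : t = z := by
        by_contra htz
        exact hno t ⟨hT, hx, hy, htz⟩
      subst htz
      have hyt := D.tri_adj (D.tri_rotate hT)
      rw [hφt _ _ _ hT, ← hzw y (D.adj_symm hyt)]
      exact (hall y (D.adj_symm hyt)).2
    · push Not at hT
      exact hφ0 _ _ hxy hT

/-- The mirror image. -/
def mirror : TriangulatedDisk α where
  verts := D.verts
  Adj := D.Adj
  Tri x y z := D.Tri y x z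
  adj_symm := D.adj_symm
  adj_irrefl := D.adj_irrefl
  adj_mem := D.adj_mem
  tri_adj h := D.adj_symm (D.tri_adj h)
  tri_rotate h := D.tri_rotate (D.tri_rotate h)
  tri_unique h h' := D.tri_unique h h'
  connected_delete := D.connected_delete
  bounding := by
    intro ζ hsymm hsupp hsum
    obtain ⟨φ, hφ0, hφt, hφe⟩ := D.bounding ζ hsymm hsupp hsum
    refine ⟨fun x y => φ y x, fun x y h h' => hφ0 y x (D.adj_symm h) h', ?_, ?_⟩
    · intro x y z hT
      beta_reduce
      rw [hφt _ _ _ hT, hφt _ _ _ (D.tri_rotate hT)]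
    · intro x y h
      rw [add_comm]
      exact hφe x y h

end TriangulatedDisk

/-- `x` is immediately followed by `y` in the list. -/
def Consec {α : Type*} (P : List α) (x y : α) : Prop := ∃ l r, P = l ++ x :: y :: r

namespace Consec

variable {α : Type*}

lemma mem_left {P : List α} {x y : α} (h : Consec P x y) : x ∈ P := by
  obtain ⟨l, r, rfl⟩ := h
  simp

lemma mem_right {P : List α} {x y : α} (h : Consec P x y) : y ∈ P := by
  obtain ⟨l, r, rfl⟩ := h
  simp

lemma not_singleton {c x y : α} : ¬ Consec [c] x y := by
  rintro ⟨l, r, h⟩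
  have := congrArg List.length h
  simp at this
  omega

lemma cons_cons_iff {P : List α} {c d x y : α} :
    Consec (c :: d :: P) x y ↔ (x = c ∧ y = d) ∨ Consec (d :: P) x y := by
  constructor
  · rintro ⟨l, r, h⟩
    match l with
    | [] =>
      simp only [List.nil_append, List.cons.injEq] at h
      exact Or.inl ⟨h.1.symm, h.2.1.symm⟩
    | e :: l =>
      simp only [List.cons_append, List.cons.injEq] at h
      exact Or.inr ⟨l, r, h.2⟩
  · rintro (⟨rfl, rfl⟩ | ⟨l, r, h⟩)
    · exact ⟨[], P, rfl⟩
    · exact ⟨c :: l, r, by rw [h]; rfl⟩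

lemma append_cons_iff {r : List α} {c x y : α} : ∀ {l : List α},
    Consec (l ++ c :: r) x y ↔ Consec (l ++ [c]) x y ∨ Consec (c :: r) x y
  | [] => by simp [not_singleton]
  | [d] => by
    simp only [List.cons_append, List.nil_append, cons_cons_iff, not_singleton, or_false]
  | d :: e :: l => by
    have := append_cons_iff (r := r) (c := c) (x := x) (y := y) (l := e :: l)
    simp only [List.cons_append, cons_cons_iff] at this ⊢
    rw [this, or_assoc]

lemma mem_of_append_singleton {l : List α} {c x y : α} (h : Consec (l ++ [c]) x y) : x ∈ l := by
  induction l with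
  | nil => exact absurd h not_singleton
  | cons d l ih =>
    match l with
    | [] =>
      rw [List.cons_append, List.nil_append, cons_cons_iff] at h
      rcases h with ⟨rfl, -⟩ | h
      · simp
      · exact absurd h not_singleton
    | e :: l =>
      rw [List.cons_append, List.cons_append, cons_cons_iff] at h
      rcases h with ⟨rfl, -⟩ | h
      · simp
      · exact List.mem_cons_of_mem _ (ih h)

lemma mem_of_cons {r : List α} {c x y : α} (h : Consec (c :: r) x y) : y ∈ r := by
  obtain ⟨l, r', h⟩ := h
  match l with
  | [] =>
    simp only [List.nil_append, List.cons.injEq] at h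
    simp [h.2]
  | e :: l =>
    simp only [List.cons_append, List.cons.injEq] at h
    simp [h.2]

lemma of_isChain {R : α → α → Prop} {l : List α} (h : l.IsChain R) {x y : α}
    (hc : Consec l x y) : R x y := by
  obtain ⟨l, r, rfl⟩ := hc
  rw [List.isChain_append, List.isChain_cons_cons] at h
  exact h.2.1.1

lemma exists_infix {P : List α} (hP : P.Nodup) : ∀ {W : List α}, W.IsChain (Consec P) →
    W ≠ [] → (∀ x ∈ W, x ∈ P) → ∃ l r, P = l ++ (W ++ r)
  | [], _, h, _ => absurd rfl h
  | [x], _, _, h => by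
    obtain ⟨l, r, h⟩ := List.append_of_mem (h x (by simp))
    exact ⟨l, r, h⟩
  | x :: y :: W, hc, _, h => by
    rw [List.isChain_cons_cons] at hc
    obtain ⟨l, r, h1⟩ := exists_infix hP hc.2 (by simp)
      (fun z hz => h z (List.mem_cons_of_mem _ hz))
    obtain ⟨l', r', h2⟩ := hc.1
    have h3 : l ++ y :: (W ++ r) = (l' ++ [x]) ++ y :: r' := by
      rw [List.cons_append] at h1
      rw [← h1, h2]
      simp
    have hn : (l ++ y :: (W ++ r)).Nodup := by
      rw [List.cons_append] at h1
      rwa [← h1]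
    have hl : l = l' ++ [x] := by
      clear h1 h2 hc h
      have hn' := hn
      rw [h3] at hn'
      generalize l' ++ [x] = k at h3 hn'
      generalize W ++ r = s at h3 hn
      induction l generalizing k with
      | nil =>
        match k with
        | [] => rfl
        | e :: k =>
          simp only [List.nil_append, List.cons_append, List.cons.injEq] at h3
          rw [← h3.1] at hn'
          simp at hn'
      | cons d l ih =>
        match k with
        | [] =>
          simp only [List.nil_append, List.cons_append, List.cons.injEq] at h3
          rw [h3.1] at hn
          simp at hn
        | e :: k =>
          simp only [List.cons_append, List.cons.injEq] at h3
          have hn₂ := (List.nodup_cons.1 hn).2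
          have hn₃ := (List.nodup_cons.1 hn').2
          have h4 := h3.2
          rw [h3.1, ih k (by assumption) (by assumption) (by assumption)]
    refine ⟨l', r, ?_⟩
    rw [h1, hl]
    simp

end Consec

/-- The graph with vertices `V` and adjacency `A` is obtained from an edge by repeatedly attaching
a new vertex along a subpath of the current upper boundary path; `P` is the resulting path. -/
inductive Shell {α : Type*} : Finset α → (α → α → Prop) → List α → Prop
  | base {V : Finset α} {A : α → α → Prop} {a b : α} (hab : a ≠ b)
      (hV : ∀ x, x ∈ V ↔ x = a ∨ x = b)
      (hA : ∀ x y, A x y ↔ (x = a ∧ y = b) ∨ (x = b ∧ y = a)) : Shell V A [a, b]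
  | step {V V' : Finset α} {A A' : α → α → Prop} {P P' l m r : List α} {x y z : α}
      (hs : Shell V A P) (hP : P = l ++ x :: (m ++ y :: r)) (hz : z ∉ V)
      (hV : ∀ p, p ∈ V' ↔ p = z ∨ p ∈ V)
      (hA : ∀ p q, A' p q ↔
        A p q ∨ (p = z ∧ q ∈ x :: (m ++ [y])) ∨ (q = z ∧ p ∈ x :: (m ++ [y])))
      (hP' : P' = l ++ x :: z :: y :: r) : Shell V' A' P'

namespace Shell

variable {α : Type*} {V : Finset α} {A : α → α → Prop} {P : List α}

lemma subset (h : Shell V A P) : ∀ x ∈ P, x ∈ V := by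
  induction h with
  | base hab hV hA =>
    intro x hx
    simpa [hV] using hx
  | step hs hP hz hV hA hP' ih =>
    intro p hp
    subst hP hP'
    rw [hV]
    simp only [List.mem_append, List.mem_cons] at hp ih
    have := ih p
    tauto

lemma adj_mem (h : Shell V A P) : ∀ x y, A x y → x ∈ V ∧ y ∈ V := by
  induction h with
  | base hab hV hA =>
    intro x y hxy
    rw [hA] at hxy
    rw [hV, hV]
    tauto
  | @step V V' A A' P P' l m r x y z hs hP hz hV hA hP' ih =>
    intro p q hpq
    have hsub : ∀ q ∈ x :: (m ++ [y]), q ∈ V := by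
      intro q hq
      apply hs.subset
      subst hP
      simp only [List.mem_append, List.mem_cons, List.not_mem_nil, or_false] at hq ⊢
      tauto
    rw [hV, hV]
    rcases (hA p q).1 hpq with h | ⟨h, h'⟩ | ⟨h, h'⟩
    · exact ⟨Or.inr (ih _ _ h).1, Or.inr (ih _ _ h).2⟩
    · exact ⟨Or.inl h, Or.inr (hsub _ h')⟩
    · exact ⟨Or.inr (hsub _ h'), Or.inl h⟩

lemma symm (h : Shell V A P) : ∀ x y, A x y → A y x := by
  induction h with
  | base hab hV hA =>
    intro x y hxy
    rw [hA] at hxy ⊢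
    tauto
  | step hs hP hz hV hA hP' ih =>
    intro p q hpq
    rw [hA] at hpq ⊢
    have := ih p q
    tauto

lemma irrefl (h : Shell V A P) : ∀ x, ¬ A x x := by
  induction h with
  | base hab hV hA =>
    intro x hxy
    rw [hA] at hxy
    rcases hxy with ⟨rfl, h⟩ | ⟨rfl, h⟩
    exacts [hab h, hab h.symm]
  | @step V V' A A' P P' l m r x y z hs hP hz hV hA hP' ih =>
    intro p hp
    have hsub : ∀ q ∈ x :: (m ++ [y]), q ∈ V := by
      intro q hq
      apply hs.subset
      subst hP
      simp only [List.mem_append, List.mem_cons, List.not_mem_nil, or_false] at hq ⊢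
      tauto
    rcases (hA p p).1 hp with h | ⟨rfl, h'⟩ | ⟨rfl, h'⟩
    · exact ih _ h
    · exact hz (hsub _ h')
    · exact hz (hsub _ h')

lemma nodup (h : Shell V A P) : P.Nodup := by
  induction h with
  | base hab hV hA => simp [hab]
  | @step V V' A A' P P' l m r x y z hs hP hz hV hA hP' ih =>
    have hzP : z ∉ P := fun h => hz (hs.subset z h)
    subst hP hP'
    grind [List.nodup_append, List.nodup_cons]

lemma adj_of_consec (h : Shell V A P) : ∀ x y, Consec P x y → A x y := by
  induction h with
  | base hab hV hA =>
    intro x y hxy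
    rw [Consec.cons_cons_iff] at hxy
    rw [hA]
    exact Or.inl (hxy.resolve_right Consec.not_singleton)
  | @step V V' A A' P P' l m r x y z hs hP hz hV hA hP' ih =>
    intro p q hpq
    subst hP hP'
    rw [Consec.append_cons_iff, Consec.cons_cons_iff, Consec.cons_cons_iff] at hpq
    rcases hpq with hpq | ⟨rfl, rfl⟩ | ⟨rfl, rfl⟩ | hpq
    · exact (hA _ _).2 (Or.inl (ih _ _ (Consec.append_cons_iff.2 (Or.inl hpq))))
    · exact (hA _ _).2 (Or.inr (Or.inr ⟨rfl, by simp⟩))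
    · exact (hA _ _).2 (Or.inr (Or.inl ⟨rfl, by simp⟩))
    · refine (hA _ _).2 (Or.inl (ih _ _ (Consec.append_cons_iff.2 (Or.inr ?_))))
      rw [← List.cons_append]
      exact Consec.append_cons_iff.2 (Or.inr hpq)

/-- Contracting the first edge of the boundary path of a shelled graph. -/
lemma contract (h : Shell V A P) : ∀ (v w : α) (r : List α), P = v :: w :: r → r ≠ [] →
    (∀ q, A v q → q ∈ P) → ∀ (V₂ : Finset α) (A₂ : α → α → Prop), (∀ p, p ∈ V₂ ↔ p ≠ w ∧ p ∈ V) →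
    (∀ p q, A₂ p q ↔ p ≠ q ∧ p ∈ V₂ ∧ q ∈ V₂ ∧ (A p q ∨ (p = v ∧ A w q) ∨ (q = v ∧ A w p))) →
    Shell V₂ A₂ (v :: r) := by
  induction h with
  | base hab hV hA =>
    intro v w r h hr
    simp only [List.cons.injEq] at h
    exact absurd h.2.2.symm hr
  | @step V V' A A' P P' l m r₀ x y z hs hP hz hV hA hP' ih =>
    intro v w r h hr hv V₂ A₂ hV₂ hA₂
    have hnd := hs.nodup
    have hadj := hs.adj_of_consec
    have hmem := hs.subset
    have hAV := hs.adj_mem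
    have hsymm := hs.symm
    have hirr := hs.irrefl
    have hv' : v ∈ V → w ∈ V → ∀ q, A v q → q ∈ P := by
      intro hvV hwV q hq
      have h1 := hv q ((hA _ _).2 (Or.inl hq))
      have h2 := (hAV _ _ hq).2
      have h3 : q ≠ z := fun h => hz (h ▸ h2)
      rw [hP'] at h1
      rw [hP]
      simp only [List.mem_append, List.mem_cons] at h1 ⊢
      tauto
    have hvw : v ≠ w := by
      have := (Shell.step hs hP hz hV hA hP').nodup
      rw [h] at this
      grind
    match l with
    | [] =>
      simp only [List.nil_append] at hP'
      rw [h] at hP'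
      simp only [List.cons.injEq] at hP'
      obtain ⟨rfl, rfl, rfl⟩ := hP'
      have hm : m = [] := by
        match m with
        | [] => rfl
        | k :: m =>
          exfalso
          have h1 := hv k ((hA _ _).2 (Or.inl (hadj v k ⟨[], m ++ y :: r₀, hP⟩)))
          have h2 := hmem k (by simp [hP])
          have h3 : k ≠ w := fun h => hz (h ▸ h2)
          rw [h] at h1
          rw [hP] at hnd
          grind
      subst hm
      have hVV : V₂ = V := by
        ext p
        rw [hV₂, hV]
        constructor
        · tauto
        · intro hp
          exact ⟨fun h => hz (h ▸ hp), Or.inr hp⟩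
      subst hVV
      have hvy := hadj v y ⟨[], r₀, hP⟩
      have hAA : A₂ = A := by
        ext p q
        rw [hA₂, hA, hA, hA]
        simp only [List.nil_append, List.mem_cons, List.not_mem_nil, or_false]
        have := hirr p
        grind
      rw [hAA]
      have hP2 : P = v :: y :: r₀ := by simpa using hP
      rw [← hP2]
      exact hs
    | [v'] =>
      rw [h] at hP'
      simp only [List.cons_append, List.nil_append, List.cons.injEq] at hP'
      obtain ⟨rfl, rfl, rfl⟩ := hP'
      have hvV := hmem v (by simp [hP])
      have hwV := hmem w (by simp [hP])
      have h1 := ih v w (m ++ y :: r₀) (by simpa using hP) (by simp) (hv' hvV hwV) (V.erase w)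
        (fun p q => p ≠ q ∧ p ∈ V.erase w ∧ q ∈ V.erase w ∧
          (A p q ∨ (p = v ∧ A w q) ∨ (q = v ∧ A w p))) (by simp) (fun _ _ => Iff.rfl)
      refine Shell.step (l := []) (z := z) h1 rfl (by simp [hz]) (by grind) ?_ rfl
      have hms : ∀ q ∈ m ++ [y], q ∈ V := by
        intro q hq
        apply hmem
        rw [hP]
        grind
      have hwm : w ∉ m ++ [y] := by
        rw [hP] at hnd
        grind
      have hvm : v ∉ m ++ [y] := by
        rw [hP] at hnd
        grind
      intro p q
      rw [hA₂, hA, hA, hA]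
      generalize m ++ [y] = m' at *
      grind
    | v' :: w' :: l =>
      rw [h] at hP'
      simp only [List.cons_append, List.cons.injEq] at hP'
      obtain ⟨rfl, rfl, rfl⟩ := hP'
      have hvV := hmem v (by simp [hP])
      have hwV := hmem w (by simp [hP])
      have h1 := ih v w (l ++ x :: (m ++ y :: r₀)) (by simpa using hP) (by simp) (hv' hvV hwV)
        (V.erase w)
        (fun p q => p ≠ q ∧ p ∈ V.erase w ∧ q ∈ V.erase w ∧
          (A p q ∨ (p = v ∧ A w q) ∨ (q = v ∧ A w p))) (by simp) (fun _ _ => Iff.rfl)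
      refine Shell.step (l := v :: l) (z := z) h1 rfl (by simp [hz]) (by grind) ?_ rfl
      have hms : ∀ q ∈ x :: (m ++ [y]), q ∈ V := by
        intro q hq
        apply hmem
        rw [hP]
        grind
      have hwm : w ∉ x :: (m ++ [y]) := by
        rw [hP] at hnd
        grind
      have hvm : v ∉ x :: (m ++ [y]) := by
        rw [hP] at hnd
        grind
      intro p q
      rw [hA₂, hA, hA, hA]
      generalize x :: (m ++ [y]) = m' at *
      grind

end Shell

namespace TriangulatedDisk

variable {α : Type*}

/-- A triangulated disk with an outer edge `ba` can be built from that edge. -/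
theorem exists_shell : ∀ (n : ℕ) (D : TriangulatedDisk α) {a b : α}, D.verts.card = n →
    D.Outer b a → ∃ P, Shell D.verts D.Adj P ∧ P.head? = some a ∧ P.getLast? = some b ∧
      ∀ x y, D.Outer x y ↔ Consec P x y ∨ (x = b ∧ y = a) := by
  intro n
  induction n with
  | zero =>
    intro D a b h0 hba
    rw [Finset.card_eq_zero] at h0
    have := D.adj_mem hba.1
    simp [h0] at this
  | succ n ih =>
  intro D a b hn hba
  have ha := D.adj_mem_right hba.1
  have hb := D.adj_mem hba.1
  have hab := (D.ne_of_adj hba.1).symm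
  by_cases h3 : 3 ≤ D.verts.card
  · obtain ⟨z, ⟨w, hw⟩, hza, hzb, hrem⟩ := exists_removable hba h3
    obtain ⟨P, hP, hPa, hPb, hout⟩ := ih (D.deleteVert z ⟨w, hw⟩ hrem) (a := a) (b := b) (by
        change (D.verts.erase z).card = n
        rw [Finset.card_erase_of_mem (D.adj_mem_right hw.1), hn]
        rfl)
      ⟨⟨hba.1, hzb.symm, hza.symm⟩, fun t ht => hba.2 t ht.1⟩
    obtain ⟨W, hWnd, hWc, hWmem, hWh, hWl⟩ := D.exists_link_list hw
    obtain ⟨v, hvw, hv⟩ := exists_outer_out_ne hw h3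
    have hWlast := (hWl v ((hWmem v).2 hv.1)).1 hv.2
    obtain ⟨m, rfl⟩ : ∃ m, W = w :: (m ++ [v]) := by
      match W, hWh with
      | w' :: W, hWh =>
        simp only [List.head?_cons, Option.some.injEq] at hWh
        subst hWh
        rcases List.eq_nil_or_concat' W with rfl | ⟨m, v', rfl⟩
        · simp only [List.getLast?_singleton, Option.some.injEq] at hWlast
          exact absurd hWlast.symm hvw
        · rw [← List.cons_append, List.getLast?_append] at hWlast
          simp only [List.getLast?_singleton, Option.some_or, Option.some.injEq] at hWlast
          exact ⟨m, by rw [hWlast]⟩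
    have hout' : ∀ x y, (D.deleteVert z ⟨w, hw⟩ hrem).Outer x y ↔
        x ≠ z ∧ y ≠ z ∧ (D.Outer x y ∨ D.Tri x y z) := by
      intro x y
      constructor
      · rintro ⟨⟨hxy, hx, hy⟩, hno⟩
        refine ⟨hx, hy, ?_⟩
        by_contra hcon
        push Not at hcon
        refine hcon.1 ⟨hxy, fun t ht => ?_⟩
        by_cases htz : t = z
        · exact hcon.2 (htz ▸ ht)
        · exact hno t ⟨ht, hx, hy, htz⟩
      · rintro ⟨hx, hy, h | h⟩
        · exact ⟨⟨h.1, hx, hy⟩, fun t ht => h.2 t ht.1⟩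
        · exact ⟨⟨D.tri_adj h, hx, hy⟩, fun t ht => ht.2.2.2 (D.tri_unique ht.1 h)⟩
    have hWz : ∀ x ∈ w :: (m ++ [v]), x ≠ z := by
      rintro x hx rfl
      exact D.adj_irrefl _ ((hWmem x).1 hx)
    have hPnd := hP.nodup
    have hinf : ∃ l r, P = l ++ (w :: (m ++ [v]) ++ r) := by
      have htri : ∀ x y, D.Tri z x y → Consec P x y := by
        intro x y hT
        have hx := D.tri_adj hT
        have hy := D.adj_symm (D.tri_adj (D.tri_rotate' hT))
        have hT' := D.tri_rotate hT
        refine ((hout x y).1 ((hout' x y).2 ⟨(D.ne_of_adj hx).symm, (D.ne_of_adj hy).symm,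
          Or.inr hT'⟩)).resolve_right ?_
        rintro ⟨rfl, rfl⟩
        exact hba.2 _ hT'
      have hch : (w :: (m ++ [v])).IsChain (Consec P) := hWc.imp htri
      refine Consec.exists_infix hPnd hch (by simp) ?_
      intro x hx
      by_cases hxv : x = v
      · subst hxv
        obtain ⟨k, hk⟩ : ∃ k, Consec (w :: (m ++ [x])) k x := by
          rcases List.eq_nil_or_concat' m with rfl | ⟨m, k, rfl⟩
          · exact ⟨w, [], [], rfl⟩
          · exact ⟨k, w :: m, [], by simp⟩
        exact (Consec.of_isChain hch hk).mem_right
      · have : ∃ k, D.Tri z x k := by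
          by_contra hcon
          push Not at hcon
          have := (hWl x hx).1 hcon
          rw [hWlast] at this
          exact hxv (Option.some.inj this).symm
        obtain ⟨k, hk⟩ := this
        exact (htri _ _ hk).mem_left
    obtain ⟨l, r, hPe⟩ := hinf
    have hPe' : P = l ++ w :: (m ++ v :: r) := by simpa using hPe
    refine ⟨l ++ w :: z :: v :: r, Shell.step (z := z) hP hPe' ?_ ?_ ?_ rfl, ?_, ?_, ?_⟩
    · exact Finset.notMem_erase z D.verts
    · intro p
      change p ∈ D.verts ↔ p = z ∨ p ∈ D.verts.erase z
      rw [Finset.mem_erase]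
      by_cases hp : p = z
      · simp [hp, D.adj_mem_right hw.1]
      · simp [hp]
    · intro p q
      change D.Adj p q ↔ (D.Adj p q ∧ p ≠ z ∧ q ≠ z) ∨ _
      rw [hWmem, hWmem]
      constructor
      · intro h
        by_cases hp : p = z
        · subst hp
          exact Or.inr (Or.inl ⟨rfl, h⟩)
        · by_cases hq : q = z
          · subst hq
            exact Or.inr (Or.inr ⟨rfl, D.adj_symm h⟩)
          · exact Or.inl ⟨h, hp, hq⟩
      · rintro (h | ⟨rfl, h⟩ | ⟨rfl, h⟩)
        · exact h.1
        · exact h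
        · exact D.adj_symm h
    · rw [hPe'] at hPa
      match l, hPa with
      | [], hPa => simpa using hPa
      | x :: l, hPa => simpa using hPa
    · have hPe₂ : P = (l ++ w :: m) ++ v :: r := by simp [hPe']
      rw [hPe₂, List.getLast?_append_cons] at hPb
      rw [← hPb, List.getLast?_append_cons, List.getLast?_cons_cons, List.getLast?_cons_cons]
    · intro x y
      have hsplit : Consec P x y ↔
          Consec (l ++ [w]) x y ∨ Consec (w :: (m ++ [v])) x y ∨ Consec (v :: r) x y := by
        rw [hPe', Consec.append_cons_iff, ← List.cons_append (bs := v :: r),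
          Consec.append_cons_iff (l := w :: m), List.cons_append]
      rw [Consec.append_cons_iff, Consec.cons_cons_iff, Consec.cons_cons_iff]
      have hWT : ∀ x y, Consec (w :: (m ++ [v])) x y → D.Tri z x y :=
        fun x y h => Consec.of_isChain hWc h
      rw [hPe'] at hPnd
      constructor
      · intro hxy
        by_cases hx : x = z
        · subst hx
          have h1 := (hWl y ((hWmem y).2 hxy.1)).1 hxy.2
          rw [hWlast, Option.some.injEq] at h1
          exact Or.inl (Or.inr (Or.inr (Or.inl ⟨rfl, h1.symm⟩)))
        by_cases hy : y = z
        · subst hy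
          have hxW := (hWmem x).2 (D.adj_symm hxy.1)
          have hxw : x = w := by
            rcases List.mem_cons.1 hxW with h | h
            · exact h
            · exfalso
              obtain ⟨m₁, m₂, hm⟩ := List.append_of_mem h
              obtain ⟨k, hk⟩ : ∃ k, Consec (w :: (m ++ [v])) k x := by
                rcases List.eq_nil_or_concat' m₁ with rfl | ⟨m₁, k, rfl⟩
                · exact ⟨w, [], m₂, by rw [hm]; rfl⟩
                · exact ⟨k, w :: m₁, m₂, by rw [hm]; simp⟩
              exact hxy.2 k (D.tri_rotate' (hWT _ _ hk))
          exact Or.inl (Or.inr (Or.inl ⟨hxw, rfl⟩))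
        have h1 := (hout x y).1 ((hout' x y).2 ⟨hx, hy, Or.inl hxy⟩)
        rw [hsplit] at h1
        rcases h1 with (h1 | h1 | h1) | h1
        · exact Or.inl (Or.inl h1)
        · exact absurd (D.tri_rotate (hWT _ _ h1)) (hxy.2 z)
        · exact Or.inl (Or.inr (Or.inr (Or.inr h1)))
        · exact Or.inr h1
      · rintro ((h | ⟨rfl, rfl⟩ | ⟨rfl, rfl⟩ | h) | ⟨rfl, rfl⟩)
        · refine ((hout' x y).1 ((hout x y).2 (Or.inl (hsplit.2 (Or.inl h))))).2.2.resolve_right ?_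
          intro hT
          have h1 := h.mem_of_append_singleton
          have h2 := (hWmem x).2 (D.tri_adj (D.tri_rotate' hT))
          grind
        · exact hw
        · exact hv
        · refine ((hout' x y).1 ((hout x y).2
            (Or.inl (hsplit.2 (Or.inr (Or.inr h)))))).2.2.resolve_right ?_
          intro hT
          have h1 := h.mem_of_cons
          have h2 := (hWmem y).2 (D.adj_symm (D.tri_adj (D.tri_rotate hT)))
          grind
        · exact hba
  · have hV : ({a, b} : Finset α) = D.verts := by
      apply Finset.eq_of_subset_of_card_le
      · intro x hx
        rw [Finset.mem_insert, Finset.mem_singleton] at hx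
        rcases hx with rfl | rfl
        exacts [ha, hb]
      · rw [Finset.card_pair hab]
        omega
    have hmem : ∀ x, x ∈ D.verts ↔ x = a ∨ x = b := by
      intro x
      simp [← hV]
    have hadj : ∀ x y, D.Adj x y ↔ (x = a ∧ y = b) ∨ (x = b ∧ y = a) := by
      intro x y
      constructor
      · intro hxy
        have h1 := (hmem x).1 (D.adj_mem hxy)
        have h2 := (hmem y).1 (D.adj_mem_right hxy)
        have h3 := D.ne_of_adj hxy
        grind
      · rintro (⟨rfl, rfl⟩ | ⟨rfl, rfl⟩)
        · exact D.adj_symm hba.1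
        · exact hba.1
    refine ⟨[a, b], Shell.base hab hmem hadj, rfl, rfl, ?_⟩
    intro x y
    rw [Consec.cons_cons_iff, or_iff_left (a := x = a ∧ y = b) Consec.not_singleton, ← hadj]
    refine ⟨fun h => h.1, fun h => ⟨h, fun z hT => ?_⟩⟩
    have h1 := D.ne_of_adj h
    have h2 := D.ne_of_adj (D.tri_adj (D.tri_rotate hT))
    have h3 := D.ne_of_adj (D.tri_adj (D.tri_rotate' hT))
    have h4 := (hmem x).1 (D.adj_mem h)
    have h5 := (hmem y).1 (D.adj_mem_right h)
    have h6 := (hmem z).1 (D.adj_mem (D.tri_adj (D.tri_rotate' hT)))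
    grind

end TriangulatedDisk

/-- Twice the signed area of the triangle `abc`. -/
def orient (a b c : ℝ × ℝ) : ℝ := (b.1 - a.1) * (c.2 - a.2) - (b.2 - a.2) * (c.1 - a.1)

lemma orient_rotate (a b c : ℝ × ℝ) : orient b c a = orient a b c := by
  unfold orient
  ring

lemma orient_swap (a b c : ℝ × ℝ) : orient b a c = -orient a b c := by
  unfold orient
  ring

lemma orient_swap_right (a b c : ℝ × ℝ) : orient a c b = -orient a b c := by
  unfold orient
  ring

lemma orient_self_right (a b : ℝ × ℝ) : orient a b b = 0 := by
  unfold orient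
  ring

lemma orient_self_left (a b : ℝ × ℝ) : orient a b a = 0 := by
  unfold orient
  ring

lemma orient_combo (a b p q : ℝ × ℝ) {s t : ℝ} (h : s + t = 1) :
    orient a b (s • p + t • q) = s * orient a b p + t * orient a b q := by
  have : s = 1 - t := by linarith
  subst this
  simp only [orient, Prod.fst_add, Prod.snd_add, Prod.smul_fst, Prod.smul_snd, smul_eq_mul]
  ring

lemma continuous_orient (a b : ℝ × ℝ) : Continuous (orient a b) := by
  unfold orient
  fun_prop

lemma convex_orient_nonneg (a b : ℝ × ℝ) : Convex ℝ {p | 0 ≤ orient a b p} := by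
  intro p hp q hq s t hs ht hst
  simp only [Set.mem_ofPred_eq] at hp hq ⊢
  rw [orient_combo _ _ _ _ hst]
  positivity

lemma convex_orient_pos (a b : ℝ × ℝ) : Convex ℝ {p | 0 < orient a b p} := by
  intro p hp q hq s t hs ht hst
  simp only [Set.mem_ofPred_eq] at hp hq ⊢
  rw [orient_combo _ _ _ _ hst]
  rcases hs.eq_or_lt with rfl | hs
  · have : t = 1 := by linarith
    subst this
    simpa using hq
  · have := mul_pos hs hp
    have := mul_nonneg ht hq.le
    linarith

lemma orient_sum (a b c p : ℝ × ℝ) :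
    orient a b p + orient b c p + orient c a p = orient a b c := by
  unfold orient
  ring

lemma convexHull_triangle {a b c : ℝ × ℝ} (h : 0 < orient a b c) :
    convexHull ℝ ({a, b, c} : Set (ℝ × ℝ)) =
      {p | 0 ≤ orient a b p ∧ 0 ≤ orient b c p ∧ 0 ≤ orient c a p} := by
  apply Set.Subset.antisymm
  · apply convexHull_min
    · have h1 := orient_rotate a b c
      have h2 := orient_rotate b c a
      rintro p (rfl | rfl | rfl) <;>
        simp only [Set.mem_ofPred_eq, orient_self_left, orient_self_right] <;>
        refine ⟨?_, ?_, ?_⟩ <;> linarith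
    · exact (convex_orient_nonneg a b).inter
        ((convex_orient_nonneg b c).inter (convex_orient_nonneg c a))
  · rintro p ⟨h1, h2, h3⟩
    have hsum := orient_sum a b c p
    have hmem := (convex_convexHull ℝ ({a, b, c} : Set (ℝ × ℝ))).sum_mem
      (t := (Finset.univ : Finset (Fin 3)))
      (w := ![orient b c p / orient a b c, orient c a p / orient a b c,
        orient a b p / orient a b c]) (z := ![a, b, c]) (by
        intro i _
        fin_cases i <;> simp <;> positivity) (by
        simp only [Fin.sum_univ_three]
        simp
        field_simp
        linarith) (by
        intro i _
        apply subset_convexHull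
        fin_cases i <;> simp)
    convert hmem using 1
    simp only [Fin.sum_univ_three]
    simp
    have hne := h.ne'
    ext
    · simp
      field_simp
      unfold orient
      ring
    · simp
      field_simp
      unfold orient
      ring

lemma exists_pos_add_smul_mem {U : Set (ℝ × ℝ)} (hU : IsOpen U) {p : ℝ × ℝ} (hp : p ∈ U)
    (d : ℝ × ℝ) : ∃ t : ℝ, 0 < t ∧ p + t • d ∈ U := by
  have hc : Continuous (fun t : ℝ => p + t • d) := by fun_prop
  have h0 : (fun t : ℝ => p + t • d) ⁻¹' U ∈ nhds (0 : ℝ) := by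
    apply hc.continuousAt.preimage_mem_nhds
    simpa using hU.mem_nhds hp
  obtain ⟨ε, hε, h⟩ := Metric.mem_nhds_iff.1 h0
  refine ⟨ε / 2, by positivity, h ?_⟩
  rw [Metric.mem_ball, Real.dist_eq, sub_zero, abs_of_pos (by positivity)]
  linarith

lemma openTriangle_eq {a b c : ℝ × ℝ} (h : 0 < orient a b c) :
    PlaneGraph.openTriangle a b c =
      {p | 0 < orient a b p ∧ 0 < orient b c p ∧ 0 < orient c a p} := by
  unfold PlaneGraph.openTriangle
  apply Set.Subset.antisymm
  · have key : ∀ a b c : ℝ × ℝ, 0 < orient a b c → ∀ S : Set (ℝ × ℝ),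
        (∀ p ∈ S, 0 ≤ orient a b p) → ∀ p ∈ interior S, 0 < orient a b p := by
      intro a b c h S hS p hp
      obtain ⟨t, ht, htS⟩ := exists_pos_add_smul_mem isOpen_interior hp (p - c)
      have h1 := hS _ (interior_subset htS)
      have h2 : orient a b (p + t • (p - c)) = (1 + t) * orient a b p - t * orient a b c := by
        simp only [orient, Prod.fst_add, Prod.snd_add, Prod.smul_fst, Prod.smul_snd, smul_eq_mul,
          Prod.fst_sub, Prod.snd_sub]
        ring
      rw [h2] at h1
      have := mul_pos ht h
      by_contra hcon
      push Not at hcon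
      have := mul_nonneg_of_nonpos_of_nonpos (a := -(1 + t)) (by linarith) hcon
      linarith
    have h1 := orient_rotate a b c
    have h2 := orient_rotate b c a
    intro p hp
    rw [convexHull_triangle h] at hp
    exact ⟨key a b c h _ (fun q hq => hq.1) p hp,
      key b c a (by linarith) _ (fun q hq => hq.2.1) p hp,
      key c a b (by linarith) _ (fun q hq => hq.2.2) p hp⟩
  · rw [convexHull_triangle h]
    apply interior_maximal
    · rintro p ⟨h1, h2, h3⟩
      exact ⟨h1.le, h2.le, h3.le⟩
    · exact (isOpen_lt continuous_const (continuous_orient a b)).inter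
        ((isOpen_lt continuous_const (continuous_orient b c)).inter
          (isOpen_lt continuous_const (continuous_orient c a)))

lemma openTriangle_rotate (a b c : ℝ × ℝ) :
    PlaneGraph.openTriangle b c a = PlaneGraph.openTriangle a b c := by
  unfold PlaneGraph.openTriangle
  congr 2
  ext
  simp
  tauto

lemma openTriangle_swap (a b c : ℝ × ℝ) :
    PlaneGraph.openTriangle b a c = PlaneGraph.openTriangle a b c := by
  unfold PlaneGraph.openTriangle
  congr 2
  ext
  simp
  tauto

lemma openTriangle_nonempty {a b c : ℝ × ℝ} (h : 0 < orient a b c) :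
    (PlaneGraph.openTriangle a b c).Nonempty := by
  rw [openTriangle_eq h]
  refine ⟨(1 / 3 : ℝ) • a + (2 / 3 : ℝ) • ((1 / 2 : ℝ) • b + (1 / 2 : ℝ) • c), ?_⟩
  have h1 := orient_rotate a b c
  have h2 := orient_rotate b c a
  simp only [Set.mem_ofPred_eq, orient_combo _ _ _ _ (show (1 / 3 : ℝ) + 2 / 3 = 1 by norm_num),
    orient_combo _ _ _ _ (show (1 / 2 : ℝ) + 1 / 2 = 1 by norm_num), orient_self_left,
    orient_self_right]
  refine ⟨?_, ?_, ?_⟩ <;> linarith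

lemma isOpen_openTriangle (a b c : ℝ × ℝ) : IsOpen (PlaneGraph.openTriangle a b c) :=
  isOpen_interior

lemma convex_openTriangle (a b c : ℝ × ℝ) : Convex ℝ (PlaneGraph.openTriangle a b c) :=
  (convex_convexHull ℝ _).interior

lemma mem_segment_of_orient_eq_zero {a b c p : ℝ × ℝ} (h : 0 < orient a b c)
    (h1 : orient a b p = 0) (h2 : 0 ≤ orient b c p) (h3 : 0 ≤ orient c a p) :
    p ∈ segment ℝ a b := by
  have hsum := orient_sum a b c p
  have hne := h.ne'
  refine ⟨orient b c p / orient a b c, orient c a p / orient a b c, by positivity, by positivity,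
    ?_, ?_⟩
  · field_simp
    linarith
  · have e1 : orient a b c * p.1 =
        orient b c p * a.1 + orient c a p * b.1 + orient a b p * c.1 := by
      unfold orient
      ring
    have e2 : orient a b c * p.2 =
        orient b c p * a.2 + orient c a p * b.2 + orient a b p * c.2 := by
      unfold orient
      ring
    rw [h1] at e1 e2
    ext
    · simp
      field_simp
      linarith
    · simp
      field_simp
      linarith

/-- A point of the cone at `z` over `ab` lies on a line joining `z` to a point of `ab`. -/
lemma exists_combo_of_mem_cone {z a b p : ℝ × ℝ} (h : 0 < orient z a b) (h1 : 0 < orient z a p)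
    (h2 : 0 < orient p b z) :
    ∃ e ∈ segment ℝ a b, ∃ t : ℝ, p = e + t • (z - e) ∧ orient a b p = t * orient z a b := by
  have hne := h.ne'
  set s := orient p b z + orient z a p with hs
  have hs0 : 0 < s := by positivity
  have hs' := hs0.ne'
  have hsum : orient a b p = orient z a b - s := by
    rw [hs]
    unfold orient
    ring
  refine ⟨(orient p b z / s) • a + (orient z a p / s) • b,
    ⟨_, _, by positivity, by positivity, ?_, rfl⟩, 1 - s / orient z a b, ?_, ?_⟩
  · field_simp
    exact hs.symm
  · have e1 : orient z a b * p.1 =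
        orient p b z * a.1 + orient z a p * b.1 + (orient z a b - s) * z.1 := by
      rw [hs]
      unfold orient
      ring
    have e2 : orient z a b * p.2 =
        orient p b z * a.2 + orient z a p * b.2 + (orient z a b - s) * z.2 := by
      rw [hs]
      unfold orient
      ring
    ext
    · simp
      field_simp
      linear_combination s * e1
    · simp
      field_simp
      linear_combination s * e2
  · rw [hsum]
    field_simp

namespace PlaneGraph

variable (H : PlaneGraph)

/-- A positively oriented triangle of the graph whose interior misses the drawing. -/
def IsEmptyTriangle (a b c : ℝ × ℝ) : Prop :=
  H.Adj a b ∧ H.Adj b c ∧ H.Adj c a ∧ 0 < orient a b c ∧ Disjoint (openTriangle a b c) H.drawing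

/-- Adding a vertex `z` joined to the vertices in the list `N`. -/
def addVertex (z : ℝ × ℝ) (N : List (ℝ × ℝ)) (hz : z ∉ H.verts) (hN : ∀ q ∈ N, q ∈ H.verts) :
    PlaneGraph where
  verts := insert z H.verts
  Adj p q := H.Adj p q ∨ (p = z ∧ q ∈ N) ∨ (q = z ∧ p ∈ N)
  symm p q h := by
    rcases h with h | h | h
    exacts [Or.inl (H.symm _ _ h), Or.inr (Or.inr h), Or.inr (Or.inl h)]
  loopless p h := by
    rcases h with h | ⟨rfl, h⟩ | ⟨rfl, h⟩
    exacts [H.loopless _ h, hz (hN _ h), hz (hN _ h)]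
  mem_of_adj p q h := by
    rcases h with h | ⟨rfl, h⟩ | ⟨rfl, h⟩
    · exact ⟨Finset.mem_insert_of_mem (H.mem_of_adj _ _ h).1,
        Finset.mem_insert_of_mem (H.mem_of_adj _ _ h).2⟩
    · exact ⟨Finset.mem_insert_self _ _, Finset.mem_insert_of_mem (hN _ h)⟩
    · exact ⟨Finset.mem_insert_of_mem (hN _ h), Finset.mem_insert_self _ _⟩

variable {H} {z : ℝ × ℝ} {N : List (ℝ × ℝ)} {hz : z ∉ H.verts} {hN : ∀ q ∈ N, q ∈ H.verts}

lemma mem_drawing_addVertex {x : ℝ × ℝ} :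
    x ∈ (H.addVertex z N hz hN).drawing ↔ x ∈ H.drawing ∨ ∃ q ∈ N, x ∈ segment ℝ q z := by
  constructor
  · rintro ⟨p, q, h | ⟨rfl, h⟩ | ⟨rfl, h⟩, hx⟩
    · exact Or.inl ⟨p, q, h, hx⟩
    · exact Or.inr ⟨q, h, segment_symm ℝ p q ▸ hx⟩
    · exact Or.inr ⟨p, h, hx⟩
  · rintro (⟨p, q, h, hx⟩ | ⟨q, hq, hx⟩)
    · exact ⟨p, q, Or.inl h, hx⟩
    · exact ⟨q, z, Or.inr (Or.inr ⟨rfl, hq⟩), hx⟩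

lemma isEmbedded_addVertex (hNe : N ≠ []) (hH : H.IsEmbedded) (hV : ∀ v ∈ H.verts, v ∈ H.drawing)
    (h1 : ∀ q ∈ N, ∀ p ∈ segment ℝ q z, p ∈ H.drawing → p = q)
    (h2 : ∀ q ∈ N, ∀ q' ∈ N, q ≠ q' → ∀ p ∈ segment ℝ q z, p ∈ segment ℝ q' z → p = z) :
    (H.addVertex z N hz hN).IsEmbedded := by
  have key1 : ∀ p q r x, H.Adj p q → r ∈ N → x ∈ segment ℝ p q → x ∈ segment ℝ r z →
      x = r ∧ (x = p ∨ x = q) := by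
    intro p q r x hpq hr hx hx'
    have := h1 r hr x hx' ⟨p, q, hpq, hx⟩
    subst this
    exact ⟨rfl, hH.2 p q x hpq (hN _ hr) hx⟩
  have key2 : ∀ q r x, q ∈ N → r ∈ N → x ∈ segment ℝ q z → x ∈ segment ℝ r z →
      q = r ∨ x = z := by
    intro q r x hq hr hx hx'
    by_cases h : q = r
    · exact Or.inl h
    · exact Or.inr (h2 q hq r hr h x hx hx')
  constructor
  · intro p q r s hpq hrs x hx hx'
    have e : ∀ p q : ℝ × ℝ, p = z ∧ q ∈ N ∨ q = z ∧ p ∈ N → ∃ t ∈ N, segment ℝ p q = segment ℝ t z ∧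
        ({p, q} : Set (ℝ × ℝ)) = {t, z} := by
      rintro p q (⟨rfl, h⟩ | ⟨rfl, h⟩)
      · exact ⟨q, h, segment_symm ℝ _ _, Set.pair_comm _ _⟩
      · exact ⟨p, h, rfl, rfl⟩
    rcases hpq with hpq | hpq <;> rcases hrs with hrs | hrs
    · exact hH.1 p q r s hpq hrs x hx hx'
    · obtain ⟨t, ht, e1, e2⟩ := e _ _ hrs
      rw [e1] at hx'
      obtain ⟨rfl, h⟩ := key1 p q t x hpq ht hx hx'
      rw [e2]
      right
      simp [h]
    · obtain ⟨t, ht, e1, e2⟩ := e _ _ hpq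
      rw [e1] at hx
      obtain ⟨rfl, h⟩ := key1 r s t x hrs ht hx' hx
      rw [e2]
      right
      simp [h]
    · obtain ⟨t, ht, e1, e2⟩ := e _ _ hpq
      obtain ⟨t', ht', e1', e2'⟩ := e _ _ hrs
      rw [e1] at hx
      rw [e1'] at hx'
      rw [e2, e2']
      rcases key2 t t' x ht ht' hx hx' with rfl | rfl
      · exact Or.inl rfl
      · right
        simp
  · have key : ∀ q ∈ N, ∀ v ∈ (H.addVertex z N hz hN).verts, v ∈ segment ℝ q z → v = q ∨ v = z := by
      intro q hq v hv hvs
      rcases Finset.mem_insert.1 hv with rfl | hv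
      · exact Or.inr rfl
      · exact Or.inl (h1 q hq v hvs (hV v hv))
    rintro p q v (h | ⟨rfl, h⟩ | ⟨rfl, h⟩) hv hvs
    · rcases Finset.mem_insert.1 hv with rfl | hv
      · exfalso
        obtain ⟨t, ht⟩ := List.exists_mem_of_ne_nil N hNe
        have := h1 t ht v (right_mem_segment ℝ _ _) ⟨p, q, h, hvs⟩
        exact hz (this ▸ hN t ht)
      · exact hH.2 p q v h hv hvs
    · rw [segment_symm] at hvs
      exact (key q h v hv hvs).symm
    · exact key p h v hv hvs

end PlaneGraph

/-- A plane graph lying between the `x`-axis and the graph of `g`, all of whose inner faces are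
empty triangles, with the path `Q` running from left to right along the graph of `g`. -/
structure Terrain (H : PlaneGraph) (Q : List (ℝ × ℝ)) (g : ℝ → ℝ) (M : ℝ) : Prop where
  embedded : H.IsEmbedded
  lipschitz : ∀ s t, |g s - g t| ≤ M * |s - t|
  increasing : Q.Pairwise (fun p q => p.1 < q.1)
  adj : ∀ p q, Consec Q p q → H.Adj p q
  subset : ∀ q ∈ Q, q ∈ H.verts
  on_graph : ∀ q ∈ Q, q.2 = g q.1
  segment_on_graph : ∀ p q, Consec Q p q → ∀ e ∈ segment ℝ p q, e.2 = g e.1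
  verts_subset : ∀ v ∈ H.verts, v ∈ H.drawing
  below : ∀ p ∈ H.drawing, 0 ≤ p.1 ∧ p.1 ≤ 1 ∧ 0 ≤ p.2 ∧ p.2 ≤ g p.1
  cover : ∀ p, p ∉ H.drawing → p.2 < 0 ∨ p.1 < 0 ∨ 1 < p.1 ∨ g p.1 < p.2 ∨
    ∃ a b c, H.IsEmptyTriangle a b c ∧ p ∈ PlaneGraph.openTriangle a b c ∧
      ∀ q ∈ PlaneGraph.openTriangle a b c, q.2 ≤ g q.1

section Peak

variable {g : ℝ → ℝ} {M : ℝ} {z e e' : ℝ × ℝ}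

lemma lt_snd_add_smul (hg : ∀ s t, |g s - g t| ≤ M * |s - t|) (he : e.2 = g e.1)
    (hz : M * |z.1 - e.1| < z.2 - e.2) {t : ℝ} (ht : 0 < t) :
    g (e + t • (z - e)).1 < (e + t • (z - e)).2 := by
  have h1 := hg (e.1 + t * (z.1 - e.1)) e.1
  simp only [Prod.fst_add, Prod.snd_add, Prod.smul_fst, Prod.smul_snd, Prod.fst_sub, Prod.snd_sub,
    smul_eq_mul]
  rw [show e.1 + t * (z.1 - e.1) - e.1 = t * (z.1 - e.1) by ring, abs_mul, abs_of_pos ht] at h1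
  have h2 := mul_lt_mul_of_pos_left hz ht
  have h3 := le_abs_self (g (e.1 + t * (z.1 - e.1)) - g e.1)
  rw [he] at h2 ⊢
  linarith

lemma snd_add_smul_le (hg : ∀ s t, |g s - g t| ≤ M * |s - t|) (he : e.2 = g e.1)
    (hz : M * |z.1 - e.1| < z.2 - e.2) {t : ℝ} (ht : t ≤ 0) :
    (e + t • (z - e)).2 ≤ g (e + t • (z - e)).1 := by
  have h1 := hg (e.1 + t * (z.1 - e.1)) e.1
  simp only [Prod.fst_add, Prod.snd_add, Prod.smul_fst, Prod.smul_snd, Prod.fst_sub, Prod.snd_sub,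
    smul_eq_mul]
  rw [show e.1 + t * (z.1 - e.1) - e.1 = t * (z.1 - e.1) by ring, abs_mul, abs_of_nonpos ht] at h1
  have h2 := mul_le_mul_of_nonneg_left hz.le (neg_nonneg.2 ht)
  have h3 := neg_abs_le (g (e.1 + t * (z.1 - e.1)) - g e.1)
  rw [he] at h2 ⊢
  linarith

lemma orient_pos_of_lt (hg : ∀ s t, |g s - g t| ≤ M * |s - t|) (he : e.2 = g e.1)
    (he' : e'.2 = g e'.1) (hz : M * |z.1 - e.1| < z.2 - e.2) (h : e.1 < e'.1) :
    0 < orient z e e' := by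
  have h1 := hg e'.1 e.1
  have hpos : 0 < e'.1 - e.1 := by linarith
  rw [← he, ← he', abs_of_pos hpos] at h1
  have h2 := mul_lt_mul_of_pos_right hz hpos
  have h3 : |(z.1 - e.1) * (e'.2 - e.2)| ≤ M * |z.1 - e.1| * (e'.1 - e.1) := by
    rw [abs_mul]
    calc |z.1 - e.1| * |e'.2 - e.2| ≤ |z.1 - e.1| * (M * (e'.1 - e.1)) := by gcongr
      _ = _ := by ring
  have h4 := le_abs_self ((z.1 - e.1) * (e'.2 - e.2))
  unfold orient
  linarith

/-- A point of the line `ze` below `z` and above the graph lies on the segment. -/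
lemma mem_segment_of_mem_line (hg : ∀ s t, |g s - g t| ≤ M * |s - t|) (he : e.2 = g e.1)
    (hz : M * |z.1 - e.1| < z.2 - e.2) (hM : 0 ≤ M) {p : ℝ × ℝ} (hp : g p.1 < p.2) (hpz : p.2 ≤ z.2)
    (h : orient z e p = 0) : p ∈ segment ℝ e z := by
  have hpos : 0 < z.2 - e.2 := lt_of_le_of_lt (by positivity) hz
  have hne := hpos.ne'
  have hp' : p = e + ((p.2 - e.2) / (z.2 - e.2)) • (z - e) := by
    unfold orient at h
    ext
    · simp
      field_simp
      linarith
    · simp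
      field_simp
      ring
  set t := (p.2 - e.2) / (z.2 - e.2) with ht
  have ht0 : 0 < t := by
    by_contra hcon
    push Not at hcon
    have := snd_add_smul_le hg he hz hcon
    rw [← hp'] at this
    linarith
  have ht1 : t ≤ 1 := by
    rw [ht, div_le_one hpos]
    linarith
  refine ⟨1 - t, t, by linarith, ht0.le, by ring, ?_⟩
  conv_rhs => rw [hp']
  rw [smul_sub, sub_smul, one_smul]
  abel

end Peak

lemma exists_consec_sign_change {α : Type*} {f : α → ℝ} {b : α} (hb : f b < 0) :
    ∀ {m : List α} {a : α}, 0 < f a → (∀ q ∈ m, f q ≠ 0) →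
      ∃ p q, Consec (a :: (m ++ [b])) p q ∧ 0 < f p ∧ f q < 0
  | [], a, ha, _ => ⟨a, b, ⟨[], [], rfl⟩, ha, hb⟩
  | k :: m, a, ha, h => by
    rcases lt_or_gt_of_ne (h k (by simp)) with hk | hk
    · exact ⟨a, k, ⟨[], m ++ [b], rfl⟩, ha, hk⟩
    · obtain ⟨p, q, hpq, h1, h2⟩ := exists_consec_sign_change hb hk
        (fun q hq => h q (List.mem_cons_of_mem _ hq))
      refine ⟨p, q, ?_, h1, h2⟩
      rw [List.cons_append, Consec.cons_cons_iff]
      exact Or.inr hpq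

lemma exists_of_mem_segment {e z p : ℝ × ℝ} (h : p ∈ segment ℝ e z) :
    ∃ t : ℝ, 0 ≤ t ∧ t ≤ 1 ∧ p = e + t • (z - e) := by
  rw [segment_eq_image'] at h
  obtain ⟨t, ht, rfl⟩ := h
  exact ⟨t, ht.1, ht.2, rfl⟩

/-- A new vertex can be placed high above a subpath of the upper boundary path. -/
lemma Terrain.exists_addVertex {H : PlaneGraph} {P l m r : List (ℝ × ℝ)} {a b : ℝ × ℝ} {g : ℝ → ℝ}
    {M : ℝ} (h : Terrain H P g M) (hP : P = l ++ a :: (m ++ b :: r)) :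
    ∃ (z : ℝ × ℝ) (hz : z ∉ H.verts) (hN : ∀ q ∈ a :: (m ++ [b]), q ∈ H.verts) (g' : ℝ → ℝ)
      (M' : ℝ), Terrain (H.addVertex z (a :: (m ++ [b])) hz hN) (l ++ a :: z :: b :: r) g' M' := by
  have hM : 0 ≤ M := by
    have := (abs_nonneg _).trans (h.lipschitz 1 0)
    simpa using this
  have hNP : ∀ q ∈ a :: (m ++ [b]), q ∈ P := by
    intro q hq
    rw [hP]
    simp only [List.mem_append, List.mem_cons, List.not_mem_nil, or_false] at hq ⊢
    tauto
  have hN : ∀ q ∈ a :: (m ++ [b]), q ∈ H.verts := fun q hq => h.subset q (hNP q hq)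
  have hbelowV : ∀ q ∈ P, 0 ≤ q.1 ∧ q.1 ≤ 1 ∧ 0 ≤ q.2 ∧ q.2 ≤ g q.1 :=
    fun q hq => h.below q (h.verts_subset q (h.subset q hq))
  have haP : a ∈ P := by simp [hP]
  have hbP : b ∈ P := by simp [hP]
  have hinc := h.increasing
  have hab : a.1 < b.1 := by
    rw [hP] at hinc
    grind
  obtain ⟨ha0, ha1, -, -⟩ := hbelowV a haP
  obtain ⟨hb0, hb1, -, -⟩ := hbelowV b hbP
  set z : ℝ × ℝ := ((a.1 + b.1) / 2, |g 0| + 3 * M + 1) with hzdef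
  have haz : a.1 < z.1 := by simp only [hzdef]; linarith
  have hzb : z.1 < b.1 := by simp only [hzdef]; linarith
  have hpeak : ∀ e : ℝ × ℝ, e.2 = g e.1 → 0 ≤ e.1 → e.1 ≤ 1 → M * |z.1 - e.1| < z.2 - e.2 := by
    intro e he h0 h1
    have h2 := h.lipschitz e.1 0
    rw [sub_zero, abs_of_nonneg h0] at h2
    have h3 : |z.1 - e.1| ≤ 1 := abs_le.2 ⟨by linarith, by linarith⟩
    have h4 := mul_le_mul_of_nonneg_left h3 hM
    have h5 := mul_le_mul_of_nonneg_left h1 hM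
    have h6 := le_abs_self (g e.1 - g 0)
    have h7 := le_abs_self (g 0)
    have hz2 : z.2 = |g 0| + 3 * M + 1 := rfl
    rw [hz2, he]
    linarith
  have hpeakP : ∀ q ∈ P, M * |z.1 - q.1| < z.2 - q.2 := fun q hq =>
    hpeak q (h.on_graph q hq) (hbelowV q hq).1 (hbelowV q hq).2.1
  have hpeakseg : ∀ p q, Consec P p q → ∀ e ∈ segment ℝ p q,
      e.2 = g e.1 ∧ M * |z.1 - e.1| < z.2 - e.2 := by
    intro p q hpq e he
    have h1 := h.segment_on_graph p q hpq e he
    have h2 := h.below e ⟨p, q, h.adj p q hpq, he⟩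
    exact ⟨h1, hpeak e h1 h2.1 h2.2.1⟩
  -- the new edges are above the graph of `g`
  have hnew : ∀ q ∈ P, ∀ p ∈ segment ℝ q z, p = q ∨ g p.1 < p.2 := by
    intro q hq p hp
    obtain ⟨t, ht0, -, rfl⟩ := exists_of_mem_segment hp
    rcases ht0.eq_or_lt with rfl | ht
    · simp
    · exact Or.inr (lt_snd_add_smul h.lipschitz (h.on_graph q hq) (hpeakP q hq) ht)
  have hzg : ∀ q ∈ P, q.2 < z.2 := by
    intro q hq
    have := (mul_nonneg hM (abs_nonneg _)).trans_lt (hpeakP q hq)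
    linarith
  have hz : z ∉ H.verts := by
    intro hzV
    have h1 := h.below z (h.verts_subset z hzV)
    rcases hnew a haP z (right_mem_segment ℝ _ _) with h2 | h2
    · rw [h2] at haz
      exact lt_irrefl _ haz
    · linarith
  have horient : ∀ p ∈ P, ∀ q ∈ P, p.1 < q.1 → 0 < orient z p q := fun p hp q hq hpq =>
    orient_pos_of_lt h.lipschitz (h.on_graph p hp) (h.on_graph q hq) (hpeakP p hp) hpq
  have htri : ∀ p ∈ P, ∀ q ∈ P, p ≠ q → p.1 < q.1 ∨ q.1 < p.1 := by
    intro p hp q hq hpq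
    have : Std.Symm (fun p q : ℝ × ℝ => p.1 < q.1 ∨ q.1 < p.1) := ⟨fun _ _ => Or.symm⟩
    exact (hinc.imp (S := fun p q => p.1 < q.1 ∨ q.1 < p.1) (fun h => Or.inl h)).forall hp hq hpq
  have hcons : ∀ p q, Consec P p q → p.1 < q.1 ∧ ∀ s ∈ P, s.1 ≤ p.1 ∨ q.1 ≤ s.1 := by
    rintro p q ⟨l', r', hl⟩
    rw [hl] at hinc ⊢
    simp only [List.pairwise_append, List.pairwise_cons, List.mem_cons, List.mem_append] at hinc ⊢
    refine ⟨hinc.2.1.1 q (Or.inl rfl), ?_⟩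
    rintro s (hs | rfl | rfl | hs)
    · exact Or.inl (hinc.2.2 s hs p (Or.inl rfl)).le
    · exact Or.inl le_rfl
    · exact Or.inr le_rfl
    · exact Or.inr (hinc.2.1.2.1 s hs).le
  have hNab : ∀ q ∈ a :: (m ++ [b]), a.1 ≤ q.1 ∧ q.1 ≤ b.1 := by
    intro q hq
    rw [hP] at hinc
    simp only [List.pairwise_append, List.pairwise_cons, List.mem_cons, List.mem_append,
      List.not_mem_nil, or_false] at hinc hq
    obtain ⟨-, ⟨h1, -, -, h2⟩, -⟩ := hinc
    rcases hq with rfl | hq | rfl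
    · exact ⟨le_rfl, hab.le⟩
    · exact ⟨(h1 q (Or.inl hq)).le, (h2 q hq b (Or.inl rfl)).le⟩
    · exact ⟨hab.le, le_rfl⟩
  have hla : ∀ q ∈ l, q.1 < a.1 := by
    intro q hq
    rw [hP] at hinc
    exact (List.pairwise_append.1 hinc).2.2 q hq a (by simp)
  have hrb : ∀ q ∈ r, b.1 < q.1 := by
    intro q hq
    rw [hP] at hinc
    simp only [List.pairwise_append, List.pairwise_cons] at hinc
    exact hinc.2.1.2.2.1.1 q hq
  -- the new upper boundary
  set s₁ := (z.2 - a.2) / (z.1 - a.1) with hs₁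
  set s₂ := (z.2 - b.2) / (z.1 - b.1) with hs₂
  have hza : z.1 - a.1 ≠ 0 := by linarith
  have hzb' : z.1 - b.1 ≠ 0 := by linarith
  have hs₁z : s₁ * (z.1 - a.1) = z.2 - a.2 := div_mul_cancel₀ _ hza
  have hs₂z : s₂ * (z.1 - b.1) = z.2 - b.2 := div_mul_cancel₀ _ hzb'
  have hs₁M : M < s₁ := by
    have := hpeakP a haP
    rw [abs_of_pos (by linarith), ← hs₁z] at this
    exact lt_of_mul_lt_mul_right this (by linarith)
  have hs₂M : s₂ < -M := by
    have := hpeakP b hbP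
    rw [abs_of_neg (by linarith), ← hs₂z] at this
    have h1 : M * (b.1 - z.1) < -s₂ * (b.1 - z.1) := by linarith
    have := lt_of_mul_lt_mul_right h1 (by linarith)
    linarith
  set L₁ : ℝ → ℝ := fun t => a.2 + s₁ * (t - a.1) with hL₁
  set L₂ : ℝ → ℝ := fun t => b.2 + s₂ * (t - b.1) with hL₂
  set g' : ℝ → ℝ := fun t => max (g t) (min (L₁ t) (L₂ t)) with hg'
  have hgg' : ∀ t, g t ≤ g' t := fun t => le_max_left _ _
  have hLa : ∀ p : ℝ × ℝ, orient z a p = (z.1 - a.1) * (L₁ p.1 - p.2) := by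
    intro p
    have : (z.1 - a.1) * (L₁ p.1 - p.2) =
        (z.1 - a.1) * (a.2 - p.2) + (s₁ * (z.1 - a.1)) * (p.1 - a.1) := by
      simp only [hL₁]
      ring
    rw [this, hs₁z]
    unfold orient
    ring
  have hLb : ∀ p : ℝ × ℝ, orient z b p = -((b.1 - z.1) * (L₂ p.1 - p.2)) := by
    intro p
    have : (b.1 - z.1) * (L₂ p.1 - p.2) =
        (b.1 - z.1) * (b.2 - p.2) - (s₂ * (z.1 - b.1)) * (p.1 - b.1) := by
      simp only [hL₂]
      ring
    rw [this, hs₂z]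
    unfold orient
    ring
  have hle_g' : ∀ p : ℝ × ℝ, 0 ≤ orient z a p → 0 ≤ orient b z p → p.2 ≤ g' p.1 := by
    intro p h1 h2
    rw [orient_swap, hLb, neg_neg] at h2
    rw [hLa] at h1
    have h3 := nonneg_of_mul_nonneg_right h1 (by linarith)
    have h4 := nonneg_of_mul_nonneg_right h2 (by linarith)
    exact le_max_of_le_right (le_min (by linarith) (by linarith))
  have hg'left : ∀ t, t ≤ a.1 → g' t = g t := by
    intro t ht
    refine max_eq_left (min_le_of_left_le ?_)
    have h1 := h.lipschitz t a.1
    rw [abs_of_nonpos (by linarith : t - a.1 ≤ 0), ← h.on_graph a haP] at h1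
    have h2 := neg_abs_le (g t - a.2)
    have h3 := mul_le_mul_of_nonneg_right hs₁M.le (by linarith : 0 ≤ a.1 - t)
    simp only [hL₁]
    linarith
  have hg'right : ∀ t, b.1 ≤ t → g' t = g t := by
    intro t ht
    refine max_eq_left (min_le_of_right_le ?_)
    have h1 := h.lipschitz t b.1
    rw [abs_of_nonneg (by linarith : 0 ≤ t - b.1), ← h.on_graph b hbP] at h1
    have h2 := neg_abs_le (g t - b.2)
    have h3 := mul_le_mul_of_nonneg_right hs₂M.le (by linarith : 0 ≤ t - b.1)
    simp only [hL₂]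
    linarith
  have hoN : ∀ q ∈ a :: (m ++ [b]), 0 ≤ orient z a q ∧ 0 ≤ orient b z q := by
    intro q hq
    have hqP := hNP q hq
    have h1 := hNab q hq
    constructor
    · by_cases h3 : q = a
      · rw [h3, orient_self_right]
      · exact (horient a haP q hqP ((htri q hqP a haP h3).resolve_left (by linarith))).le
    · by_cases h3 : q = b
      · rw [h3, orient_self_left]
      · rw [← orient_rotate b z q]
        exact (horient q hqP b hbP ((htri q hqP b hbP h3).resolve_right (by linarith))).le
  have hnewg' : ∀ q ∈ a :: (m ++ [b]), ∀ p ∈ segment ℝ q z, p.2 ≤ g' p.1 := by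
    intro q hq p hp
    exact hle_g' p ((convex_orient_nonneg z a).segment_subset (hoN q hq).1
      (by simp [orient_self_left]) hp) ((convex_orient_nonneg b z).segment_subset (hoN q hq).2
      (by simp [orient_self_right]) hp)
  have hgz : g z.1 < z.2 :=
    (hnew a haP z (right_mem_segment ℝ _ _)).resolve_left (fun h => haz.ne' (congrArg Prod.fst h))
  have hg'seg : ∀ p : ℝ × ℝ, g p.1 ≤ p.2 → p.2 ≤ L₁ p.1 → p.2 ≤ L₂ p.1 →
      (p.2 = L₁ p.1 ∨ p.2 = L₂ p.1) → p.2 = g' p.1 := by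
    intro p h1 h2 h3 h4
    refine le_antisymm (le_max_of_le_right (le_min h2 h3)) (max_le h1 ?_)
    rcases h4 with h4 | h4
    · exact (min_le_left _ _).trans h4.ge
    · exact (min_le_right _ _).trans h4.ge
  refine ⟨z, hz, hN, g', max M (max |s₁| |s₂|), ?_, ?_, ?_, ?_, ?_, ?_, ?_, ?_, ?_, ?_⟩
  · refine PlaneGraph.isEmbedded_addVertex (by simp) h.embedded h.verts_subset ?_ ?_
    · intro q hq p hp hpd
      exact (hnew q (hNP q hq) p hp).resolve_right (not_lt.2 (h.below p hpd).2.2.2)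
    · intro q hq q' hq' hne p hp hp'
      obtain ⟨t, -, -, hpt⟩ := exists_of_mem_segment hp
      obtain ⟨t', -, -, hpt'⟩ := exists_of_mem_segment hp'
      have h1 : orient z q p = 0 := by
        rw [hpt]
        unfold orient
        simp
        ring
      have h2 : orient z q p = (1 - t') * orient z q q' := by
        rw [hpt']
        unfold orient
        simp
        ring
      have h3 : orient z q q' ≠ 0 := by
        rcases htri q (hNP q hq) q' (hNP q' hq') hne with h3 | h3
        · exact (horient q (hNP q hq) q' (hNP q' hq') h3).ne'
        · rw [orient_swap_right]
          exact (neg_neg_of_pos (horient q' (hNP q' hq') q (hNP q hq) h3)).ne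
      rw [h1] at h2
      have h4 : t' = 1 := by
        have := (mul_eq_zero.1 h2.symm).resolve_right h3
        linarith
      rw [hpt', h4]
      simp
  · intro s t
    have e1 : |L₁ s - L₁ t| = |s₁| * |s - t| := by
      rw [← abs_mul]
      congr 1
      simp only [hL₁]
      ring
    have e2 : |L₂ s - L₂ t| = |s₂| * |s - t| := by
      rw [← abs_mul]
      congr 1
      simp only [hL₂]
      ring
    calc |g' s - g' t| ≤ max |g s - g t| |min (L₁ s) (L₂ s) - min (L₁ t) (L₂ t)| :=
          abs_max_sub_max_le_max _ _ _ _
      _ ≤ max |g s - g t| (max |L₁ s - L₁ t| |L₂ s - L₂ t|) :=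
          max_le_max le_rfl (abs_min_sub_min_le_max _ _ _ _)
      _ ≤ max (M * |s - t|) (max (|s₁| * |s - t|) (|s₂| * |s - t|)) :=
          max_le_max (h.lipschitz s t) (max_le_max e1.le e2.le)
      _ = _ := by
        rw [max_mul_of_nonneg _ _ (abs_nonneg _), max_mul_of_nonneg _ _ (abs_nonneg _)]
  · rw [hP] at hinc
    simp only [List.pairwise_append, List.pairwise_cons, List.mem_cons] at hinc ⊢
    refine ⟨hinc.1, ⟨?_, ?_, hrb, ?_⟩, ?_⟩
    · rintro q (rfl | rfl | hq)
      exacts [haz, hab, hab.trans (hrb q hq)]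
    · rintro q (rfl | hq)
      exacts [hzb, hzb.trans (hrb q hq)]
    · exact hinc.2.1.2.2.1.2
    · intro q hq q' hq'
      have := hla q hq
      rcases hq' with rfl | rfl | rfl | hq'
      · exact this
      · exact this.trans haz
      · exact this.trans hab
      · exact (this.trans hab).trans (hrb q' hq')
  · intro p q hpq
    rw [Consec.append_cons_iff, Consec.cons_cons_iff, Consec.cons_cons_iff] at hpq
    rcases hpq with hpq | ⟨rfl, rfl⟩ | ⟨rfl, rfl⟩ | hpq
    · refine Or.inl (h.adj _ _ ?_)
      rw [hP]
      exact Consec.append_cons_iff.2 (Or.inl hpq)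
    · exact Or.inr (Or.inr ⟨rfl, by simp⟩)
    · exact Or.inr (Or.inl ⟨rfl, by simp⟩)
    · refine Or.inl (h.adj _ _ ?_)
      rw [hP]
      refine Consec.append_cons_iff.2 (Or.inr ?_)
      rw [← List.cons_append]
      exact Consec.append_cons_iff.2 (Or.inr hpq)
  · intro q hq
    have : q = z ∨ q ∈ P := by
      rw [hP]
      simp only [List.mem_append, List.mem_cons] at hq ⊢
      tauto
    rcases this with rfl | hq
    · exact Finset.mem_insert_self _ _
    · exact Finset.mem_insert_of_mem (h.subset q hq)
  · intro q hq
    simp only [List.mem_append, List.mem_cons] at hq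
    rcases hq with hq | rfl | rfl | rfl | hq
    · rw [hg'left _ (hla q hq).le]
      exact h.on_graph q (by simp [hP, hq])
    · rw [hg'left _ le_rfl]
      exact h.on_graph q haP
    · have h1 : L₁ z.1 = z.2 := by
        simp only [hL₁]
        rw [hs₁z]
        ring
      have h2 : L₂ z.1 = z.2 := by
        simp only [hL₂]
        rw [hs₂z]
        ring
      exact hg'seg z hgz.le h1.ge h2.ge (Or.inl h1.symm)
    · rw [hg'right _ le_rfl]
      exact h.on_graph q hbP
    · rw [hg'right _ (hrb q hq).le]
      exact h.on_graph q (by simp [hP, hq])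
  · intro p q hpq e he
    have hx1 : ∀ c : ℝ, p.1 ≤ c → q.1 ≤ c → e.1 ≤ c := fun c h1 h2 =>
      (convex_halfSpace_le (f := Prod.fst) ⟨fun _ _ => rfl, fun _ _ => rfl⟩ c).segment_subset
        h1 h2 he
    have hx2 : ∀ c : ℝ, c ≤ p.1 → c ≤ q.1 → c ≤ e.1 := fun c h1 h2 =>
      (convex_halfSpace_ge (f := Prod.fst) ⟨fun _ _ => rfl, fun _ _ => rfl⟩ c).segment_subset
        h1 h2 he
    rw [Consec.append_cons_iff, Consec.cons_cons_iff, Consec.cons_cons_iff] at hpq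
    rcases hpq with hpq | ⟨rfl, rfl⟩ | ⟨rfl, rfl⟩ | hpq
    · have hle : ∀ s ∈ l ++ [a], s.1 ≤ a.1 := by
        intro s hs
        rcases List.mem_append.1 hs with hs | hs
        · exact (hla s hs).le
        · simp at hs
          rw [hs]
      rw [hg'left _ (hx1 _ (hle p hpq.mem_left) (hle q hpq.mem_right))]
      refine h.segment_on_graph p q ?_ e he
      rw [hP]
      exact Consec.append_cons_iff.2 (Or.inl hpq)
    · have h0 : orient z p e = 0 := by
        obtain ⟨t, -, -, rfl⟩ := exists_of_mem_segment he
        unfold orient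
        simp
        ring
      have h1 : e.2 = L₁ e.1 := by
        rw [hLa] at h0
        have := (mul_eq_zero.1 h0).resolve_left hza
        linarith
      have h2 : e.2 ≤ L₂ e.1 := by
        have := (convex_orient_nonneg b z).segment_subset (hoN p (by simp)).2
          (by simp [orient_self_right]) he
        rw [Set.mem_ofPred_eq, orient_swap, hLb, neg_neg] at this
        have := nonneg_of_mul_nonneg_right this (by linarith)
        linarith
      refine hg'seg e ?_ h1.le h2 (Or.inl h1)
      rcases hnew p haP e he with rfl | h3
      · exact (h.on_graph e haP).ge
      · exact h3.le
    · rw [segment_symm] at he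
      have h0 : orient z q e = 0 := by
        obtain ⟨t, -, -, rfl⟩ := exists_of_mem_segment he
        unfold orient
        simp
        ring
      have h1 : e.2 = L₂ e.1 := by
        rw [hLb] at h0
        have := (mul_eq_zero.1 (neg_eq_zero.1 h0)).resolve_left (by linarith)
        linarith
      have h2 : e.2 ≤ L₁ e.1 := by
        have := (convex_orient_nonneg z a).segment_subset (hoN q (by simp)).1
          (by simp [orient_self_left]) he
        rw [Set.mem_ofPred_eq, hLa] at this
        have := nonneg_of_mul_nonneg_right this (by linarith)
        linarith
      refine hg'seg e ?_ h2 h1.le (Or.inr h1)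
      rcases hnew q hbP e he with rfl | h3
      · exact (h.on_graph e hbP).ge
      · exact h3.le
    · have hge : ∀ s ∈ b :: r, b.1 ≤ s.1 := by
        intro s hs
        rcases List.mem_cons.1 hs with rfl | hs
        · exact le_rfl
        · exact (hrb s hs).le
      rw [hg'right _ (hx2 _ (hge p hpq.mem_left) (hge q hpq.mem_right))]
      refine h.segment_on_graph p q ?_ e he
      rw [hP]
      refine Consec.append_cons_iff.2 (Or.inr ?_)
      rw [← List.cons_append]
      exact Consec.append_cons_iff.2 (Or.inr hpq)
  · intro v hv
    rw [PlaneGraph.mem_drawing_addVertex]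
    rcases Finset.mem_insert.1 hv with rfl | hv
    · exact Or.inr ⟨a, by simp, right_mem_segment ℝ _ _⟩
    · exact Or.inl (h.verts_subset v hv)
  · intro p hp
    rcases PlaneGraph.mem_drawing_addVertex.1 hp with hp | ⟨q, hq, hpq⟩
    · obtain ⟨h1, h2, h3, h4⟩ := h.below p hp
      exact ⟨h1, h2, h3, h4.trans (hgg' _)⟩
    · obtain ⟨h1, h2, h3, -⟩ := hbelowV q (hNP q hq)
      have hz0 := hzg q (hNP q hq)
      refine ⟨?_, ?_, ?_, hnewg' q hq p hpq⟩
      · exact (convex_halfSpace_ge (f := Prod.fst) ⟨fun _ _ => rfl, fun _ _ => rfl⟩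
          (0 : ℝ)).segment_subset h1 (ha0.trans haz.le) hpq
      · exact (convex_halfSpace_le (f := Prod.fst) ⟨fun _ _ => rfl, fun _ _ => rfl⟩
          (1 : ℝ)).segment_subset h2 (hzb.le.trans hb1) hpq
      · exact (convex_halfSpace_ge (f := Prod.snd) ⟨fun _ _ => rfl, fun _ _ => rfl⟩
          (0 : ℝ)).segment_subset h3 (h3.trans hz0.le) hpq
  · intro p hp
    rw [PlaneGraph.mem_drawing_addVertex, not_or] at hp
    obtain ⟨hpd, hpn⟩ := hp
    by_cases hgp : g p.1 < p.2
    · by_cases hg'p : g' p.1 < p.2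
      · exact Or.inr (Or.inr (Or.inr (Or.inl hg'p)))
      push Not at hg'p
      have hL : p.2 ≤ L₁ p.1 ∧ p.2 ≤ L₂ p.1 := by
        rcases le_max_iff.1 hg'p with h1 | h1
        · linarith
        · exact le_min_iff.1 h1
      have hoa : 0 ≤ orient z a p := by
        rw [hLa]
        exact mul_nonneg (by linarith) (by linarith)
      have hob : orient z b p ≤ 0 := by
        rw [hLb]
        exact neg_nonpos.2 (mul_nonneg (by linarith) (by linarith))
      have hpz : p.2 ≤ z.2 := by
        rcases le_total p.1 z.1 with h1 | h1
        · have h2 : s₁ * (p.1 - a.1) ≤ s₁ * (z.1 - a.1) :=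
            mul_le_mul_of_nonneg_left (by linarith) (hM.trans hs₁M.le)
          have h3 : p.2 ≤ a.2 + s₁ * (p.1 - a.1) := hL.1
          linarith
        · have h2 : s₂ * (p.1 - b.1) ≤ s₂ * (z.1 - b.1) :=
            mul_le_mul_of_nonpos_left (by linarith) (by linarith)
          have h3 : p.2 ≤ b.2 + s₂ * (p.1 - b.1) := hL.2
          linarith
      have hne : ∀ q ∈ a :: (m ++ [b]), orient z q p ≠ 0 := fun q hq h0 =>
        hpn ⟨q, hq, mem_segment_of_mem_line h.lipschitz (h.on_graph q (hNP q hq))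
          (hpeakP q (hNP q hq)) hM hgp hpz h0⟩
      obtain ⟨q, q', hqq, h1, h2⟩ := exists_consec_sign_change (f := fun q => orient z q p) (m := m)
        (lt_of_le_of_ne hob (hne b (by simp))) (lt_of_le_of_ne hoa (hne a (by simp)).symm)
        (fun q hq => hne q (by simp [hq]))
      have hqN := hqq.mem_left
      have hqN' := hqq.mem_right
      have hqP : Consec P q q' := by
        rw [hP]
        refine Consec.append_cons_iff.2 (Or.inr ?_)
        rw [← List.cons_append]
        exact Consec.append_cons_iff.2 (Or.inl hqq)
      obtain ⟨hqq1, hqq2⟩ := hcons q q' hqP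
      have hzqq := horient q (hNP q hqN) q' (hNP q' hqN') hqq1
      have hcone : ∀ x, 0 < orient z q x → 0 < orient q' z x → ∃ e ∈ segment ℝ q q', ∃ t : ℝ,
          x = e + t • (z - e) ∧ orient q q' x = t * orient z q q' := by
        intro x hx1 hx2
        refine exists_combo_of_mem_cone hzqq hx1 ?_
        rwa [← orient_rotate]
      have hswap : 0 < orient q' z p := by
        rw [orient_swap]
        exact neg_pos.2 h2
      have hmem : p ∈ PlaneGraph.openTriangle z q q' := by
        rw [openTriangle_eq hzqq]
        refine ⟨h1, ?_, hswap⟩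
        obtain ⟨e, he, t, hpe, hpt⟩ := hcone p h1 hswap
        rw [hpt]
        refine mul_pos ?_ hzqq
        by_contra hcon
        push Not at hcon
        obtain ⟨he1, he2⟩ := hpeakseg q q' hqP e he
        have := snd_add_smul_le h.lipschitz he1 he2 hcon
        rw [← hpe] at this
        linarith
      refine Or.inr (Or.inr (Or.inr (Or.inr ⟨z, q, q', ⟨Or.inr (Or.inl ⟨rfl, hqN⟩),
        Or.inl (h.adj q q' hqP), Or.inr (Or.inr ⟨rfl, hqN'⟩), hzqq, ?_⟩, hmem, ?_⟩)))
      · rw [Set.disjoint_left]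
        intro x hx hxd
        rw [openTriangle_eq hzqq] at hx
        obtain ⟨hx1, hx2, hx3⟩ := hx
        rcases PlaneGraph.mem_drawing_addVertex.1 hxd with hxd | ⟨s, hs, hxs⟩
        · obtain ⟨e, he, t, hpe, hpt⟩ := hcone x hx1 hx3
          rw [hpt] at hx2
          obtain ⟨he1, he2⟩ := hpeakseg q q' hqP e he
          have := lt_snd_add_smul h.lipschitz he1 he2 (pos_of_mul_pos_left hx2 hzqq.le)
          rw [← hpe] at this
          linarith [(h.below x hxd).2.2.2]
        · obtain ⟨t, -, ht1, hxt⟩ := exists_of_mem_segment hxs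
          have e1 : orient z q x = (1 - t) * orient z q s := by
            rw [hxt]
            unfold orient
            simp
            ring
          have e2 : orient q' z x = (1 - t) * orient q' z s := by
            rw [hxt]
            unfold orient
            simp
            ring
          rw [e1] at hx1
          rw [e2] at hx3
          have hs1 := pos_of_mul_pos_right hx1 (by linarith)
          have hs2 := pos_of_mul_pos_right hx3 (by linarith)
          have hsP := hNP s hs
          rcases hqq2 s hsP with hsq | hsq
          · rcases eq_or_ne s q with rfl | hne'
            · rw [orient_self_right] at hs1
              exact lt_irrefl _ hs1
            · have := horient s hsP q (hNP q hqN)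
                ((htri s hsP q (hNP q hqN) hne').resolve_right (by linarith))
              rw [orient_swap_right] at this
              linarith
          · rcases eq_or_ne s q' with rfl | hne'
            · rw [orient_self_left] at hs2
              exact lt_irrefl _ hs2
            · have := horient q' (hNP q' hqN') s hsP
                ((htri s hsP q' (hNP q' hqN') hne').resolve_left (by linarith))
              rw [orient_swap] at this
              linarith
      · intro x hx
        have hx' := interior_subset hx
        have hsub : ∀ S : Set (ℝ × ℝ), Convex ℝ S → z ∈ S → q ∈ S → q' ∈ S → x ∈ S := by
          intro S hS h1 h2 h3
          refine convexHull_min ?_ hS hx'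
          rintro y (rfl | rfl | rfl)
          exacts [h1, h2, h3]
        exact hle_g' x
          (hsub _ (convex_orient_nonneg z a) (by simp [orient_self_left]) (hoN q hqN).1
            (hoN q' hqN').1)
          (hsub _ (convex_orient_nonneg b z) (by simp [orient_self_right]) (hoN q hqN).2
            (hoN q' hqN').2)
    · rcases h.cover p hpd with h1 | h1 | h1 | h1 | ⟨a', b', c', ⟨k1, k2, k3, k4, k5⟩, hmem, hle⟩
      · exact Or.inl h1
      · exact Or.inr (Or.inl h1)
      · exact Or.inr (Or.inr (Or.inl h1))
      · exact absurd h1 hgp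
      · refine Or.inr (Or.inr (Or.inr (Or.inr ⟨a', b', c',
          ⟨Or.inl k1, Or.inl k2, Or.inl k3, k4, ?_⟩, hmem, fun q hq => (hle q hq).trans (hgg' _)⟩)))
        rw [Set.disjoint_left] at k5 ⊢
        intro x hx hxd
        rcases PlaneGraph.mem_drawing_addVertex.1 hxd with hxd | ⟨s, hs, hxs⟩
        · exact k5 hx hxd
        · rcases hnew s (hNP s hs) x hxs with rfl | h1
          · exact k5 hx (h.verts_subset x (hN x hs))
          · linarith [hle x hx]

lemma Shell.connected_delete {α : Type*} {V : Finset α} {A : α → α → Prop} {P : List α}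
    (h : Shell V A P) : ∀ (c : α) (K : Set α), (∀ x ∈ K, x ∈ V) → c ∉ K → K.Nonempty →
      (∀ x ∈ K, ∀ y, A x y → y ≠ c → y ∈ K) → ∀ y ∈ V, y ≠ c → y ∈ K := by
  induction h with
  | @base V A a b hab hV hA =>
    rintro c K hKV hc ⟨x, hx⟩ hK y hy hyc
    by_cases hxy : x = y
    · exact hxy ▸ hx
    · refine hK x hx y ?_ hyc
      rw [hA]
      have h1 := (hV x).1 (hKV x hx)
      have h2 := (hV y).1 hy
      grind
  | @step V V' A A' P P' l m r x y z hs hP hz hV hA hP' ih =>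
    intro c K hKV hc hKne hK
    have hxV : x ∈ V := hs.subset x (by simp [hP])
    have hyV : y ∈ V := hs.subset y (by simp [hP])
    have hxy : x ≠ y := by
      have := hs.nodup
      rw [hP] at this
      grind
    obtain ⟨w, hwV, hwc, hzw, hwz⟩ : ∃ w ∈ V, w ≠ c ∧ A' z w ∧ A' w z := by
      by_cases hxc : x = c
      · exact ⟨y, hyV, fun h => hxy (hxc.trans h.symm), (hA _ _).2 (Or.inr (Or.inl ⟨rfl, by simp⟩)),
          (hA _ _).2 (Or.inr (Or.inr ⟨rfl, by simp⟩))⟩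
      · exact ⟨x, hxV, hxc, (hA _ _).2 (Or.inr (Or.inl ⟨rfl, by simp⟩)),
          (hA _ _).2 (Or.inr (Or.inr ⟨rfl, by simp⟩))⟩
    have hne : (K ∩ {p | p ∈ V}).Nonempty := by
      obtain ⟨k, hk⟩ := hKne
      rcases (hV k).1 (hKV k hk) with rfl | hkV
      · exact ⟨w, hK k hk w hzw hwc, hwV⟩
      · exact ⟨k, hk, hkV⟩
    have hall := ih c (K ∩ {p | p ∈ V}) (fun p hp => hp.2) (fun hp => hc hp.1) hne
      (fun p hp q hpq hqc => ⟨hK p hp.1 q ((hA p q).2 (Or.inl hpq)) hqc, (hs.adj_mem p q hpq).2⟩)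
    intro p hp hpc
    rcases (hV p).1 hp with rfl | hpV
    · exact hK w (hall w hwV hwc).1 p hwz hpc
    · exact (hall p hpV hpc).1

lemma Shell.biconnected {H : PlaneGraph} {P : List (ℝ × ℝ)} (h : Shell H.verts H.Adj P)
    (h3 : 3 ≤ H.verts.card) : H.Biconnected := by
  refine ⟨h3, ⟨Finset.card_pos.1 (by omega), ?_⟩, ?_⟩
  · intro p hp q hq
    obtain ⟨c, hc⟩ := Infinite.exists_notMem_finset H.verts
    refine (h.connected_delete c {x | x ∈ H.verts ∧ H.Reachable p x} (fun x hx => hx.1)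
      (fun hx => hc hx.1) ⟨p, hp, Relation.ReflTransGen.refl⟩ ?_ q hq ?_).2
    · intro x hx y hxy _
      exact ⟨(H.mem_of_adj x y hxy).2, hx.2.tail hxy⟩
    · rintro rfl
      exact hc hq
  · intro v hv
    have hmem : ∀ x, x ∈ (H.deleteVerts {v}).verts ↔ x ∈ H.verts ∧ x ≠ v := by
      intro x
      simp [PlaneGraph.deleteVerts]
    constructor
    · obtain ⟨x, hx, hxv⟩ := Finset.exists_mem_ne (by omega : 1 < H.verts.card) v
      exact ⟨x, (hmem x).2 ⟨hx, hxv⟩⟩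
    · intro p hp q hq
      rw [hmem] at hp hq
      refine (h.connected_delete v {x | x ∈ H.verts ∧ x ≠ v ∧ (H.deleteVerts {v}).Reachable p x}
        (fun x hx => hx.1) (fun hx => hx.2.1 rfl) ⟨p, hp.1, hp.2, Relation.ReflTransGen.refl⟩ ?_
        q hq.1 hq.2).2.2
      intro x hx y hxy hyv
      refine ⟨(H.mem_of_adj x y hxy).2, hyv, hx.2.2.tail ⟨hxy, ?_, ?_⟩⟩
      · simpa using hx.2.1
      · simpa using hyv

lemma not_isBounded_of_ray {S : Set (ℝ × ℝ)} {x d : ℝ × ℝ} (hd : d ≠ 0)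
    (h : ∀ t : ℝ, 0 ≤ t → x + t • d ∈ S) : ¬ Bornology.IsBounded S := by
  intro hb
  obtain ⟨C, hC⟩ := hb.exists_norm_le
  have hd' : 0 < ‖d‖ := norm_pos_iff.2 hd
  have hC0 : 0 ≤ C := (norm_nonneg _).trans (hC _ (h 0 le_rfl))
  set t := (C + ‖x‖ + 1) / ‖d‖ with ht
  have ht0 : 0 ≤ t := by positivity
  have h1 := hC _ (h t ht0)
  have h2 : ‖t • d‖ ≤ ‖x + t • d‖ + ‖x‖ := by
    calc ‖t • d‖ = ‖(x + t • d) - x‖ := by rw [add_sub_cancel_left]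
      _ ≤ _ := norm_sub_le _ _
  rw [norm_smul, Real.norm_of_nonneg ht0, ht, div_mul_cancel₀ _ hd'.ne'] at h2
  linarith

lemma not_isBounded_component_of_ray {D : Set (ℝ × ℝ)} {x d : ℝ × ℝ} (hd : d ≠ 0)
    (h : ∀ t : ℝ, 0 ≤ t → x + t • d ∉ D) :
    ¬ Bornology.IsBounded (connectedComponentIn Dᶜ x) := by
  refine not_isBounded_of_ray (x := x) hd fun t ht => ?_
  have hpre : IsPreconnected ((fun s : ℝ => x + s • d) '' Set.Ici 0) :=
    isPreconnected_Ici.image _ (by fun_prop)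
  refine hpre.subset_connectedComponentIn ⟨0, by simp, by simp⟩ ?_ ⟨t, ht, rfl⟩
  rintro _ ⟨s, hs, rfl⟩
  exact h s hs

namespace PlaneGraph

variable {H : PlaneGraph}

lemma IsEmptyTriangle.component_eq {a b c x : ℝ × ℝ} (h : H.IsEmptyTriangle a b c)
    (hx : x ∈ openTriangle a b c) : connectedComponentIn H.drawingᶜ x = openTriangle a b c := by
  obtain ⟨hab, hbc, hca, ho, hd⟩ := h
  apply Set.Subset.antisymm
  · have hxd : x ∈ H.drawingᶜ := Set.disjoint_left.1 hd hx
    have hcl : IsClosed {p | 0 ≤ orient a b p ∧ 0 ≤ orient b c p ∧ 0 ≤ orient c a p} :=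
      (isClosed_le continuous_const (continuous_orient a b)).inter
        ((isClosed_le continuous_const (continuous_orient b c)).inter
          (isClosed_le continuous_const (continuous_orient c a)))
    refine IsPreconnected.subset_left_of_subset_union (isOpen_openTriangle a b c) hcl.isOpen_compl
      ?_ ?_ ⟨x, mem_connectedComponentIn hxd, hx⟩ isPreconnected_connectedComponentIn
    · rw [Set.disjoint_left]
      intro p hp hp'
      rw [openTriangle_eq ho] at hp
      exact hp' ⟨hp.1.le, hp.2.1.le, hp.2.2.le⟩
    · intro p hp
      have hpd := connectedComponentIn_subset _ _ hp
      by_contra hcon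
      rw [Set.mem_union, not_or, Set.notMem_compl_iff, openTriangle_eq ho] at hcon
      obtain ⟨h1, h2, h3, h4⟩ := hcon
      have o1 : 0 < orient b c a := by rwa [orient_rotate]
      have o2 : 0 < orient c a b := by rwa [orient_rotate]
      rcases h2.eq_or_lt with h5 | h5
      · exact hpd ⟨a, b, hab, mem_segment_of_orient_eq_zero ho h5.symm h3 h4⟩
      rcases h3.eq_or_lt with h6 | h6
      · exact hpd ⟨b, c, hbc, mem_segment_of_orient_eq_zero o1 h6.symm h4 h2⟩
      rcases h4.eq_or_lt with h7 | h7
      · exact hpd ⟨c, a, hca, mem_segment_of_orient_eq_zero o2 h7.symm h2 h3⟩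
      exact h1 ⟨h5, h6, h7⟩
  · exact (convex_openTriangle a b c).isPreconnected.subset_connectedComponentIn hx
      (fun p hp => Set.disjoint_left.1 hd hp)

end PlaneGraph

lemma Terrain.innerFacesTriangles {H : PlaneGraph} {P : List (ℝ × ℝ)} {g : ℝ → ℝ} {M : ℝ}
    (h : Terrain H P g M) : H.InnerFacesTriangles := by
  rintro F ⟨x, hx, rfl⟩ hb
  have key : ∀ d : ℝ × ℝ, d ≠ 0 → ¬ ∀ t : ℝ, 0 ≤ t → x + t • d ∉ H.drawing := fun d hd hray =>
    not_isBounded_component_of_ray hd hray hb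
  rcases h.cover x hx with h1 | h1 | h1 | h1 | ⟨a, b, c, habc, hmem, -⟩
  · refine absurd (fun t ht hd => ?_) (key (0, -1) (by simp))
    have := (h.below _ hd).2.2.1
    simp at this
    linarith
  · refine absurd (fun t ht hd => ?_) (key (-1, 0) (by simp))
    have := (h.below _ hd).1
    simp at this
    linarith
  · refine absurd (fun t ht hd => ?_) (key (1, 0) (by simp))
    have := (h.below _ hd).2.1
    simp at this
    linarith
  · refine absurd (fun t ht hd => ?_) (key (0, 1) (by simp))
    have := (h.below _ hd).2.2.2
    simp at this
    linarith
  · have ⟨h2, h3, h4, _, _⟩ := habc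
    exact ⟨a, (H.mem_of_adj _ _ h2).1, b, (H.mem_of_adj _ _ h2).2, c, (H.mem_of_adj _ _ h3).2,
      h2, h3, H.symm _ _ h4, habc.component_eq hmem⟩

/-- The graph consisting of the edge from `(0, 0)` to `(1, 0)`. -/
def unitEdge : PlaneGraph where
  verts := {((0 : ℝ), (0 : ℝ)), ((1 : ℝ), (0 : ℝ))}
  Adj p q := (p = (0, 0) ∧ q = (1, 0)) ∨ (p = (1, 0) ∧ q = (0, 0))
  symm p q h := by tauto
  loopless p h := by
    rcases h with ⟨rfl, h⟩ | ⟨rfl, h⟩ <;> simp at h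
  mem_of_adj p q h := by
    rcases h with ⟨rfl, rfl⟩ | ⟨rfl, rfl⟩ <;> simp

lemma unitEdge_segment {p q x : ℝ × ℝ} (h : unitEdge.Adj p q) (hx : x ∈ segment ℝ p q) :
    0 ≤ x.1 ∧ x.1 ≤ 1 ∧ x.2 = 0 := by
  have : x ∈ segment ℝ ((0 : ℝ), (0 : ℝ)) (1, 0) := by
    rcases h with ⟨rfl, rfl⟩ | ⟨rfl, rfl⟩
    · exact hx
    · rwa [segment_symm]
  obtain ⟨s, t, hs, ht, hst, rfl⟩ := this
  refine ⟨?_, ?_, ?_⟩ <;> simp <;> linarith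

lemma terrain_unitEdge : Terrain unitEdge [(0, 0), (1, 0)] (fun _ => 0) 0 where
  embedded := by
    constructor
    · intro p q r s hpq hrs x _ _
      left
      rcases hpq with ⟨rfl, rfl⟩ | ⟨rfl, rfl⟩ <;> rcases hrs with ⟨rfl, rfl⟩ | ⟨rfl, rfl⟩
      exacts [rfl, Set.pair_comm _ _, Set.pair_comm _ _, rfl]
    · intro p q v hpq hv _
      simp only [unitEdge, Finset.mem_insert, Finset.mem_singleton] at hv
      rcases hpq with ⟨rfl, rfl⟩ | ⟨rfl, rfl⟩
      exacts [hv, hv.symm]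
  lipschitz s t := by simp
  increasing := by simp
  adj p q h := by
    rw [Consec.cons_cons_iff] at h
    exact Or.inl (h.resolve_right Consec.not_singleton)
  subset q hq := by simpa [unitEdge] using hq
  on_graph q hq := by
    simp at hq
    rcases hq with rfl | rfl <;> rfl
  segment_on_graph p q h e he := by
    rw [Consec.cons_cons_iff] at h
    exact (unitEdge_segment (Or.inl (h.resolve_right Consec.not_singleton)) he).2.2
  verts_subset v hv := by
    simp only [unitEdge, Finset.mem_insert, Finset.mem_singleton] at hv
    refine ⟨(0, 0), (1, 0), Or.inl ⟨rfl, rfl⟩, ?_⟩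
    rcases hv with rfl | rfl
    exacts [left_mem_segment ℝ _ _, right_mem_segment ℝ _ _]
  below := by
    rintro p ⟨a, b, hab, hp⟩
    obtain ⟨h1, h2, h3⟩ := unitEdge_segment hab hp
    exact ⟨h1, h2, h3.ge, h3.le⟩
  cover p hp := by
    by_contra hcon
    push Not at hcon
    obtain ⟨h1, h2, h3, h4, -⟩ := hcon
    refine hp ⟨(0, 0), (1, 0), Or.inl ⟨rfl, rfl⟩, 1 - p.1, p.1, by linarith, h2, by ring, ?_⟩
    ext
    · simp
    · simp
      linarith

lemma Shell.exists_terrain {α : Type*} {V : Finset α} {A : α → α → Prop} {P : List α}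
    (h : Shell V A P) : ∃ (H : PlaneGraph) (f : α → ℝ × ℝ) (g : ℝ → ℝ) (M : ℝ),
      Terrain H (P.map f) g M ∧ Shell H.verts H.Adj (P.map f) ∧ Set.BijOn f V H.verts ∧
        ∀ p ∈ V, ∀ q ∈ V, (A p q ↔ H.Adj (f p) (f q)) := by
  induction h with
  | @base V A a b hab hV hA =>
    have hba := hab.symm
    have h01 : ((0 : ℝ), (0 : ℝ)) ≠ (1, 0) := by simp
    refine ⟨unitEdge, fun x => if x = a then (0, 0) else (1, 0), fun _ => 0, 0, ?_, ?_,
      ⟨?_, ?_, ?_⟩, ?_⟩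
    · simpa [hba] using terrain_unitEdge
    · simp only [List.map_cons, if_true, hba, if_false, List.map_nil]
      exact .base h01 (fun x => by simp [unitEdge]) (fun x y => Iff.rfl)
    · intro x hx
      simp only [unitEdge, Finset.coe_insert, Finset.coe_singleton]
      split_ifs <;> simp
    · intro x hx y hy hxy
      have h1 := (hV x).1 hx
      have h2 := (hV y).1 hy
      grind
    · intro x hx
      simp only [unitEdge, Finset.coe_insert, Finset.coe_singleton] at hx
      rcases hx with rfl | rfl
      · exact ⟨a, (hV a).2 (Or.inl rfl), by simp⟩
      · exact ⟨b, (hV b).2 (Or.inr rfl), by simp [hba]⟩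
    · intro p hp q hq
      rw [hA]
      simp only [unitEdge]
      have h1 := (hV p).1 hp
      have h2 := (hV q).1 hq
      rcases h1 with rfl | rfl <;> rcases h2 with rfl | rfl <;> simp [hab, hba]
  | @step V V' A A' P P' l m r x y z hs hP hz hV hA hP' ih =>
    obtain ⟨H, f, g, M, hT, hS, ⟨hmap, hinj, hsurj⟩, hadj⟩ := ih
    have hPf : P.map f = l.map f ++ f x :: (m.map f ++ f y :: r.map f) := by simp [hP]
    obtain ⟨Z, hZ, hN, g', M', hT'⟩ := hT.exists_addVertex hPf
    set F := Function.update f z Z with hF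
    have hFz : F z = Z := by simp [hF]
    have hFV : ∀ p ∈ V, F p = f p := by
      intro p hp
      refine Function.update_of_ne ?_ _ _
      rintro rfl
      exact hz hp
    have hsub := hs.subset
    have hmapF : P'.map F = l.map f ++ f x :: Z :: f y :: r.map f := by
      have : ∀ k : List α, (∀ q ∈ k, q ∈ P) → k.map F = k.map f := fun k hk =>
        List.map_congr_left fun q hq => hFV q (hsub q (hk q hq))
      rw [hP', List.map_append, List.map_cons, List.map_cons, List.map_cons, hFz,
        this l (by simp +contextual [hP]), this r (by simp +contextual [hP]),
        hFV x (hsub x (by simp [hP])), hFV y (hsub y (by simp [hP]))]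
    have hNmap : f x :: (m.map f ++ [f y]) = (x :: (m ++ [y])).map f := by simp
    have hNV : ∀ q ∈ x :: (m ++ [y]), q ∈ V := by
      intro q hq
      refine hsub q ?_
      rw [hP]
      simp only [List.mem_append, List.mem_cons, List.not_mem_nil, or_false] at hq ⊢
      tauto
    have hmemN : ∀ q ∈ V, (f q ∈ f x :: (m.map f ++ [f y]) ↔ q ∈ x :: (m ++ [y])) := by
      intro q hq
      rw [hNmap, List.mem_map]
      constructor
      · rintro ⟨q', hq', e⟩
        exact hinj (hNV q' hq') hq e ▸ hq'
      · exact fun h => ⟨q, h, rfl⟩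
    have hfZ : ∀ q ∈ V, f q ≠ Z := fun q hq h => hZ (h ▸ hmap hq)
    have hzA : ∀ q, ¬ A z q ∧ ¬ A q z := fun q =>
      ⟨fun h => hz (hs.adj_mem _ _ h).1, fun h => hz (hs.adj_mem _ _ h).2⟩
    have hZA : ∀ q, ¬ H.Adj Z q ∧ ¬ H.Adj q Z := fun q =>
      ⟨fun h => hZ (H.mem_of_adj _ _ h).1, fun h => hZ (H.mem_of_adj _ _ h).2⟩
    have hzN : z ∉ x :: (m ++ [y]) := fun h => hz (hNV z h)
    have hZN : Z ∉ f x :: (m.map f ++ [f y]) := fun h => hZ (hN Z h)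
    refine ⟨_, F, g', M', hmapF ▸ hT', ?_, ⟨?_, ?_, ?_⟩, ?_⟩
    · rw [hmapF]
      exact hS.step hPf hZ (fun p => Finset.mem_insert) (fun p q => Iff.rfl) rfl
    · intro p hp
      rcases (hV p).1 hp with rfl | hpV
      · rw [hFz]
        exact Finset.mem_insert_self _ _
      · rw [hFV p hpV]
        exact Finset.mem_insert_of_mem (hmap hpV)
    · intro p hp q hq hpq
      rcases (hV p).1 hp with rfl | hpV <;> rcases (hV q).1 hq with rfl | hqV
      · rfl
      · rw [hFz, hFV q hqV] at hpq
        exact absurd hpq.symm (hfZ q hqV)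
      · rw [hFz, hFV p hpV] at hpq
        exact absurd hpq (hfZ p hpV)
      · rw [hFV p hpV, hFV q hqV] at hpq
        exact hinj hpV hqV hpq
    · intro w hw
      rcases Finset.mem_insert.1 hw with rfl | hw
      · exact ⟨z, (hV z).2 (Or.inl rfl), hFz⟩
      · obtain ⟨p, hp, rfl⟩ := hsurj hw
        exact ⟨p, (hV p).2 (Or.inr hp), hFV p hp⟩
    · intro p hp q hq
      rw [hA]
      change _ ↔ H.Adj (F p) (F q) ∨ (F p = Z ∧ F q ∈ _) ∨ (F q = Z ∧ F p ∈ _)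
      rcases (hV p).1 hp with rfl | hpV <;> rcases (hV q).1 hq with rfl | hqV
      · rw [hFz]
        simp only [hzA, hZA, hzN, hZN, and_false, or_false]
      · have hqp : q ≠ p := fun h => hz (h ▸ hqV)
        rw [hFz, hFV q hqV, hmemN q hqV]
        simp only [hzA, hZA, hqp, hfZ q hqV, false_and, or_false]
      · have hpq : p ≠ q := fun h => hz (h ▸ hpV)
        rw [hFz, hFV p hpV, hmemN p hpV]
        simp only [hzA, hZA, hpq, hfZ p hpV, false_and, false_or]
      · have hpz : p ≠ z := fun h => hz (h ▸ hpV)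
        have hqz : q ≠ z := fun h => hz (h ▸ hqV)
        rw [hFV p hpV, hFV q hqV]
        simp only [hadj p hpV q hqV, hpz, hqz, hfZ p hpV, hfZ q hqV, false_and, or_false]

lemma Shell.exists_nearTriangulation {α : Type*} {V : Finset α} {A : α → α → Prop} {P : List α}
    (h : Shell V A P) (h3 : 3 ≤ V.card) : ∃ (H : PlaneGraph) (f : α → ℝ × ℝ),
      H.IsNearTriangulation ∧ Set.BijOn f V H.verts ∧
        ∀ p ∈ V, ∀ q ∈ V, (A p q ↔ H.Adj (f p) (f q)) := by
  obtain ⟨H, f, g, M, hT, hS, hf, hadj⟩ := h.exists_terrain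
  refine ⟨H, f, ⟨hT.embedded, hS.biconnected ?_, hT.innerFacesTriangles⟩, hf, hadj⟩
  rwa [← Set.ncard_coe_finset, ← hf.image_eq, hf.injOn.ncard_image,
    Set.ncard_coe_finset]

lemma TriangulatedDisk.exists_shell_contract {α : Type*} (D : TriangulatedDisk α) {v w b : α}
    (hbv : D.Outer b v) (hw : D.Outer v w ∨ D.Outer w v) (hwb : w ≠ b)
    (hall : ∀ q, D.Adj v q → ∃ q', D.Outer q q' ∨ D.Outer q' q) (V₂ : Finset α)
    (A₂ : α → α → Prop) (hV₂ : ∀ p, p ∈ V₂ ↔ p ≠ w ∧ p ∈ D.verts)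
    (hA₂ : ∀ p q, A₂ p q ↔
      p ≠ q ∧ p ∈ V₂ ∧ q ∈ V₂ ∧ (D.Adj p q ∨ (p = v ∧ D.Adj w q) ∨ (q = v ∧ D.Adj w p))) :
    ∃ P, Shell V₂ A₂ P := by
  obtain ⟨P, hP, hhead, hlast, hout⟩ := D.exists_shell _ rfl hbv
  obtain ⟨P, rfl⟩ : ∃ P', P = v :: P' := by
    match P, hhead with
    | _ :: P', h => exact ⟨P', by simpa using h⟩
  have hvP : v ∉ P := (List.nodup_cons.1 hP.nodup).1
  have hbP : b ∈ v :: P := List.mem_of_getLast? hlast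
  have hcons : Consec (v :: P) v w := by
    rcases hw with hw | hw
    · refine ((hout v w).1 hw).resolve_right ?_
      rintro ⟨rfl, rfl⟩
      exact D.adj_irrefl _ hw.1
    · rcases (hout w v).1 hw with h | ⟨h, -⟩
      · exact absurd h.mem_of_cons hvP
      · exact absurd h hwb
  obtain ⟨l, r, hl⟩ := hcons
  obtain ⟨rfl⟩ : l = [] := by
    match l with
    | [] => rfl
    | x :: l =>
      simp only [List.cons_append, List.cons.injEq] at hl
      rw [hl.2] at hvP
      simp at hvP
  rw [List.nil_append] at hl
  refine ⟨v :: r, hP.contract v w r hl ?_ ?_ V₂ A₂ hV₂ hA₂⟩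
  · rintro rfl
    rw [hl] at hlast
    exact hwb (by simpa using hlast)
  · intro q hq
    obtain ⟨q', h | h⟩ := hall q hq
    · rcases (hout q q').1 h with h | ⟨rfl, -⟩
      exacts [h.mem_left, hbP]
    · rcases (hout q' q).1 h with h | ⟨-, rfl⟩
      exacts [h.mem_right, List.mem_cons_self]

lemma PlaneGraph.isContractible_of_outer {T : PlaneGraph} (D : TriangulatedDisk (ℝ × ℝ))
    (hV : D.verts = T.verts) (hA : D.Adj = T.Adj) (hn : 4 ≤ T.verts.card) {v w b : ℝ × ℝ}
    (hw : D.Outer v w ∨ D.Outer w v) (hb : D.Outer v b ∨ D.Outer b v) (hwb : w ≠ b)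
    (hall : ∀ q, T.Adj v q → ∃ q', D.Outer q q' ∨ D.Outer q' q) : T.IsContractible v w := by
  have hvw : T.Adj v w := by
    rw [← hA]
    exact hw.elim (fun h => h.1) (fun h => D.adj_symm h.1)
  have hmirror : ∀ x y, D.Outer x y → D.mirror.Outer y x := fun x y h => ⟨D.adj_symm h.1, h.2⟩
  obtain ⟨P, hP⟩ : ∃ P, Shell (T.contractEdge v w).verts (T.contractEdge v w).Adj P := by
    have hV₂ : ∀ p, p ∈ (T.contractEdge v w).verts ↔ p ≠ w ∧ p ∈ T.verts :=
      fun p => Finset.mem_erase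
    have hA₂ : ∀ p q, (T.contractEdge v w).Adj p q ↔ p ≠ q ∧ p ∈ (T.contractEdge v w).verts ∧
        q ∈ (T.contractEdge v w).verts ∧
          (T.Adj p q ∨ (p = v ∧ T.Adj w q) ∨ (q = v ∧ T.Adj w p)) := fun p q => Iff.rfl
    rw [← hA] at hA₂ hall
    rw [← hV] at hV₂
    rcases hb with hb | hb
    · refine D.mirror.exists_shell_contract (hmirror _ _ hb)
        (hw.symm.imp (hmirror _ _) (hmirror _ _)) hwb (fun q hq => ?_) _ _ hV₂ hA₂
      obtain ⟨q', h⟩ := hall q hq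
      exact ⟨q', h.symm.imp (hmirror _ _) (hmirror _ _)⟩
    · exact D.exists_shell_contract hb hw hwb hall _ _ hV₂ hA₂
  have hcard : 3 ≤ (T.contractEdge v w).verts.card := by
    change 3 ≤ (T.verts.erase w).card
    rw [Finset.card_erase_of_mem (T.mem_of_adj _ _ hvw).2]
    omega
  obtain ⟨H, f, hH, hf⟩ := hP.exists_nearTriangulation hcard
  exact ⟨hvw, H, hH, f, hf⟩

lemma PlaneGraph.IsContractible.symm {T : PlaneGraph} {v w : ℝ × ℝ} (h : T.IsContractible v w) :
    T.IsContractible w v := by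
  obtain ⟨hvw, H, hH, f, ⟨hmap, hinj, hsurj⟩, hadj⟩ := h
  have hne : v ≠ w := by
    rintro rfl
    exact T.loopless _ hvw
  set σ := Equiv.swap v w
  have hv := (T.mem_of_adj _ _ hvw).1
  have hw := (T.mem_of_adj _ _ hvw).2
  have hverts : ∀ p, p ∈ (T.contractEdge w v).verts ↔ p ≠ v ∧ p ∈ T.verts :=
    fun p => Finset.mem_erase
  have hverts' : ∀ p, p ∈ (T.contractEdge v w).verts ↔ p ≠ w ∧ p ∈ T.verts :=
    fun p => Finset.mem_erase
  have hσ : ∀ p, p ∈ (T.contractEdge w v).verts → σ p = if p = w then v else p := by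
    intro p hp
    split_ifs with h
    · rw [h]
      exact Equiv.swap_apply_right v w
    · exact Equiv.swap_apply_of_ne_of_ne ((hverts p).1 hp).1 h
  have hσmem : ∀ p, p ∈ (T.contractEdge w v).verts → σ p ∈ (T.contractEdge v w).verts := by
    intro p hp
    rw [hσ p hp, hverts']
    split_ifs with h
    · exact ⟨hne, hv⟩
    · exact ⟨h, ((hverts p).1 hp).2⟩
  refine ⟨T.symm _ _ hvw, H, hH, f ∘ σ, ⟨fun p hp => hmap (hσmem p hp), ?_, ?_⟩, ?_⟩
  · intro p hp q hq hpq
    exact σ.injective (hinj (hσmem p hp) (hσmem q hq) hpq)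
  · intro x hx
    obtain ⟨p, hp, rfl⟩ := hsurj hx
    refine ⟨σ p, ?_, by simp [σ]⟩
    have hp' := (hverts' p).1 hp
    rw [Finset.mem_coe, hverts]
    by_cases h : p = v
    · rw [h, Equiv.swap_apply_left]
      exact ⟨hne.symm, hw⟩
    · rw [Equiv.swap_apply_of_ne_of_ne h hp'.1]
      exact ⟨h, hp'.2⟩
  · intro p hp q hq
    rw [Function.comp_apply, Function.comp_apply,
      ← hadj _ (hσmem p hp) _ (hσmem q hq), hσ p hp, hσ q hq]
    change (p ≠ q ∧ p ∈ (T.contractEdge w v).verts ∧ q ∈ (T.contractEdge w v).verts ∧ _) ↔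
      (_ ∧ _ ∈ (T.contractEdge v w).verts ∧ _ ∈ (T.contractEdge v w).verts ∧ _)
    have hloop := T.loopless
    have hsymm := T.symm
    simp only [hverts, hverts'] at hp hq ⊢
    by_cases h1 : p = w <;> by_cases h2 : q = w
    · simp [h1, h2]
    · simp only [h1, h2, if_true, if_false]
      grind
    · simp only [h1, h2, if_true, if_false]
      grind
    · simp only [h1, h2, if_false]
      grind

/-- A linear height function on the plane. -/
def height (s : ℝ) (p : ℝ × ℝ) : ℝ := p.1 + s * p.2

lemma continuous_height (s : ℝ) : Continuous (height s) := by
  unfold height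
  fun_prop

lemma exists_injOn_height (V : Finset (ℝ × ℝ)) : ∃ s : ℝ, Set.InjOn (height s) V := by
  obtain ⟨s, hs⟩ := Infinite.exists_notMem_finset
    ((V ×ˢ V).image fun pq => (pq.2.1 - pq.1.1) / (pq.1.2 - pq.2.2))
  refine ⟨s, fun p hp q hq hpq => ?_⟩
  unfold height at hpq
  have h2 : p.2 = q.2 := by
    by_contra hne
    refine hs (Finset.mem_image.2 ⟨(p, q), Finset.mem_product.2 ⟨hp, hq⟩, ?_⟩)
    rw [div_eq_iff (sub_ne_zero.2 hne)]
    dsimp only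
    linarith
  refine Prod.ext ?_ h2
  rw [h2] at hpq
  linarith

lemma eq_add_smul_of_orient_eq_zero {s : ℝ} {x y p : ℝ × ℝ} (h : orient x y p = 0)
    (hxy : height s x ≠ height s y) :
    p = x + ((height s p - height s x) / (height s y - height s x)) • (y - x) := by
  have hne : height s y - height s x ≠ 0 := sub_ne_zero.2 hxy.symm
  unfold orient at h
  ext
  · simp only [Prod.fst_add, Prod.smul_fst, Prod.fst_sub, smul_eq_mul]
    field_simp
    unfold height
    linear_combination (-s) * h
  · simp only [Prod.snd_add, Prod.smul_snd, Prod.snd_sub, smul_eq_mul]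
    field_simp
    unfold height
    linear_combination h

/-- The indicator of the points on the lower side of the line `xy`. -/
def lowerSide (s : ℝ) (x y q : ℝ × ℝ) : ZMod 2 :=
  if orient x y q * (height s y - height s x) < 0 then 1 else 0

/-- The number of edges of the chain `ζ` above `q`, modulo 2. -/
def parity (s : ℝ) (V : Finset (ℝ × ℝ)) (ζ : ℝ × ℝ → ℝ × ℝ → ZMod 2) (q : ℝ × ℝ) : ZMod 2 :=
  ∑ x ∈ V, ∑ y ∈ V, ζ x y * (if height s x ≤ height s q then 1 else 0) * lowerSide s x y q

lemma lowerSide_comm (s : ℝ) (x y q : ℝ × ℝ) : lowerSide s x y q = lowerSide s y x q := by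
  unfold lowerSide
  rw [orient_swap y x q]
  congr 2
  ring

lemma sum_sum_eq_zero_of_symm {α : Type*} (V : Finset α) (F : α → α → ZMod 2)
    (hs : ∀ x y, F x y = F y x) (h0 : ∀ x, F x x = 0) : ∑ x ∈ V, ∑ y ∈ V, F x y = 0 := by
  rw [← Finset.sum_product']
  refine Finset.sum_involution (fun p _ => p.swap) ?_ ?_ ?_ ?_
  · intro p _
    rw [Prod.fst_swap, Prod.snd_swap, hs p.2 p.1]
    exact CharTwo.add_self_eq_zero _
  · rintro ⟨a, b⟩ _ h hab
    simp only [Prod.swap_prod_mk, Prod.mk.injEq] at hab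
    rw [hab.1] at h
    exact h (h0 _)
  · intro p hp
    rw [Finset.mem_product] at hp ⊢
    exact hp.symm
  · intro p _
    exact Prod.swap_swap p

lemma eventually_le_height_iff {s c : ℝ} {p : ℝ × ℝ} (h : c ≠ height s p) :
    ∀ᶠ q in nhds p, (c ≤ height s q ↔ c ≤ height s p) := by
  rcases lt_or_gt_of_ne h with h | h
  · filter_upwards [(continuous_height s).continuousAt.eventually_const_lt h] with q hq
    exact ⟨fun _ => h.le, fun _ => hq.le⟩
  · filter_upwards [(continuous_height s).continuousAt.eventually_lt_const h] with q hq
    exact ⟨fun h' => absurd h' hq.not_ge, fun h' => absurd h' (not_le.2 h)⟩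

lemma eventually_lowerSide_eq {s : ℝ} {x y p : ℝ × ℝ} (hxy : height s x ≠ height s y)
    (hp : p ∉ segment ℝ x y) : ∀ᶠ q in nhds p, lowerSide s x y q = lowerSide s x y p ∨
      (height s x ≤ height s q ↔ height s y ≤ height s q) := by
  have hne : height s y - height s x ≠ 0 := sub_ne_zero.2 hxy.symm
  have hc : Continuous fun q => orient x y q * (height s y - height s x) :=
    (continuous_orient x y).mul continuous_const
  rcases lt_trichotomy (orient x y p * (height s y - height s x)) 0 with h | h | h
  · filter_upwards [hc.continuousAt.eventually_lt_const h] with q hq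
    left
    simp only [lowerSide, if_pos h, if_pos hq]
  · have h0 := (mul_eq_zero.1 h).resolve_right hne
    have hpe := eq_add_smul_of_orient_eq_zero h0 hxy
    set t := (height s p - height s x) / (height s y - height s x) with ht
    have hht : height s p - height s x = t * (height s y - height s x) :=
      (div_mul_cancel₀ _ hne).symm
    have ht' : t < 0 ∨ 1 < t := by
      by_contra hcon
      push Not at hcon
      refine hp ⟨1 - t, t, by linarith, by linarith, by ring, ?_⟩
      conv_rhs => rw [hpe]
      rw [smul_sub, sub_smul, one_smul]
      abel
    have key : (height s x ≠ height s p ∧ height s y ≠ height s p) ∧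
        (height s x ≤ height s p ↔ height s y ≤ height s p) := by
      have e : height s p - height s y = (t - 1) * (height s y - height s x) := by linarith
      rcases lt_or_gt_of_ne hne with h1 | h1 <;> rcases ht' with h2 | h2
      · have h3 := mul_pos_of_neg_of_neg h2 h1
        have h4 := mul_pos_of_neg_of_neg (by linarith : t - 1 < 0) h1
        exact ⟨⟨by linarith, by linarith⟩, ⟨fun _ => by linarith, fun _ => by linarith⟩⟩
      · have h3 := mul_neg_of_pos_of_neg (by linarith : 0 < t) h1
        have h4 := mul_neg_of_pos_of_neg (by linarith : 0 < t - 1) h1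
        exact ⟨⟨by linarith, by linarith⟩, ⟨fun _ => by linarith, fun _ => by linarith⟩⟩
      · have h3 := mul_neg_of_neg_of_pos h2 h1
        have h4 := mul_neg_of_neg_of_pos (by linarith : t - 1 < 0) h1
        exact ⟨⟨by linarith, by linarith⟩, ⟨fun _ => by linarith, fun _ => by linarith⟩⟩
      · have h3 := mul_pos (by linarith : 0 < t) h1
        have h4 := mul_pos (by linarith : 0 < t - 1) h1
        exact ⟨⟨by linarith, by linarith⟩, ⟨fun _ => by linarith, fun _ => by linarith⟩⟩
    filter_upwards [eventually_le_height_iff key.1.1, eventually_le_height_iff key.1.2] with q h1 h2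
    exact Or.inr (h1.trans (key.2.trans h2.symm))
  · filter_upwards [hc.continuousAt.eventually_const_lt h] with q hq
    left
    simp only [lowerSide, if_neg h.not_gt, if_neg hq.not_gt]

lemma lowerSide_of_height_eq {s : ℝ} {x y p : ℝ × ℝ} (hxy : height s x ≠ height s y)
    (hp : height s x = height s p) : lowerSide s x y p = if p.2 < x.2 then 1 else 0 := by
  have hne : height s y - height s x ≠ 0 := sub_ne_zero.2 hxy.symm
  have h : orient x y p * (height s y - height s x) =
      (p.2 - x.2) * (height s y - height s x) ^ 2 := by
    have h1 : orient x y p = (p.2 - x.2) * (height s y - height s x) := by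
      unfold height at hp ⊢
      unfold orient
      linear_combination (y.2 - x.2) * hp
    rw [h1]
    ring
  have hiff : (p.2 - x.2) * (height s y - height s x) ^ 2 < 0 ↔ p.2 < x.2 := by
    have hsq : 0 < (height s y - height s x) ^ 2 := by positivity
    rw [← sub_neg (b := x.2)]
    exact ⟨fun h => neg_of_mul_neg_left h hsq.le, fun h => mul_neg_of_neg_of_pos h hsq⟩
  unfold lowerSide
  rw [h]
  simp only [hiff]

lemma eventually_parity_eq {s : ℝ} {V : Finset (ℝ × ℝ)} {ζ : ℝ × ℝ → ℝ × ℝ → ZMod 2} {p : ℝ × ℝ}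
    (hζ : ∀ x y, ζ x y = ζ y x) (hs : ∀ x y, ζ x y ≠ 0 → height s x ≠ height s y)
    (hp : ∀ x y, ζ x y ≠ 0 → p ∉ segment ℝ x y)
    (hrow : ∀ x ∈ V, height s x = height s p → ∑ y ∈ V, ζ x y = 0) :
    ∀ᶠ q in nhds p, parity s V ζ q = parity s V ζ p := by
  have h1 : ∀ᶠ q in nhds p, ∀ x ∈ V, height s x ≠ height s p →
      (height s x ≤ height s q ↔ height s x ≤ height s p) := by
    rw [Finset.eventually_all]
    intro x hx
    by_cases h : height s x = height s p
    · exact Filter.Eventually.of_forall fun q h' => absurd h h'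
    · filter_upwards [eventually_le_height_iff h] with q hq _
      exact hq
  have h2 : ∀ᶠ q in nhds p, ∀ x ∈ V, ∀ y ∈ V, ζ x y ≠ 0 → lowerSide s x y q = lowerSide s x y p ∨
      (height s x ≤ height s q ↔ height s y ≤ height s q) := by
    rw [Finset.eventually_all]
    intro x hx
    rw [Finset.eventually_all]
    intro y hy
    by_cases h : ζ x y = 0
    · exact Filter.Eventually.of_forall fun q h' => absurd h h'
    · filter_upwards [eventually_lowerSide_eq (hs x y h) (hp x y h)] with q hq _
      exact hq
  filter_upwards [h1, h2] with q h1 h2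
  have e1 : ∑ x ∈ V, ∑ y ∈ V, ζ x y * (if height s x ≤ height s q then 1 else 0) *
      (lowerSide s x y q - lowerSide s x y p) = 0 := by
    rw [← Finset.sum_coe_sort V]
    simp_rw [← Finset.sum_coe_sort V]
    refine sum_sum_eq_zero_of_symm Finset.univ (fun x y : V => ζ x y *
      (if height s x ≤ height s q then 1 else 0) * (lowerSide s x y q - lowerSide s x y p)) ?_ ?_
    · intro x y
      rw [hζ x y, lowerSide_comm s x y q, lowerSide_comm s x y p]
      by_cases h0 : ζ y x = 0
      · rw [h0, zero_mul, zero_mul, zero_mul, zero_mul]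
      · rcases h2 y y.2 x x.2 h0 with h3 | h3
        · rw [h3, sub_self, mul_zero, mul_zero]
        · simp only [h3]
    · intro x
      have : ζ x x = 0 := by
        by_contra h
        exact hs x x h rfl
      rw [this, zero_mul, zero_mul]
  have e2 : ∑ x ∈ V, ∑ y ∈ V, ζ x y * ((if height s x ≤ height s q then 1 else 0) -
      (if height s x ≤ height s p then 1 else 0)) * lowerSide s x y p = 0 := by
    refine Finset.sum_eq_zero fun x hx => ?_
    by_cases hxp : height s x = height s p
    · have : ∀ y, ζ x y * ((if height s x ≤ height s q then 1 else 0) -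
          (if height s x ≤ height s p then 1 else 0)) * lowerSide s x y p =
          ζ x y * (((if height s x ≤ height s q then 1 else 0) -
          (if height s x ≤ height s p then 1 else 0)) * (if p.2 < x.2 then 1 else 0)) := by
        intro y
        by_cases h0 : ζ x y = 0
        · rw [h0, zero_mul, zero_mul, zero_mul]
        · rw [lowerSide_of_height_eq (hs x y h0) hxp, mul_assoc]
      rw [Finset.sum_congr rfl fun y _ => this y, ← Finset.sum_mul, hrow x hx hxp, zero_mul]
    · refine Finset.sum_eq_zero fun y _ => ?_
      simp only [h1 x hx hxp, sub_self, mul_zero, zero_mul]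
  have e3 : parity s V ζ q - parity s V ζ p =
      (∑ x ∈ V, ∑ y ∈ V, ζ x y * (if height s x ≤ height s q then 1 else 0) *
        (lowerSide s x y q - lowerSide s x y p)) +
      ∑ x ∈ V, ∑ y ∈ V, ζ x y * ((if height s x ≤ height s q then 1 else 0) -
        (if height s x ≤ height s p then 1 else 0)) * lowerSide s x y p := by
    unfold parity
    simp only [← Finset.sum_sub_distrib, ← Finset.sum_add_distrib]
    refine Finset.sum_congr rfl fun x _ => Finset.sum_congr rfl fun y _ => ?_
    ring
  rw [e1, e2, add_zero] at e3
  exact sub_eq_zero.1 e3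

lemma parity_eq_zero {s : ℝ} {V : Finset (ℝ × ℝ)} {ζ : ℝ × ℝ → ℝ × ℝ → ZMod 2} {q : ℝ × ℝ}
    (h : ∀ x ∈ V, height s q < height s x) : parity s V ζ q = 0 := by
  refine Finset.sum_eq_zero fun x hx => Finset.sum_eq_zero fun y _ => ?_
  rw [if_neg (h x hx).not_ge, mul_zero, zero_mul]

lemma parity_add (s : ℝ) (V : Finset (ℝ × ℝ)) (ζ η : ℝ × ℝ → ℝ × ℝ → ZMod 2) (q : ℝ × ℝ) :
    parity s V (fun x y => ζ x y + η x y) q = parity s V ζ q + parity s V η q := by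
  unfold parity
  simp only [← Finset.sum_add_distrib, add_mul]

lemma parity_edge {s : ℝ} {V : Finset (ℝ × ℝ)} {c : ZMod 2} {a b q : ℝ × ℝ} (ha : a ∈ V)
    (hb : b ∈ V) (hab : a ≠ b)
    (hq : ¬ (height s a ≤ height s q ↔ height s b ≤ height s q)) :
    parity s V (fun x y => c * TriangulatedDisk.edgeChain a b x y) q =
      c * lowerSide s a b q := by
  have h1 : ∀ x y, c * TriangulatedDisk.edgeChain a b x y =
      (if x = a then if y = b then c else 0 else 0) +
        (if x = b then if y = a then c else 0 else 0) := by
    intro x y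
    unfold TriangulatedDisk.edgeChain
    grind
  unfold parity
  simp only [h1, add_mul, ite_mul, zero_mul, Finset.sum_add_distrib, Finset.sum_ite_eq',
    ha, hb, if_true, Finset.sum_ite_irrel, Finset.sum_const_zero]
  rw [lowerSide_comm s b a]
  by_cases h2 : height s a ≤ height s q
  · rw [if_pos h2, if_neg (fun h => hq (iff_of_true h2 h))]
    ring
  · rw [if_neg h2, if_pos (by tauto)]
    ring

namespace PlaneGraph

variable {T : PlaneGraph}

lemma mem_drawing_left {p q : ℝ × ℝ} (h : T.Adj p q) : p ∈ T.drawing :=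
  ⟨p, q, h, left_mem_segment ℝ p q⟩

lemma ne_of_adj {p q : ℝ × ℝ} (h : T.Adj p q) : p ≠ q := by
  rintro rfl
  exact T.loopless _ h

lemma eq_of_midpoint_mem_segment (hE : T.IsEmbedded) {x y p q : ℝ × ℝ} (hxy : T.Adj x y)
    (hpq : T.Adj p q) (h : midpoint ℝ x y ∈ segment ℝ p q) :
    (x = p ∧ y = q) ∨ (x = q ∧ y = p) := by
  have hne := ne_of_adj hxy
  rcases hE.1 x y p q hxy hpq _ (midpoint_mem_segment x y) h with h1 | ⟨h1 | h1, -⟩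
  · rcases Set.pair_eq_pair_iff.1 h1 with h2 | h2
    exacts [Or.inl h2, Or.inr h2]
  · exact absurd ((midpoint_eq_left_iff (R := ℝ)).1 h1) hne
  · exact absurd ((midpoint_eq_right_iff (R := ℝ)).1 h1) hne

lemma eventually_mem_segment (hE : T.IsEmbedded) {x y : ℝ × ℝ} (hxy : T.Adj x y) :
    ∀ᶠ q in nhds (midpoint ℝ x y), q ∈ T.drawing → q ∈ segment ℝ x y := by
  have h : ∀ᶠ q in nhds (midpoint ℝ x y), ∀ a ∈ T.verts, ∀ b ∈ T.verts, T.Adj a b →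
      q ∈ segment ℝ a b → q ∈ segment ℝ x y := by
    rw [Finset.eventually_all]
    intro a _
    rw [Finset.eventually_all]
    intro b _
    by_cases hab : T.Adj a b
    · by_cases hm : midpoint ℝ x y ∈ segment ℝ a b
      · rcases eq_of_midpoint_mem_segment hE hxy hab hm with ⟨rfl, rfl⟩ | ⟨rfl, rfl⟩
        · exact Filter.Eventually.of_forall fun q _ hq => hq
        · exact Filter.Eventually.of_forall fun q _ hq => segment_symm ℝ y x ▸ hq
      · have hcl : IsClosed (segment ℝ a b) := by
          rw [← convexHull_pair]
          exact (Set.toFinite _).isClosed_convexHull ℝ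
        filter_upwards [hcl.isOpen_compl.mem_nhds hm] with q hq _ hq'
        exact absurd hq' hq
    · exact Filter.Eventually.of_forall fun q h' => absurd h' hab
  filter_upwards [h] with q hq
  rintro ⟨a, b, hab, hqab⟩
  exact hq a (T.mem_of_adj a b hab).1 b (T.mem_of_adj a b hab).2 hab hqab

end PlaneGraph

/-- The filter of points to the left of the segment `xy`, close to its midpoint. -/
def leftNhds (x y : ℝ × ℝ) : Filter (ℝ × ℝ) := nhdsWithin (midpoint ℝ x y) {q | 0 < orient x y q}

lemma orient_midpoint (a b x y : ℝ × ℝ) :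
    orient a b (midpoint ℝ x y) = (orient a b x + orient a b y) / 2 := by
  rw [midpoint_eq_smul_add, smul_add, invOf_eq_inv, orient_combo _ _ _ _ (by norm_num)]
  ring

lemma exists_orient_lt {U : Set (ℝ × ℝ)} (hU : IsOpen U) {p a b : ℝ × ℝ} (hp : p ∈ U)
    (hab : a ≠ b) : ∃ q ∈ U, orient a b p < orient a b q := by
  obtain ⟨t, ht, htU⟩ := exists_pos_add_smul_mem hU hp ((a.2 - b.2, b.1 - a.1) : ℝ × ℝ)
  refine ⟨_, htU, ?_⟩
  have h : orient a b (p + t • ((a.2 - b.2, b.1 - a.1) : ℝ × ℝ)) =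
      orient a b p + t * ((b.1 - a.1) ^ 2 + (b.2 - a.2) ^ 2) := by
    simp only [orient, Prod.fst_add, Prod.snd_add, Prod.smul_fst, Prod.smul_snd, smul_eq_mul]
    ring
  rw [h, lt_add_iff_pos_right]
  refine mul_pos ht ?_
  by_contra hcon
  have h2 : b.1 - a.1 = 0 := by nlinarith [sq_nonneg (b.1 - a.1), sq_nonneg (b.2 - a.2)]
  have h3 : b.2 - a.2 = 0 := by nlinarith [sq_nonneg (b.1 - a.1), sq_nonneg (b.2 - a.2)]
  exact hab (Prod.ext (sub_eq_zero.1 h2).symm (sub_eq_zero.1 h3).symm)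

lemma leftNhds_neBot {x y : ℝ × ℝ} (hxy : x ≠ y) : (leftNhds x y).NeBot := by
  refine mem_closure_iff_nhdsWithin_neBot.1 (mem_closure_iff.2 fun o ho hm => ?_)
  obtain ⟨q, hqo, hq⟩ := exists_orient_lt ho hm hxy
  refine ⟨q, hqo, ?_⟩
  rw [orient_midpoint, orient_self_left, orient_self_right, add_zero, zero_div] at hq
  exact hq

lemma eventually_leftNhds {x y : ℝ × ℝ} : ∀ᶠ q in leftNhds x y, 0 < orient x y q :=
  self_mem_nhdsWithin

lemma leftNhds_le (x y : ℝ × ℝ) : leftNhds x y ≤ nhds (midpoint ℝ x y) := nhdsWithin_le_nhds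

lemma leftNhds_swap_le (x y : ℝ × ℝ) : leftNhds y x ≤ nhds (midpoint ℝ x y) := by
  rw [midpoint_comm]
  exact leftNhds_le y x

lemma eventually_orient_pos_sides {x y z : ℝ × ℝ} (h : 0 < orient x y z) :
    ∀ᶠ q in nhds (midpoint ℝ x y), 0 < orient y z q ∧ 0 < orient z x q := by
  have h1 : 0 < orient y z (midpoint ℝ x y) := by
    rw [orient_midpoint, orient_self_left, orient_rotate]
    linarith
  have h2 : 0 < orient z x (midpoint ℝ x y) := by
    rw [orient_midpoint, orient_self_right, orient_rotate, orient_rotate]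
    linarith
  exact ((continuous_orient y z).continuousAt.eventually_const_lt h1).and
    ((continuous_orient z x).continuousAt.eventually_const_lt h2)

lemma eventually_mem_openTriangle {x y z : ℝ × ℝ} (h : 0 < orient x y z) :
    ∀ᶠ q in leftNhds x y, q ∈ PlaneGraph.openTriangle x y z := by
  filter_upwards [eventually_leftNhds, leftNhds_le x y (eventually_orient_pos_sides h)]
    with q h1 h2
  rw [openTriangle_eq h]
  exact ⟨h1, h2⟩

lemma closure_openTriangle {a b c : ℝ × ℝ} (h : 0 < orient a b c) :
    closure (PlaneGraph.openTriangle a b c) =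
      {p | 0 ≤ orient a b p ∧ 0 ≤ orient b c p ∧ 0 ≤ orient c a p} := by
  unfold PlaneGraph.openTriangle
  rw [(convex_convexHull ℝ _).closure_interior_eq_closure_of_nonempty_interior
    (openTriangle_nonempty h), ((Set.toFinite _).isClosed_convexHull ℝ).closure_eq,
    convexHull_triangle h]

namespace PlaneGraph

variable {T : PlaneGraph}

lemma exists_convex_mem_leftNhds (hE : T.IsEmbedded) {x y : ℝ × ℝ} (hxy : T.Adj x y) :
    ∃ U ∈ leftNhds x y, Convex ℝ U ∧ U ⊆ T.drawingᶜ ∧ ∀ q ∈ U, 0 < orient x y q := by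
  obtain ⟨ε, hε, h⟩ := Metric.eventually_nhds_iff_ball.1 (eventually_mem_segment hE hxy)
  refine ⟨Metric.ball (midpoint ℝ x y) ε ∩ {q | 0 < orient x y q},
    Filter.inter_mem (leftNhds_le x y (Metric.ball_mem_nhds _ hε)) eventually_leftNhds,
    (convex_ball _ _).inter (convex_orient_pos x y), ?_, fun q hq => hq.2⟩
  rintro q ⟨hq, hq'⟩ hqd
  obtain ⟨a, b, -, -, hab, rfl⟩ := h q hq hqd
  rw [Set.mem_ofPred_eq, orient_combo _ _ _ _ hab, orient_self_left, orient_self_right] at hq'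
  simp at hq'

lemma IsEmptyTriangle.rotate {a b c : ℝ × ℝ} (h : T.IsEmptyTriangle a b c) :
    T.IsEmptyTriangle b c a :=
  ⟨h.2.1, h.2.2.1, h.1, by rw [orient_rotate]; exact h.2.2.2.1,
    by rw [openTriangle_rotate]; exact h.2.2.2.2⟩

/-- A point of the drawing in the closure of an empty triangle lies on one of its sides. -/
lemma IsEmptyTriangle.mem_side {a b c p : ℝ × ℝ} (h : T.IsEmptyTriangle a b c)
    (hp : p ∈ closure (openTriangle a b c)) (hpd : p ∈ T.drawing) :
    p ∈ segment ℝ a b ∨ p ∈ segment ℝ b c ∨ p ∈ segment ℝ c a := by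
  have o1 := h.rotate.2.2.2.1
  have o2 := h.rotate.rotate.2.2.2.1
  obtain ⟨-, -, -, ho, hd⟩ := h
  rw [closure_openTriangle ho] at hp
  obtain ⟨h1, h2, h3⟩ := hp
  rcases h1.eq_or_lt with h5 | h5
  · exact Or.inl (mem_segment_of_orient_eq_zero ho h5.symm h2 h3)
  rcases h2.eq_or_lt with h6 | h6
  · exact Or.inr (Or.inl (mem_segment_of_orient_eq_zero o1 h6.symm h3 h1))
  rcases h3.eq_or_lt with h7 | h7
  · exact Or.inr (Or.inr (mem_segment_of_orient_eq_zero o2 h7.symm h1 h2))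
  refine absurd hpd (Set.disjoint_left.1 hd ?_)
  rw [openTriangle_eq ho]
  exact ⟨h5, h6, h7⟩

lemma IsEmptyTriangle.unique (hE : T.IsEmbedded) {x y z z' : ℝ × ℝ} (h : T.IsEmptyTriangle x y z)
    (h' : T.IsEmptyTriangle x y z') : z = z' := by
  have := leftNhds_neBot (ne_of_adj h.1)
  obtain ⟨q, hq, hq'⟩ := ((eventually_mem_openTriangle h.2.2.2.1).and
    (eventually_mem_openTriangle h'.2.2.2.1)).exists
  have heq : openTriangle x y z = openTriangle x y z' :=
    (h.component_eq hq).symm.trans (h'.component_eq hq')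
  have hz' : z' ∈ closure (openTriangle x y z) := by
    rw [heq, closure_openTriangle h'.2.2.2.1, Set.mem_ofPred_eq, orient_self_right,
      orient_self_left]
    exact ⟨h'.2.2.2.1.le, le_rfl, le_rfl⟩
  have hv := (T.mem_of_adj _ _ h'.2.1).2
  have hx : z' ≠ x := ne_of_adj h'.2.2.1
  have hy : z' ≠ y := (ne_of_adj h'.2.1).symm
  rcases h.mem_side hz' (mem_drawing_left h'.2.2.1) with h1 | h1 | h1
  · rcases hE.2 _ _ _ h.1 hv h1 with h2 | h2
    exacts [absurd h2 hx, absurd h2 hy]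
  · rcases hE.2 _ _ _ h.2.1 hv h1 with h2 | h2
    exacts [absurd h2 hy, h2.symm]
  · rcases hE.2 _ _ _ h.2.2.1 hv h1 with h2 | h2
    exacts [h2.symm, absurd h2 hx]

lemma exists_isEmptyTriangle_of_isFace (hF : T.InnerFacesTriangles) {q : ℝ × ℝ}
    (hq : q ∉ T.drawing) (hb : Bornology.IsBounded (connectedComponentIn T.drawingᶜ q)) :
    ∃ a b c, T.IsEmptyTriangle a b c ∧
      connectedComponentIn T.drawingᶜ q = openTriangle a b c := by
  obtain ⟨a, -, b, -, c, -, hab, hbc, hac, hF⟩ := hF _ ⟨q, hq, rfl⟩ hb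
  have hd : Disjoint (openTriangle a b c) T.drawing := by
    rw [← hF, Set.disjoint_left]
    exact fun p hp => connectedComponentIn_subset _ _ hp
  rcases lt_trichotomy 0 (orient a b c) with ho | ho | ho
  · exact ⟨a, b, c, ⟨hab, hbc, T.symm _ _ hac, ho, hd⟩, hF⟩
  · exfalso
    have hmem : q ∈ openTriangle a b c := hF ▸ mem_connectedComponentIn hq
    have hsub : convexHull ℝ ({a, b, c} : Set (ℝ × ℝ)) ⊆ {p | orient a b p = 0} := by
      refine convexHull_min ?_ ?_
      · rintro p (rfl | rfl | rfl)
        exacts [orient_self_left _ _, orient_self_right _ _, ho.symm]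
      · intro p hp r hr s t _ _ hst
        rw [Set.mem_ofPred_eq] at hp hr ⊢
        rw [orient_combo _ _ _ _ hst, hp, hr, mul_zero, mul_zero, add_zero]
    obtain ⟨p, hp, hlt⟩ := exists_orient_lt isOpen_interior hmem (ne_of_adj hab)
    rw [show orient a b q = 0 from hsub (interior_subset hmem),
      show orient a b p = 0 from hsub (interior_subset hp)] at hlt
    exact lt_irrefl _ hlt
  · refine ⟨b, a, c, ⟨T.symm _ _ hab, hac, T.symm _ _ hbc, ?_, ?_⟩, ?_⟩
    · rw [orient_swap]
      linarith
    · rwa [openTriangle_swap]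
    · rwa [openTriangle_swap]

end PlaneGraph

lemma isPreconnected_compl_closedBall_prod {R : ℝ} (hR : 0 ≤ R) :
    IsPreconnected (Metric.closedBall (0 : ℝ × ℝ) R)ᶜ := by
  have hrank : 1 < Module.rank ℝ (ℝ × ℝ) := by
    rw [rank_prod', Module.rank_self]
    norm_num
  have himage : (Metric.closedBall (0 : ℝ × ℝ) R)ᶜ =
      (fun p : (ℝ × ℝ) × ℝ => p.2 • p.1) '' (Metric.sphere (0 : ℝ × ℝ) 1 ×ˢ Set.Ioi R) := by
    ext q
    simp only [Set.mem_compl_iff, mem_closedBall_zero_iff, not_le, Set.mem_image, Set.mem_prod,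
      mem_sphere_zero_iff_norm, Set.mem_Ioi]
    constructor
    · intro hq
      have hq0 : ‖q‖ ≠ 0 := (hR.trans_lt hq).ne'
      refine ⟨(‖q‖⁻¹ • q, ‖q‖), ⟨?_, hq⟩, ?_⟩
      · rw [norm_smul, norm_inv, norm_norm, inv_mul_cancel₀ hq0]
      · rw [smul_smul, mul_inv_cancel₀ hq0, one_smul]
    · rintro ⟨⟨v, t⟩, ⟨hv, ht⟩, rfl⟩
      rw [norm_smul, hv, mul_one]
      exact ht.trans_le (le_abs_self t)
  rw [himage]
  exact ((isPreconnected_sphere hrank 0 1).prod isPreconnected_Ioi).image _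
    (by fun_prop)

namespace PlaneGraph

variable {T : PlaneGraph}

/-- An even edge set of `T`, as a symmetric mod 2 chain. -/
structure IsCycleChain (T : PlaneGraph) (ζ : ℝ × ℝ → ℝ × ℝ → ZMod 2) : Prop where
  symm : ∀ x y, ζ x y = ζ y x
  adj : ∀ x y, ζ x y ≠ 0 → T.Adj x y
  sum_eq_zero : ∀ x, ∑ y ∈ T.verts, ζ x y = 0

variable {s : ℝ} {ζ : ℝ × ℝ → ℝ × ℝ → ZMod 2}

lemma height_ne (hs : Set.InjOn (height s) T.verts) {x y : ℝ × ℝ} (h : T.Adj x y) :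
    height s x ≠ height s y := fun he =>
  ne_of_adj h (hs (T.mem_of_adj _ _ h).1 (T.mem_of_adj _ _ h).2 he)

lemma IsCycleChain.parity_eq (hζ : T.IsCycleChain ζ) (hs : Set.InjOn (height s) T.verts)
    {S : Set (ℝ × ℝ)} (hS : IsPreconnected S) (hd : S ⊆ T.drawingᶜ) {p q : ℝ × ℝ} (hp : p ∈ S)
    (hq : q ∈ S) : parity s T.verts ζ p = parity s T.verts ζ q := by
  refine hS.induction₂ (fun p q => parity s T.verts ζ p = parity s T.verts ζ q) ?_ ?_ ?_ hp hq
  · intro p hp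
    filter_upwards [mem_nhdsWithin_of_mem_nhds (eventually_parity_eq hζ.symm
      (fun x y h => height_ne hs (hζ.adj x y h))
      (fun x y h hpxy => hd hp ⟨x, y, hζ.adj x y h, hpxy⟩)
      (fun x _ _ => hζ.sum_eq_zero x))] with q hq
    exact hq.symm
  · exact fun x y z _ _ _ h1 h2 => h1.trans h2
  · exact fun x y _ _ h => h.symm

lemma IsCycleChain.parity_eq_zero (hζ : T.IsCycleChain ζ) (hs : Set.InjOn (height s) T.verts)
    {S : Set (ℝ × ℝ)} (hS : IsPreconnected S) (hd : S ⊆ T.drawingᶜ) (hb : ¬ Bornology.IsBounded S)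
    {p : ℝ × ℝ} (hp : p ∈ S) : parity s T.verts ζ p = 0 := by
  obtain ⟨R, hR⟩ := (T.verts.finite_toSet.isBounded).subset_closedBall (0 : ℝ × ℝ)
  obtain ⟨M, hM⟩ := (T.verts.finite_toSet.image (height s)).bddBelow
  have hR' : (T.verts : Set (ℝ × ℝ)) ⊆ Metric.closedBall 0 (max R 0) :=
    hR.trans (Metric.closedBall_subset_closedBall (le_max_left _ _))
  have hU : (Metric.closedBall (0 : ℝ × ℝ) (max R 0))ᶜ ⊆ T.drawingᶜ := by
    rw [Set.compl_subset_compl]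
    rintro x ⟨a, b, hab, hx⟩
    exact (convex_closedBall _ _).segment_subset (hR' (T.mem_of_adj a b hab).1)
      (hR' (T.mem_of_adj a b hab).2) hx
  obtain ⟨q, hqS, hq⟩ := Set.not_subset.1 fun h : S ⊆ Metric.closedBall 0 (max R 0) =>
    hb (Metric.isBounded_closedBall.subset h)
  have hlow : ((-(max R 0 + |M| + 1), 0) : ℝ × ℝ) ∈
      (Metric.closedBall (0 : ℝ × ℝ) (max R 0))ᶜ := by
    rw [Set.mem_compl_iff, mem_closedBall_zero_iff, not_le]
    refine lt_of_lt_of_le ?_ (norm_fst_le _)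
    rw [norm_neg, Real.norm_of_nonneg (by positivity)]
    have := abs_nonneg M
    linarith
  rw [hζ.parity_eq hs hS hd hp hqS, hζ.parity_eq hs
    (isPreconnected_compl_closedBall_prod (le_max_right _ _)) hU hq hlow]
  refine _root_.parity_eq_zero fun x hx => ?_
  refine lt_of_lt_of_le ?_ (hM ⟨x, hx, rfl⟩)
  have h1 := neg_abs_le M
  have h2 := le_max_right R 0
  simp only [height, mul_zero, add_zero]
  linarith

lemma IsCycleChain.eventually_parity_add (hE : T.IsEmbedded) (hζ : T.IsCycleChain ζ)
    (hs : Set.InjOn (height s) T.verts) {x y : ℝ × ℝ} (hxy : T.Adj x y) :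
    ∃ c, (∀ᶠ q in leftNhds x y, parity s T.verts ζ q = c) ∧
      ∀ᶠ q in leftNhds y x, parity s T.verts ζ q = c + ζ x y := by
  have hne := height_ne hs hxy
  have hx := (T.mem_of_adj _ _ hxy).1
  have hy := (T.mem_of_adj _ _ hxy).2
  set m := midpoint ℝ x y with hm
  have hhm : height s m = (height s x + height s y) / 2 := by
    rw [hm, midpoint_eq_smul_add]
    simp only [height, Prod.smul_fst, Prod.smul_snd, Prod.fst_add, Prod.snd_add, smul_eq_mul,
      invOf_eq_inv]
    ring
  have hxm : height s x ≠ height s m := fun h => hne (by linarith)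
  have hym : height s y ≠ height s m := fun h => hne (by linarith)
  have hbetween : ¬ (height s x ≤ height s m ↔ height s y ≤ height s m) := by
    rcases lt_or_gt_of_ne hne with h | h
    · exact fun h' => absurd (h'.1 (by linarith)) (by linarith)
    · exact fun h' => absurd (h'.2 (by linarith)) (by linarith)
  set ζ' : ℝ × ℝ → ℝ × ℝ → ZMod 2 := fun a b =>
    ζ a b + ζ x y * TriangulatedDisk.edgeChain x y a b with hζ'
  have hadj : ∀ a b, ζ' a b ≠ 0 → T.Adj a b ∧ ¬ (x = a ∧ y = b ∨ x = b ∧ y = a) := by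
    intro a b h
    by_cases hc : x = a ∧ y = b ∨ x = b ∧ y = a
    · refine absurd ?_ h
      have hab : ζ a b = ζ x y := by
        rcases hc with ⟨rfl, rfl⟩ | ⟨rfl, rfl⟩
        exacts [rfl, hζ.symm _ _]
      simp only [hζ']
      rw [hab, TriangulatedDisk.edgeChain, if_pos (by tauto), mul_one]
      exact CharTwo.add_self_eq_zero _
    · refine ⟨hζ.adj a b fun h0 => h ?_, hc⟩
      simp only [hζ']
      rw [h0, TriangulatedDisk.edgeChain, if_neg (by tauto), mul_zero, add_zero]
  have hconst : ∀ᶠ q in nhds m, parity s T.verts ζ' q = parity s T.verts ζ' m := by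
    refine eventually_parity_eq (fun a b => ?_) (fun a b h => height_ne hs (hadj a b h).1)
      (fun a b h hmab => (hadj a b h).2 (eq_of_midpoint_mem_segment hE hxy (hadj a b h).1 hmab))
      (fun v _ hvm => ?_)
    · simp only [hζ', hζ.symm a b, TriangulatedDisk.edgeChain_symm x y a b]
    · simp only [hζ', Finset.sum_add_distrib, ← Finset.mul_sum, hζ.sum_eq_zero,
        TriangulatedDisk.sum_edgeChain hx hy (ne_of_adj hxy)]
      rw [if_neg (by rintro rfl; exact hxm hvm), if_neg (by rintro rfl; exact hym hvm)]
      simp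
  have hpar : ∀ᶠ q in nhds m, parity s T.verts ζ q =
      parity s T.verts ζ' m + ζ x y * lowerSide s x y q := by
    filter_upwards [hconst, eventually_le_height_iff hxm, eventually_le_height_iff hym]
      with q h1 h2 h3
    rw [← h1, ← parity_edge hx hy (ne_of_adj hxy) (by rwa [h2, h3]), ← parity_add]
    congr 1
    funext a b
    rw [hζ', add_assoc, CharTwo.add_self_eq_zero, add_zero]
  refine ⟨parity s T.verts ζ' m + ζ x y * (if height s y - height s x < 0 then 1 else 0),
    ?_, ?_⟩
  · filter_upwards [leftNhds_le x y hpar, eventually_leftNhds] with q h1 h2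
    rw [h1, lowerSide]
    simp only [mul_neg_iff, h2, h2.not_gt, true_and, false_and, or_false]
  · filter_upwards [leftNhds_swap_le x y hpar, eventually_leftNhds] with q h1 h2
    rw [orient_swap] at h2
    have h3 : orient x y q < 0 := by linarith
    rw [h1, lowerSide]
    simp only [mul_neg_iff, h3, h3.not_gt, true_and, false_and, false_or]
    rcases lt_or_gt_of_ne (sub_ne_zero.2 hne.symm) with h | h
    · rw [if_neg h.not_gt, if_pos h, mul_one, mul_zero, add_assoc, CharTwo.add_self_eq_zero]
    · rw [if_pos h, if_neg h.not_gt, mul_one, mul_zero, add_zero]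

end PlaneGraph

namespace PlaneGraph

variable {T : PlaneGraph}

/-- Close to its midpoint, the left side of an edge belongs either to an unbounded face or to a
triangular face with this edge as a side. -/
lemma exists_isEmptyTriangle_of_isBounded (hE : T.IsEmbedded) (hF : T.InnerFacesTriangles)
    {x y q : ℝ × ℝ} (hxy : T.Adj x y) {U : Set (ℝ × ℝ)} (hU : U ∈ leftNhds x y) (hc : Convex ℝ U)
    (hd : U ⊆ T.drawingᶜ) (ho : ∀ q ∈ U, 0 < orient x y q) (hq : q ∈ U)
    (hb : Bornology.IsBounded (connectedComponentIn T.drawingᶜ q)) :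
    ∃ z, T.IsEmptyTriangle x y z := by
  obtain ⟨a, b, c, h, heq⟩ := exists_isEmptyTriangle_of_isFace hF (hd hq) hb
  have hsub : U ⊆ openTriangle a b c := heq ▸ hc.isPreconnected.subset_connectedComponentIn hq hd
  have := leftNhds_neBot (ne_of_adj hxy)
  have hm : midpoint ℝ x y ∈ closure (openTriangle a b c) :=
    isClosed_closure.mem_of_tendsto (Filter.tendsto_id'.2 (leftNhds_le x y))
      (Filter.mem_of_superset hU (hsub.trans subset_closure))
  have key : ∀ a b c, T.IsEmptyTriangle a b c → U ⊆ openTriangle a b c →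
      midpoint ℝ x y ∈ segment ℝ a b → ∃ z, T.IsEmptyTriangle x y z := by
    intro a b c h hsub hab
    rcases eq_of_midpoint_mem_segment hE hxy h.1 hab with ⟨rfl, rfl⟩ | ⟨rfl, rfl⟩
    · exact ⟨c, h⟩
    · have h1 := hsub hq
      rw [openTriangle_eq h.2.2.2.1, Set.mem_ofPred_eq, orient_swap] at h1
      have := ho q hq
      linarith [h1.1]
  rcases h.mem_side hm ⟨x, y, hxy, midpoint_mem_segment x y⟩ with h1 | h1 | h1
  · exact key a b c h hsub h1
  · exact key b c a h.rotate (by rwa [openTriangle_rotate]) h1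
  · exact key c a b h.rotate.rotate (by rwa [openTriangle_rotate, openTriangle_rotate]) h1

lemma IsNearTriangulation.connected_delete (hT : T.IsNearTriangulation) (c : ℝ × ℝ)
    (K : Set (ℝ × ℝ)) (hK : ∀ x ∈ K, x ∈ T.verts) (hcK : c ∉ K) (hne : K.Nonempty)
    (hstep : ∀ x ∈ K, ∀ y, T.Adj x y → y ≠ c → y ∈ K) (y : ℝ × ℝ) (hy : y ∈ T.verts)
    (hyc : y ≠ c) : y ∈ K := by
  obtain ⟨x, hx⟩ := hne
  have hxc : x ≠ c := fun h => hcK (h ▸ hx)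
  by_cases hc : c ∈ T.verts
  · have hr := (hT.2.1.2.2 c hc).2 x
      (Finset.mem_sdiff.2 ⟨hK x hx, by simpa using hxc⟩) y
      (Finset.mem_sdiff.2 ⟨hy, by simpa using hyc⟩)
    clear hy hyc
    induction hr with
    | refl => exact hx
    | tail _ hab ih => exact hstep _ ih _ hab.1 (by simpa using hab.2.2)
  · have hr := hT.2.1.2.1.2 x (hK x hx) y hy
    clear hy hyc
    induction hr with
    | refl => exact hx
    | tail _ hab ih =>
      exact hstep _ ih _ hab fun h => hc (h ▸ (T.mem_of_adj _ _ hab).2)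

lemma IsNearTriangulation.exists_bounding (hT : T.IsNearTriangulation)
    {ζ : ℝ × ℝ → ℝ × ℝ → ZMod 2} (hζ : T.IsCycleChain ζ) :
    ∃ φ : ℝ × ℝ → ℝ × ℝ → ZMod 2,
      (∀ x y, T.Adj x y → (∀ z, ¬ T.IsEmptyTriangle x y z) → φ x y = 0) ∧
      (∀ x y z, T.IsEmptyTriangle x y z → φ x y = φ y z) ∧
      (∀ x y, T.Adj x y → φ x y + φ y x = ζ x y) := by
  obtain ⟨hE, -, hF⟩ := hT
  obtain ⟨s, hs⟩ := exists_injOn_height T.verts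
  have hφ : ∀ x y, ∃ c, T.Adj x y → (∀ᶠ q in leftNhds x y, parity s T.verts ζ q = c) ∧
      ∀ᶠ q in leftNhds y x, parity s T.verts ζ q = c + ζ x y := by
    intro x y
    by_cases hxy : T.Adj x y
    · obtain ⟨c, hc⟩ := hζ.eventually_parity_add hE hs hxy
      exact ⟨c, fun _ => hc⟩
    · exact ⟨0, fun h => absurd h hxy⟩
  choose φ hφ using hφ
  refine ⟨φ, fun x y hxy hno => ?_, fun x y z h => ?_, fun x y hxy => ?_⟩
  · obtain ⟨U, hU, hc, hd, ho⟩ := exists_convex_mem_leftNhds hE hxy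
    have := leftNhds_neBot (ne_of_adj hxy)
    obtain ⟨q, hq, hqU⟩ := ((hφ x y hxy).1.and hU).exists
    rw [← hq]
    refine hζ.parity_eq_zero hs isPreconnected_connectedComponentIn
      (connectedComponentIn_subset _ _) (fun hb => ?_) (mem_connectedComponentIn (hd hqU))
    obtain ⟨z, hz⟩ := exists_isEmptyTriangle_of_isBounded hE hF hxy hU hc hd ho hqU hb
    exact hno z hz
  · have h1 := leftNhds_neBot (ne_of_adj h.1)
    have h2 := leftNhds_neBot (ne_of_adj h.2.1)
    obtain ⟨p, hp, hpT⟩ := ((hφ x y h.1).1.and (eventually_mem_openTriangle h.2.2.2.1)).exists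
    obtain ⟨q, hq, hqT⟩ :=
      ((hφ y z h.2.1).1.and (eventually_mem_openTriangle h.rotate.2.2.2.1)).exists
    rw [openTriangle_rotate] at hqT
    rw [← hp, ← hq]
    exact hζ.parity_eq hs (convex_openTriangle x y z).isPreconnected
      (fun r hr => Set.disjoint_left.1 h.2.2.2.2 hr) hpT hqT
  · have := leftNhds_neBot (ne_of_adj hxy).symm
    obtain ⟨q, hq, hq'⟩ := ((hφ x y hxy).2.and (hφ y x (T.symm _ _ hxy)).1).exists
    rw [← hq', hq, ← add_assoc, CharTwo.add_self_eq_zero, zero_add]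

/-- The combinatorial disk underlying a near-triangulation. -/
def IsNearTriangulation.toTriangulatedDisk (hT : T.IsNearTriangulation) :
    TriangulatedDisk (ℝ × ℝ) where
  verts := T.verts
  Adj := T.Adj
  Tri := T.IsEmptyTriangle
  adj_symm h := T.symm _ _ h
  adj_irrefl := T.loopless
  adj_mem h := (T.mem_of_adj _ _ h).1
  tri_adj h := h.1
  tri_rotate h := h.rotate
  tri_unique h h' := h.unique hT.1 h'
  connected_delete := hT.connected_delete
  bounding _ h1 h2 h3 := hT.exists_bounding ⟨h1, h2, h3⟩

lemma IsNearTriangulation.outer_of_midpoint_mem_closure (hT : T.IsNearTriangulation) {x y : ℝ × ℝ}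
    (hxy : T.Adj x y) (hm : midpoint ℝ x y ∈ closure T.outerRegion) :
    hT.toTriangulatedDisk.Outer x y ∨ hT.toTriangulatedDisk.Outer y x := by
  by_contra hcon
  have hx : ∃ z, T.IsEmptyTriangle x y z := by
    by_contra h
    exact hcon (Or.inl ⟨hxy, not_exists.1 h⟩)
  have hy : ∃ z, T.IsEmptyTriangle y x z := by
    by_contra h
    exact hcon (Or.inr ⟨T.symm _ _ hxy, not_exists.1 h⟩)
  obtain ⟨z, hz⟩ := hx
  obtain ⟨w, hw⟩ := hy
  have hbdd : ∀ a b c, Bornology.IsBounded (openTriangle a b c) := fun a b c =>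
    ((isBounded_convexHull (s := ({a, b, c} : Set (ℝ × ℝ)))).2
      (Set.toFinite _).isBounded).subset interior_subset
  have hw' := eventually_orient_pos_sides hw.2.2.2.1
  rw [midpoint_comm] at hw'
  refine mem_closure_iff_frequently.1 hm ?_
  filter_upwards [eventually_orient_pos_sides hz.2.2.2.1, hw'] with q h1 h2
  rintro ⟨hqd, hqb⟩
  rcases lt_trichotomy 0 (orient x y q) with h3 | h3 | h3
  · refine hqb ?_
    rw [hz.component_eq (by rw [openTriangle_eq hz.2.2.2.1]; exact ⟨h3, h1⟩)]
    exact hbdd _ _ _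
  · exact hqd ⟨x, y, hxy, mem_segment_of_orient_eq_zero hz.2.2.2.1 h3.symm h1.1.le h1.2.le⟩
  · refine hqb ?_
    have h4 : 0 < orient y x q := by
      rw [orient_swap]
      linarith
    rw [hw.component_eq (by rw [openTriangle_eq hw.2.2.2.1]; exact ⟨h4, h2⟩)]
    exact hbdd _ _ _

end PlaneGraph

/-- Let `T` be a near-triangulation of order `n ≥ 5` with boundary cycle
`C = (u_1, …, u_h, u_1)`, and let `u_i` be a boundary vertex.  If all neighbors of `u_i` lie
on `C`, then both boundary edges `(u_{i-1}, u_i)` and `(u_i, u_{i+1})` are contractible. -/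
theorem boundary_edges_contractible_of_all_neighbors_on_cycle (T : PlaneGraph) (h : ℕ)
    (u : ZMod h → ℝ × ℝ) (i : ZMod h)
    (hT : T.IsNearTriangulation) (hu : T.IsBoundaryCycle u) (hn : 5 ≤ T.verts.card)
    (hall : ∀ w, T.Adj (u i) w → w ∈ Set.range u) :
    T.IsContractible (u (i - 1)) (u i) ∧ T.IsContractible (u i) (u (i + 1)) := by
  obtain ⟨h3, hinj, -, hadj, hfr, -⟩ := hu
  have houter : ∀ j, hT.toTriangulatedDisk.Outer (u j) (u (j + 1)) ∨
      hT.toTriangulatedDisk.Outer (u (j + 1)) (u j) := fun j =>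
    hT.outer_of_midpoint_mem_closure (hadj j)
      (frontier_subset_closure (hfr j (midpoint_mem_segment _ _)))
  have hnext := houter i
  have hprev : hT.toTriangulatedDisk.Outer (u i) (u (i - 1)) ∨
      hT.toTriangulatedDisk.Outer (u (i - 1)) (u i) := by
    have := houter (i - 1)
    rw [sub_add_cancel] at this
    exact this.symm
  have hne : u (i + 1) ≠ u (i - 1) := by
    intro heq
    have h2 : ((2 : ℕ) : ZMod h) = 0 := by
      push_cast
      linear_combination hinj heq
    have := Nat.le_of_dvd two_pos ((ZMod.natCast_eq_zero_iff 2 h).1 h2)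
    omega
  have hall' : ∀ q, T.Adj (u i) q → ∃ q', hT.toTriangulatedDisk.Outer q q' ∨
      hT.toTriangulatedDisk.Outer q' q := by
    intro q hq
    obtain ⟨j, rfl⟩ := hall q hq
    exact ⟨u (j + 1), houter j⟩
  have hcard : 4 ≤ T.verts.card := by omega
  exact ⟨(PlaneGraph.isContractible_of_outer hT.toTriangulatedDisk rfl rfl hcard hprev hnext
      hne.symm hall').symm,
    PlaneGraph.isContractible_of_outer hT.toTriangulatedDisk rfl rfl hcard hnext hprev hne hall'⟩
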